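/- Let γ be a symmetrical graph (possibly with loops) on I = {1,2,3,4,5,6}. Then every 2-connected claw-o-heavy and P6-γ-heavy graph is hamiltonian if and only if γ is a subgraph of γ1, γ2 or γ3, where E(γ1) = {14,15,16,24,25,26,34,35,36}, E(γ2) = {11,12,14,15,16,25,26,36,56,66}, and E(γ3) = {13,14,15,25,26,36,46}. -/

import Mathlib

/-- A graph is 2-connected if it has at least 3 vertices and deleting any
single vertex leaves a connected graph. -/
def TwoConnected {V : Type*} [Fintype V] (G : SimpleGraph V) : Prop :=
  3 ≤ Fintype.card V ∧ ∀ v : V, (G.induce ({v}ᶜ : Set V)).Connected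

/-- A graph `G` of order `n` is claw-o-heavy if every induced copy of the claw `K_{1,3}`
(with center `a` and leaves `b₁, b₂, b₃`) contains two nonadjacent vertices whose
degree sum in `G` is at least `n`. -/
def ClawOHeavy {V : Type*} [Fintype V] (G : SimpleGraph V) [DecidableRel G.Adj] : Prop :=
  ∀ a b₁ b₂ b₃ : V, b₁ ≠ b₂ → b₁ ≠ b₃ → b₂ ≠ b₃ →
    G.Adj a b₁ → G.Adj a b₂ → G.Adj a b₃ →
    ¬ G.Adj b₁ b₂ → ¬ G.Adj b₁ b₃ → ¬ G.Adj b₂ b₃ →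
    ∃ u v : V, u ∈ ({a, b₁, b₂, b₃} : Set V) ∧ v ∈ ({a, b₁, b₂, b₃} : Set V) ∧
      u ≠ v ∧ ¬ G.Adj u v ∧ Fintype.card V ≤ G.degree u + G.degree v

/-- `v 0, v 1, …, v 5` is an induced path on 6 vertices in `G`. -/
def IsInducedP6 {V : Type*} (G : SimpleGraph V) (v : Fin 6 → V) : Prop :=
  Function.Injective v ∧
    ∀ i j : Fin 6, G.Adj (v i) (v j) ↔ (i.val + 1 = j.val ∨ j.val + 1 = i.val)

/- The paper indexes the vertices of `P₆` by `I = {1,…,6}`; here we use `Fin 6 = {0,…,5}`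
(so paper-index `i` corresponds to `i - 1 : Fin 6`).  A graph (possibly with loops) on `I`
is modelled as a set of unordered pairs (`Sym2 (Fin 6)`); a loop at `i` is `s(i, i)`. -/

/-- `γ` is symmetrical: `ij ∈ E(γ)` iff `(7-i)(7-j) ∈ E(γ)` (in `Fin 6` terms,
the map `i ↦ 7 - i` on `{1,…,6}` is `Fin.rev : i ↦ 5 - i`). -/
def SymmetricalGamma (γ : Set (Sym2 (Fin 6))) : Prop :=
  ∀ e : Sym2 (Fin 6), e ∈ γ ↔ e.map Fin.rev ∈ γ

/-- A graph `G` of order `n` is `P₆`-`γ`-heavy if for every induced path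
`v 0, …, v 5` on 6 vertices there is an edge (or loop) `ij` of `γ` with
`d(v i) + d(v j) ≥ n`. -/
def P6GammaHeavy {V : Type*} [Fintype V] (G : SimpleGraph V) [DecidableRel G.Adj]
    (γ : Set (Sym2 (Fin 6))) : Prop :=
  ∀ v : Fin 6 → V, IsInducedP6 G v →
    ∃ i j : Fin 6, s(i, j) ∈ γ ∧ Fintype.card V ≤ G.degree (v i) + G.degree (v j)

/-- `γ₁`, with paper edge set `{14,15,16,24,25,26,34,35,36}`. -/
def gamma1 : Set (Sym2 (Fin 6)) :=
  {s(0,3), s(0,4), s(0,5), s(1,3), s(1,4), s(1,5), s(2,3), s(2,4), s(2,5)}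

/-- `γ₂`, with paper edge set `{11,12,14,15,16,25,26,36,56,66}`. -/
def gamma2 : Set (Sym2 (Fin 6)) :=
  {s(0,0), s(0,1), s(0,3), s(0,4), s(0,5), s(1,4), s(1,5), s(2,5), s(4,5), s(5,5)}

/-- `γ₃`, with paper edge set `{13,14,15,25,26,36,46}`. -/
def gamma3 : Set (Sym2 (Fin 6)) :=
  {s(0,2), s(0,3), s(0,4), s(1,4), s(1,5), s(2,5), s(3,5)}

section Lists

variable {α : Type*}

/-- `l` is a nonempty `R`-chain from `u` to `v`. -/
def Seg (R : α → α → Prop) (u v : α) (l : List α) : Prop :=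
  l.IsChain R ∧ l.head? = some u ∧ l.getLast? = some v

theorem Seg.singleton {R : α → α → Prop} (u : α) : Seg R u u [u] := by
  simp [Seg]

theorem Seg.append {R : α → α → Prop} {u v u' v' : α} {l l' : List α}
    (h : Seg R u v l) (h' : Seg R u' v' l') (hr : R v u') : Seg R u v' (l ++ l') := by
  obtain ⟨h1, h2, h3⟩ := h
  obtain ⟨h1', h2', h3'⟩ := h'
  refine ⟨List.isChain_append.2 ⟨h1, h1', ?_⟩, ?_, ?_⟩
  · intro x hx y hy
    simp_all
  · simp [h2]
  · simp [h3']

theorem Seg.cons {R : α → α → Prop} {u u' v' : α} {l' : List α}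
    (hr : R u u') (h' : Seg R u' v' l') : Seg R u v' (u :: l') :=
  (Seg.singleton u).append h' hr

theorem Seg.reverse {R : α → α → Prop} (hs : ∀ a b, R a b → R b a) {u v : α} {l : List α}
    (h : Seg R u v l) : Seg R v u l.reverse := by
  obtain ⟨h1, h2, h3⟩ := h
  refine ⟨List.isChain_reverse.2 (h1.imp fun a b => hs a b), ?_, ?_⟩
  · simp [h3]
  · simp [h2]

theorem Seg.mono {R R' : α → α → Prop} (hs : ∀ a b, R a b → R' a b) {u v : α} {l : List α}
    (h : Seg R u v l) : Seg R' u v l :=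
  ⟨h.1.imp hs, h.2⟩

theorem Seg.ne_nil {R : α → α → Prop} {u v : α} {l : List α} (h : Seg R u v l) : l ≠ [] := by
  rintro rfl
  simp [Seg] at h

theorem Seg.head_mem {R : α → α → Prop} {u v : α} {l : List α} (h : Seg R u v l) : u ∈ l :=
  List.mem_of_head? h.2.1

theorem Seg.last_mem {R : α → α → Prop} {u v : α} {l : List α} (h : Seg R u v l) : v ∈ l :=
  List.mem_of_getLast? h.2.2

/-- Splitting a chain. -/
theorem Seg.split {R : α → α → Prop} {u v : α} {l l' : List α} (h : Seg R u v (l ++ l'))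
    (hl : l ≠ []) (hl' : l' ≠ []) :
    ∃ a b, Seg R u a l ∧ Seg R b v l' ∧ R a b := by
  obtain ⟨h1, h2, h3⟩ := h
  obtain ⟨h4, h5, h6⟩ := List.isChain_append.1 h1
  have e1 : l.getLast? = some (l.getLast hl) := List.getLast?_eq_some_getLast hl
  have e2 : l'.head? = some (l'.head hl') := List.head?_eq_some_head hl'
  refine ⟨l.getLast hl, l'.head hl', ⟨h4, ?_, e1⟩, ⟨h5, e2, ?_⟩, h6 _ (by simp [e1]) _ (by simp [e2])⟩
  · rw [List.head?_append_of_ne_nil _ hl] at h2; exact h2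
  · rw [List.getLast?_append_of_ne_nil _ hl'] at h3; exact h3

/-- Splitting a chain at a vertex which is neither the first nor the last one. -/
theorem Seg.split_at {R : α → α → Prop} {u v x : α} {l : List α} (h : Seg R u v l)
    (hx : x ∈ l) (hu : x ≠ u) (hv : x ≠ v) :
    ∃ P Q a b, l = P ++ x :: Q ∧ Seg R u a P ∧ R a x ∧ R x b ∧ Seg R b v Q := by
  obtain ⟨P, Q, rfl⟩ := List.append_of_mem hx
  have hP : P ≠ [] := by
    rintro rfl
    exact hu (by simpa using h.2.1)
  have hQ : Q ≠ [] := by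
    rintro rfl
    exact hv (by simpa using h.2.2)
  obtain ⟨a, b, h1, h2, h3⟩ := h.split hP (by simp)
  have hb : b = x := by simpa using h2.2.1.symm
  subst hb
  obtain ⟨c, d, h4, h5, h6⟩ := Seg.split (l := [b]) (l' := Q) h2 (by simp) hQ
  have hc : c = b := by simpa using h4.2.2.symm
  subst hc
  exact ⟨P, Q, a, d, rfl, h1, h3, h6, h5⟩

theorem Seg.eq_singleton {R : α → α → Prop} {u v : α} {l : List α} (h : Seg R u v l)
    (hn : l.Nodup) (huv : u = v) : l = [u] := by
  subst huv
  obtain ⟨h1, h2, h3⟩ := h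
  cases l with
  | nil => simp at h2
  | cons a t =>
    simp only [List.head?_cons, Option.some.injEq] at h2
    subst h2
    by_contra hne
    have ht : t ≠ [] := by rintro rfl; simp at hne
    have : (a :: t).getLast? = t.getLast? := by
      rw [show a :: t = [a] ++ t from rfl, List.getLast?_append_of_ne_nil _ ht]
    rw [this] at h3
    exact (List.nodup_cons.1 hn).1 (List.mem_of_getLast? h3)

/-- `l` lists the vertices of a closed `R`-chain. -/
def IsCyc (R : α → α → Prop) (l : List α) : Prop :=
  ∃ u v, Seg R u v l ∧ R v u

theorem IsCyc.rotate {R : α → α → Prop} {l l' : List α} (h : IsCyc R (l ++ l')) :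
    IsCyc R (l' ++ l) := by
  rcases eq_or_ne l [] with rfl | hl
  · simpa using h
  rcases eq_or_ne l' [] with rfl | hl'
  · simpa using h
  obtain ⟨u, v, h1, h2⟩ := h
  obtain ⟨a, b, h3, h4, h5⟩ := h1.split hl hl'
  exact ⟨b, a, h4.append h3 h2, h5⟩

theorem IsCyc.mono {R R' : α → α → Prop} (hs : ∀ a b, R a b → R' a b) {l : List α}
    (h : IsCyc R l) : IsCyc R' l := by
  obtain ⟨u, v, h1, h2⟩ := h
  exact ⟨u, v, h1.mono hs, hs _ _ h2⟩

/-- There is a cyclic list running exactly once through each element of `S`. -/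
def HamOn (R : α → α → Prop) (S : Set α) : Prop :=
  ∃ l : List α, l.Nodup ∧ (∀ v, v ∈ l ↔ v ∈ S) ∧ 3 ≤ l.length ∧ IsCyc R l

theorem HamOn.of_perm {R : α → α → Prop} {S : Set α} {l l' : List α} (hn : l.Nodup)
    (hm : ∀ v, v ∈ l ↔ v ∈ S) (hl : 3 ≤ l.length) (hp : l'.Perm l) {u v : α} (hs : Seg R u v l')
    (hr : R v u) : HamOn R S :=
  ⟨l', hp.nodup_iff.2 hn, fun v => by rw [hp.mem_iff, hm], by rw [hp.length_eq]; exact hl,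
    u, v, hs, hr⟩

theorem exists_split_of_not_isChain {R : α → α → Prop} {l : List α} (h : ¬ l.IsChain R) :
    ∃ l₁ a b l₂, l = l₁ ++ a :: b :: l₂ ∧ ¬ R a b := by
  induction l with
  | nil => simp at h
  | cons a t ih =>
    cases t with
    | nil => simp at h
    | cons b t =>
      by_cases hab : R a b
      · have : ¬ (b :: t).IsChain R := fun hc => h (List.isChain_cons_cons.2 ⟨hab, hc⟩)
        obtain ⟨l₁, c, d, l₂, e, hcd⟩ := ih this
        exact ⟨a :: l₁, c, d, l₂, by simp [e], hcd⟩
      · exact ⟨[], a, b, t, rfl, hab⟩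

theorem IsCyc.of_add_edge {R R' : α → α → Prop} (hs : ∀ a b, R a b → R b a) {u v : α}
    (hR : ∀ a b, R' a b → R a b ∨ (a = u ∧ b = v) ∨ (a = v ∧ b = u)) {l : List α}
    (hn : l.Nodup) (hl : 3 ≤ l.length) (h : IsCyc R' l) :
    IsCyc R l ∨ ∃ l', l'.Perm l ∧ Seg R u v l' := by
  -- a chain whose ends are the two special vertices is already an `R`-chain
  have key : ∀ (a b : α) (m : List α), m.Nodup → 3 ≤ m.length → Seg R' b a m →
      ((a = u ∧ b = v) ∨ (a = v ∧ b = u)) → ∃ l', l'.Perm m ∧ Seg R u v l' := by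
    intro a b m hn hl hm hab
    have hc : m.IsChain R := by
      by_contra hc
      obtain ⟨l₁, c, d, l₂, rfl, hcd⟩ := exists_split_of_not_isChain hc
      have h1 : R' c d := by
        have := hm.1
        rw [List.isChain_append_cons_cons] at this
        exact this.2.1
      have h2 : (c = b ∧ d = a) ∨ (c = a ∧ d = b) := by
        rcases hR _ _ h1 with h | h | h
        · exact absurd h hcd
        · rcases hab with h' | h' <;> grind
        · rcases hab with h' | h' <;> grind
      obtain ⟨-, h3, h4⟩ := hm
      rcases h2 with ⟨rfl, rfl⟩ | ⟨rfl, rfl⟩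
      · have : l₁ = [] := by
          cases l₁ with
          | nil => rfl
          | cons e t => simp at h3; subst h3; simp at hn
        subst this
        have : l₂ = [] := by
          rcases List.eq_nil_or_concat l₂ with h | ⟨t, e, rfl⟩
          · exact h
          · have h5 : ((c :: d :: t) ++ [e]).getLast? = some e := List.getLast?_concat ..
            have h6 : ((c :: d :: t) ++ [e]).getLast? = some d := by
              rw [← h4]; simp [List.concat_eq_append]
            have h7 : e = d := by simpa using h5.symm.trans h6
            subst h7
            simp at hn
        subst this
        simp at hl
      · cases l₁ with
        | nil => simp at h3; subst h3; simp at hn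
        | cons e t => simp at h3; subst h3; simp at hn
    have hm' : Seg R b a m := ⟨hc, hm.2⟩
    rcases hab with ⟨rfl, rfl⟩ | ⟨rfl, rfl⟩
    · exact ⟨m.reverse, List.reverse_perm m, hm'.reverse hs⟩
    · exact ⟨m, List.Perm.refl _, hm'⟩
  obtain ⟨p, q, h1, h2⟩ := h
  by_cases hc : l.IsChain R
  · by_cases hqp : R q p
    · exact Or.inl ⟨p, q, ⟨hc, h1.2⟩, hqp⟩
    · exact Or.inr (key q p l hn hl h1 ((hR _ _ h2).resolve_left hqp))
  · right
    obtain ⟨l₁, a, b, l₂, rfl, hab⟩ := exists_split_of_not_isChain hc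
    have h3 : R' a b := by
      have := h1.1
      rw [List.isChain_append_cons_cons] at this
      exact this.2.1
    have e : l₁ ++ a :: b :: l₂ = (l₁ ++ [a]) ++ (b :: l₂) := by simp
    rw [e] at h1 hn hl
    obtain ⟨c, d, h4, h5, h6⟩ := h1.split (by simp) (by simp)
    have hcd : c = a := by simpa using h4.2.2.symm
    have hdb : d = b := by simpa using h5.2.1.symm
    subst hcd hdb
    have hp : ((d :: l₂) ++ (l₁ ++ [c])).Perm ((l₁ ++ [c]) ++ (d :: l₂)) := List.perm_append_comm
    obtain ⟨l', hl', hs'⟩ := key c d ((d :: l₂) ++ (l₁ ++ [c])) (hp.nodup_iff.2 hn)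
      (by rw [hp.length_eq]; exact hl) (h5.append h4 h2) ((hR _ _ h3).resolve_left hab)
    exact ⟨l', by rw [e]; exact hl'.trans hp, hs'⟩

theorem nodup_split_unique {a : α} : ∀ {l₁ l₁' l₂ l₂' : List α}, (l₁ ++ a :: l₂).Nodup →
    l₁ ++ a :: l₂ = l₁' ++ a :: l₂' → l₁ = l₁' ∧ l₂ = l₂'
  | [], [], _, _, _, h => by simpa using h
  | [], b :: l₁', l₂, l₂', hn, h => by
    simp only [List.nil_append, List.cons_append, List.cons.injEq] at h
    obtain ⟨rfl, rfl⟩ := h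
    simp at hn
  | b :: l₁, [], l₂, l₂', hn, h => by
    simp only [List.nil_append, List.cons_append, List.cons.injEq] at h
    obtain ⟨rfl, rfl⟩ := h
    simp at hn
  | b :: l₁, c :: l₁', l₂, l₂', hn, h => by
    simp only [List.cons_append, List.cons.injEq] at h
    obtain ⟨rfl, h⟩ := h
    have := nodup_split_unique (List.nodup_cons.1 hn).2 h
    simpa using this

end Lists

section Ham

variable {V : Type*}

/-- The degree of a vertex. -/
noncomputable def nd (G : SimpleGraph V) (v : V) : ℕ := (G.neighborSet v).ncard

/-- The pair `u, v` has degree sum at least the order of the graph. -/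
def Hv (G : SimpleGraph V) (u v : V) : Prop := Nat.card V ≤ nd G u + nd G v

/-- The graph `G` together with all its heavy pairs. -/
def hc (G : SimpleGraph V) : SimpleGraph V where
  Adj a b := a ≠ b ∧ (G.Adj a b ∨ Hv G a b)
  symm := ⟨fun a b h => ⟨h.1.symm, h.2.imp (fun h => h.symm) (fun h => by
    unfold Hv at *; omega)⟩⟩
  loopless := ⟨fun a h => h.1 rfl⟩

theorem Hv.symm {G : SimpleGraph V} {u v : V} (h : Hv G u v) : Hv G v u := by
  unfold Hv at *; omega

theorem nd_mono [Finite V] {G G' : SimpleGraph V} (h : G ≤ G') (v : V) : nd G v ≤ nd G' v :=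
  Set.ncard_le_ncard (fun _ hw => h hw) (Set.toFinite _)

theorem Hv.mono [Finite V] {G G' : SimpleGraph V} (h : G ≤ G') {u v : V} (hu : Hv G u v) : Hv G' u v :=
  le_trans hu (add_le_add (nd_mono h u) (nd_mono h v))

theorem le_hc (G : SimpleGraph V) : G ≤ hc G := fun _ _ h => ⟨h.ne, Or.inl h⟩

theorem hc_mono [Finite V] {G G' : SimpleGraph V} (h : G ≤ G') : hc G ≤ hc G' :=
  fun _ _ ha => ⟨ha.1, ha.2.imp (fun hh => h hh) fun hh => hh.mono h⟩

/-- `G` has a Hamilton cycle, given as a list. -/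
def Ham (G : SimpleGraph V) : Prop := HamOn G.Adj Set.univ

theorem Ham.mono {G G' : SimpleGraph V} (h : G ≤ G') (hG : Ham G) : Ham G' := by
  obtain ⟨l, h1, h2, h3, h4⟩ := hG
  exact ⟨l, h1, h2, h3, h4.mono fun _ _ hh => h hh⟩

theorem ham_of_path [Finite V] {G : SimpleGraph V} {u v : V} {l : List V} (hs : Seg G.Adj u v l)
    (hn : l.Nodup) (hm : ∀ w, w ∈ l) (hl : 3 ≤ l.length) (h : Hv G u v) : Ham G := by
  classical
  have hmem : ∀ w, w ∈ l ↔ w ∈ (Set.univ : Set V) := fun w => by simp [hm w]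
  by_cases huv : G.Adj v u
  · exact ⟨l, hn, hmem, hl, u, v, hs, huv⟩
  by_cases hex : ∃ l₁ a b l₂, l = l₁ ++ a :: b :: l₂ ∧ G.Adj u b ∧ G.Adj v a
  · obtain ⟨l₁, a, b, l₂, rfl, h1, h2⟩ := hex
    have e : l₁ ++ a :: b :: l₂ = (l₁ ++ [a]) ++ (b :: l₂) := by simp
    rw [e] at hs
    obtain ⟨c, d, h4, h5, h6⟩ := hs.split (by simp) (by simp)
    have hcd : c = a := by simpa using h4.2.2.symm
    have hdb : d = b := by simpa using h5.2.1.symm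
    subst hcd hdb
    refine HamOn.of_perm hn hmem hl (l' := (l₁ ++ [c]) ++ (d :: l₂).reverse) ?_
      (h4.append (h5.reverse fun _ _ h => h.symm) h2.symm) h1.symm
    rw [e]
    exact (List.reverse_perm _).append_left _
  · exfalso
    -- each neighbour of `u` has a predecessor on `l`
    have hpred : ∀ b, ∃ a, G.Adj u b → ∃ l₁ l₂, l = l₁ ++ a :: b :: l₂ := by
      intro b
      by_cases hb : G.Adj u b
      · obtain ⟨l₁, l₂, e⟩ := List.append_of_mem (hm b)
        rcases List.eq_nil_or_concat l₁ with rfl | ⟨t, a, rfl⟩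
        · have := hs.2.1
          rw [e] at this
          simp at this
          exact absurd this hb.ne'
        · exact ⟨a, fun _ => ⟨t, l₂, by simp [e]⟩⟩
      · exact ⟨b, fun h => absurd h hb⟩
    choose f hf using hpred
    have hinj : Set.InjOn f (G.neighborSet u) := by
      intro b hb b' hb' he
      obtain ⟨l₁, l₂, e⟩ := hf b hb
      obtain ⟨l₁', l₂', e'⟩ := hf b' hb'
      rw [← he] at e'
      rw [e] at hn
      have h3 := nodup_split_unique hn (e.symm.trans e')
      simpa using (List.cons.inj h3.2).1
    have hdisj : Disjoint (insert v (f '' G.neighborSet u)) (G.neighborSet v) := by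
      rw [Set.disjoint_left]
      rintro x hx hxv
      rcases hx with rfl | ⟨b, hb, rfl⟩
      · exact G.loopless.irrefl _ hxv
      · obtain ⟨l₁, l₂, e⟩ := hf b hb
        exact hex ⟨l₁, f b, b, l₂, e, hb, hxv⟩
    have hv : v ∉ f '' G.neighborSet u := by
      rintro ⟨b, hb, hfb⟩
      obtain ⟨l₁, l₂, e⟩ := hf b hb
      rw [hfb] at e
      have h1 := hs.2.2
      rw [e, show l₁ ++ v :: b :: l₂ = (l₁ ++ [v]) ++ (b :: l₂) by simp,
        List.getLast?_append_of_ne_nil _ (by simp)] at h1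
      have h2 := List.mem_of_getLast? h1
      rw [e, List.nodup_append] at hn
      exact (List.nodup_cons.1 hn.2.1).1 h2
    have h1 := Set.ncard_union_eq hdisj (Set.toFinite _) (Set.toFinite _)
    rw [Set.ncard_insert_of_notMem hv (Set.toFinite _), hinj.ncard_image] at h1
    have h2 := Set.ncard_le_card (insert v (f '' G.neighborSet u) ∪ G.neighborSet v)
    unfold Hv nd at h
    omega

theorem ham_or_path_of_sup_edge {G : SimpleGraph V} {u v : V} (h : Ham (G ⊔ SimpleGraph.edge u v)) :
    Ham G ∨ ∃ l, Seg G.Adj u v l ∧ l.Nodup ∧ (∀ w, w ∈ l) ∧ 3 ≤ l.length := by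
  obtain ⟨l, h1, h2, h3, h4⟩ := h
  have hR : ∀ a b, (G ⊔ SimpleGraph.edge u v).Adj a b →
      G.Adj a b ∨ (a = u ∧ b = v) ∨ (a = v ∧ b = u) := by
    intro a b hab
    rw [SimpleGraph.sup_adj, SimpleGraph.edge_adj] at hab
    tauto
  rcases h4.of_add_edge (fun _ _ h => h.symm) hR h1 h3 with h | h
  · exact Or.inl ⟨l, h1, h2, h3, h⟩
  · obtain ⟨l', hp, hs⟩ := h
    exact Or.inr ⟨l', hs, hp.nodup_iff.2 h1, fun w => hp.mem_iff.2 ((h2 w).2 trivial),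
      by rw [hp.length_eq]; exact h3⟩

theorem ham_of_sup_edge [Finite V] {G : SimpleGraph V} {u v : V} (h : Ham (G ⊔ SimpleGraph.edge u v))
    (hv : Hv G u v) : Ham G := by
  rcases ham_or_path_of_sup_edge h with h | ⟨l, h1, h2, h3, h4⟩
  · exact h
  · exact ham_of_path h1 h2 h3 h4 hv

theorem ham_of_ham_hc [Finite V] {G : SimpleGraph V} (h : Ham (hc G)) : Ham G := by
  obtain ⟨K, hK, hmin⟩ := (Set.toFinite {K : SimpleGraph V | G ≤ K ∧ K ≤ hc G ∧ Ham K}).exists_minimal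
    ⟨hc G, le_hc G, le_rfl, h⟩
  obtain ⟨h1, h2, h3⟩ := hK
  by_cases hKG : K ≤ G
  · exact h3.mono hKG
  exfalso
  have : ∃ a b, K.Adj a b ∧ ¬ G.Adj a b := by
    by_contra hcon
    push Not at hcon
    exact hKG fun a b hab => hcon a b hab
  obtain ⟨a, b, hab, hnab⟩ := this
  have hle : G ≤ K.deleteEdges {s(a, b)} := by
    intro c d hcd
    rw [SimpleGraph.deleteEdges_adj]
    refine ⟨h1 hcd, ?_⟩
    simp only [Set.mem_singleton_iff, Sym2.eq_iff]
    rintro (⟨rfl, rfl⟩ | ⟨rfl, rfl⟩)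
    · exact hnab hcd
    · exact hnab hcd.symm
  have hsup : K ≤ K.deleteEdges {s(a, b)} ⊔ SimpleGraph.edge a b := by
    intro c d hcd
    rw [SimpleGraph.sup_adj, SimpleGraph.edge_adj, SimpleGraph.deleteEdges_adj]
    simp only [Set.mem_singleton_iff, Sym2.eq_iff]
    have := hcd.ne
    tauto
  have hH : Ham (K.deleteEdges {s(a, b)}) :=
    ham_of_sup_edge (h3.mono hsup) (((h2 hab).2.resolve_left hnab).mono hle)
  have hdle : K.deleteEdges {s(a, b)} ≤ K := SimpleGraph.deleteEdges_le _
  have := hmin ⟨hle, hdle.trans h2, hH⟩ hdle hab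
  rw [SimpleGraph.deleteEdges_adj] at this
  simp at this

end Ham

section Completion

variable {V : Type*}

/-- Claw-o-heaviness, phrased with the heavy pairs graph. -/
def CH (G : SimpleGraph V) : Prop :=
  ∀ a b₁ b₂ b₃, b₁ ≠ b₂ → b₁ ≠ b₃ → b₂ ≠ b₃ → G.Adj a b₁ → G.Adj a b₂ → G.Adj a b₃ →
    (hc G).Adj b₁ b₂ ∨ (hc G).Adj b₁ b₃ ∨ (hc G).Adj b₂ b₃

/-- Local completion at `x`. -/
def cpl (G : SimpleGraph V) (x : V) : SimpleGraph V where
  Adj a b := G.Adj a b ∨ (a ≠ b ∧ G.Adj x a ∧ G.Adj x b)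
  symm := ⟨fun _ _ h => h.imp (fun h => h.symm) fun h => ⟨h.1.symm, h.2.2, h.2.1⟩⟩
  loopless := ⟨fun _ h => h.elim (fun h => h.ne rfl) fun h => h.1 rfl⟩

theorem le_cpl (G : SimpleGraph V) (x : V) : G ≤ cpl G x := fun _ _ h => Or.inl h

theorem ham_of_rotation [Finite V] {G L : SimpleGraph V} {x y z w : V}
    (hGL : G ≤ L) (hCH : CH G) (hLG : L ≤ cpl G x)
    (hK : ∀ a b, G.Adj x a → G.Adj x b → (hc G).Adj a b → L.Adj a b)
    (hxy : G.Adj x y) (hxz : G.Adj x z) (hyz : ¬ L.Adj y z)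
    (hwy : L.Adj w y) (hwz : L.Adj w z) (hxw : (hc L).Adj x w)
    {P Q : List V} {a b : V} (hn : (P ++ x :: Q).Nodup) (hm : ∀ v, v ∈ P ++ x :: Q)
    (hP : Seg L.Adj y a P) (hax : L.Adj a x) (hxb : L.Adj x b) (hQ : Seg L.Adj b z Q)
    (hwQ : w ∈ Q) : Ham L := by
  classical
  have hlen : 3 ≤ (P ++ x :: Q).length := by
    have h1 := List.length_pos_of_ne_nil hP.ne_nil
    have h2 := List.length_pos_of_ne_nil hQ.ne_nil
    simp; omega
  have hmem : ∀ v, v ∈ P ++ x :: Q ↔ v ∈ (Set.univ : Set V) := fun v => by simp [hm v]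
  have hsy : ∀ a b, L.Adj a b → L.Adj b a := fun _ _ h => h.symm
  by_cases hby : L.Adj b y
  · refine HamOn.of_perm hn hmem hlen (l' := (P.reverse ++ Q) ++ [x]) ?_
      (((hP.reverse hsy).append hQ hby.symm).append (Seg.singleton x) (hGL hxz.symm)) hax.symm
    rw [List.perm_iff_count]; intro v; simp [List.count_append, List.count_cons]
  have hwb : w ≠ b := by rintro rfl; exact hby hwy
  obtain ⟨Q₁, Q₂, c, d, rfl, hQ₁, hcw, hwd, hQ₂⟩ := hQ.split_at hwQ hwb hwz.ne
  -- all neighbours of `x` in `L` are neighbours in `G`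
  have hxL : ∀ t, L.Adj x t → G.Adj x t := by
    intro t ht
    rcases hLG ht with h | h
    · exact h
    · exact absurd h.2.1 (G.loopless.irrefl _)
  have hyP := hP.head_mem
  have haP := hP.last_mem
  have hbQ := hQ₁.head_mem
  have hcQ := hQ₁.last_mem
  have hdQ := hQ₂.head_mem
  have hzQ := hQ₂.last_mem
  rw [List.nodup_append, List.nodup_cons, List.nodup_append, List.nodup_cons] at hn
  obtain ⟨hn1, ⟨hn2, hn3, ⟨hn4, hn5⟩, hn6⟩, hn7⟩ := hn
  have hnn : (P ++ x :: (Q₁ ++ w :: Q₂)).Nodup := by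
    rw [List.nodup_append, List.nodup_cons, List.nodup_append, List.nodup_cons]
    exact ⟨hn1, ⟨hn2, hn3, ⟨hn4, hn5⟩, hn6⟩, hn7⟩
  have hbz : L.Adj b z := by
    have hb := hxL _ hxb
    have h1 : b ≠ z := hn6 _ hbQ _ (by simp [hzQ])
    have h2 : b ≠ y := (hn7 _ hyP _ (by simp [hbQ])).symm
    have h3 : y ≠ z := hn7 _ hyP _ (by simp [hzQ])
    rcases hCH x b y z h2 h1 h3 hb hxy hxz with h | h | h
    · exact absurd (hK _ _ hb hxy h) hby
    · exact hK _ _ hb hxz h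
    · exact absurd (hK _ _ hxy hxz h) hyz
  have hLM := le_hc L
  have hsM : ∀ a b, (hc L).Adj a b → (hc L).Adj b a := fun _ _ h => h.symm
  have up : ∀ {u v : V} {l : List V}, Seg L.Adj u v l → Seg (hc L).Adj u v l :=
    fun h => h.mono fun _ _ h => hLM h
  have upr : ∀ {u v : V} {l : List V}, Seg L.Adj u v l → Seg (hc L).Adj v u l.reverse :=
    fun h => (up h).reverse hsM
  have one : ∀ v : V, Seg (hc L).Adj v v [v] := Seg.singleton
  have fin : ∀ (l' : List V) (s t : V), Seg (hc L).Adj s t l' → (hc L).Adj t s →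
      l'.Perm (P ++ x :: (Q₁ ++ w :: Q₂)) → Ham L := fun l' s t h1 h2 h3 =>
    ham_of_ham_hc (HamOn.of_perm hnn hmem hlen h3 h1 h2)
  -- the rotations
  have alt1 : (hc L).Adj x c → Ham L := by
    intro h
    refine fin ((([w] ++ Q₂) ++ Q₁) ++ [x] ++ P.reverse) w y
      (((((one w).append (up hQ₂) (hLM hwd)).append (up hQ₁) (hLM hbz.symm)).append (one x)
        h.symm).append (upr hP) (hLM hax.symm)) (hLM hwy.symm) ?_
    rw [List.perm_iff_count]; intro v; simp [List.count_append, List.count_cons]; omega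
  have alt2 : (hc L).Adj x d → Ham L := by
    intro h
    refine fin ((([w] ++ Q₁.reverse) ++ Q₂.reverse) ++ [x] ++ P.reverse) w y
      (((((one w).append (upr hQ₁) (hLM hcw.symm)).append (upr hQ₂) (hLM hbz)).append (one x)
        h.symm).append (upr hP) (hLM hax.symm)) (hLM hwy.symm) ?_
    rw [List.perm_iff_count]; intro v; simp [List.count_append, List.count_cons]; omega
  have alt3 : (hc L).Adj c d → Ham L := by
    intro h
    refine fin ((((P ++ [x]) ++ Q₁) ++ Q₂) ++ [w]) y w
      (((((up hP).append (one x) (hLM hax)).append (up hQ₁) (hLM hxb)).append (up hQ₂)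
        h).append (one w) (hLM hwz.symm)) (hLM hwy) ?_
    rw [List.perm_iff_count]; intro v; simp [List.count_append, List.count_cons]
  have alt4 : (hc L).Adj y d → Ham L := by
    intro h
    refine fin ((((Q₂ ++ [w]) ++ Q₁.reverse) ++ [x]) ++ P.reverse) d y
      (((((up hQ₂).append (one w) (hLM hwz.symm)).append (upr hQ₁) (hLM hcw.symm)).append (one x)
        (hLM hxb.symm)).append (upr hP) (hLM hax.symm)) h ?_
    rw [List.perm_iff_count]; intro v; simp [List.count_append, List.count_cons]; omega
  have alt6 : (hc L).Adj y c → Ham L := by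
    intro h
    refine fin ((((Q₁.reverse ++ Q₂.reverse) ++ [w]) ++ [x]) ++ P.reverse) c y
      (((((upr hQ₁).append (upr hQ₂) (hLM hbz)).append (one w) (hLM hwd.symm)).append (one x)
        hxw.symm).append (upr hP) (hLM hax.symm)) h ?_
    rw [List.perm_iff_count]; intro v; simp [List.count_append, List.count_cons]; omega
  have hGM := hc_mono hGL
  have hwK : ∀ t, L.Adj w t → G.Adj w t ∨ G.Adj x t := by
    intro t ht
    rcases hLG ht with h | h
    · exact Or.inl h
    · exact Or.inr h.2.2
  have hcd : c ≠ d := hn6 _ hcQ _ (by simp [hdQ])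
  rcases hwK c hcw.symm with hwc | hwc
  swap
  · exact alt1 (hLM (hGL hwc))
  rcases hwK d hwd with hwd' | hwd'
  swap
  · exact alt2 (hLM (hGL hwd'))
  by_cases hxwG : G.Adj x w
  · have h1 : x ≠ c := by rintro rfl; exact hn2 (by simp [hcQ])
    have h2 : x ≠ d := by rintro rfl; exact hn2 (by simp [hdQ])
    rcases hCH w x c d h1 h2 hcd hxwG.symm hwc hwd' with h | h | h
    · exact alt1 (hGM h)
    · exact alt2 (hGM h)
    · exact alt3 (hGM h)
  · have hwyG : G.Adj w y := by
      rcases hLG hwy with h | h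
      · exact h
      · exact absurd h.2.1 hxwG
    have h1 : y ≠ c := hn7 _ hyP _ (by simp [hcQ])
    have h2 : y ≠ d := hn7 _ hyP _ (by simp [hdQ])
    rcases hCH w y c d h1 h2 hcd hwyG hwc hwd' with h | h | h
    · exact alt6 (hGM h)
    · exact alt4 (hGM h)
    · exact alt3 (hGM h)

theorem ham_of_hub [Finite V] {G L : SimpleGraph V} {x y z w : V}
    (hGL : G ≤ L) (hCH : CH G) (hLG : L ≤ cpl G x)
    (hK : ∀ a b, G.Adj x a → G.Adj x b → (hc G).Adj a b → L.Adj a b)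
    (hxy : G.Adj x y) (hxz : G.Adj x z) (hyz : ¬ L.Adj y z)
    (hwy : L.Adj w y) (hwz : L.Adj w z) (hxw : (hc L).Adj x w)
    {p : List V} (hp : Seg L.Adj y z p) (hn : p.Nodup) (hm : ∀ v, v ∈ p) : Ham L := by
  obtain ⟨P, Q, a, b, rfl, h1, h2, h3, h4⟩ := hp.split_at (hm x) hxy.ne hxz.ne
  have hw := hm w
  rw [List.mem_append, List.mem_cons] at hw
  rcases hw with hw | rfl | hw
  · have e : (P ++ x :: Q).reverse = Q.reverse ++ x :: P.reverse := by simp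
    have hsy : ∀ a b, L.Adj a b → L.Adj b a := fun _ _ h => h.symm
    refine ham_of_rotation hGL hCH hLG hK hxz hxy (fun h => hyz h.symm) hwz hwy hxw
      (P := Q.reverse) (Q := P.reverse) (e ▸ List.nodup_reverse.2 hn)
      (fun v => e ▸ List.mem_reverse.2 (hm v)) (h4.reverse hsy) h3.symm h2.symm (h1.reverse hsy)
      (List.mem_reverse.2 hw)
  · exact absurd rfl hxw.1
  · exact ham_of_rotation hGL hCH hLG hK hxy hxz hyz hwy hwz hxw hn hm h1 h2 h3 h4 hw

/-- The vertices at which local completion keeps nonhamiltonicity. -/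
def Elig (G : SimpleGraph V) (x : V) : Prop :=
  (∀ A : Set V, A ⊆ G.neighborSet x → A.Nonempty → A ≠ G.neighborSet x →
    ∃ a ∈ A, ∃ b ∈ G.neighborSet x \ A, (hc G).Adj a b) ∨
  ∃ j, ¬ G.Adj x j ∧ (hc G).Adj x j ∧ ∃ C₁ C₂ : Set V, G.neighborSet x = C₁ ∪ C₂ ∧
    (hc G).IsClique C₁ ∧ (hc G).IsClique C₂ ∧ (∃ a ∈ C₁, G.Adj j a) ∧ ∃ b ∈ C₂, G.Adj j b

theorem ham_of_ham_cpl [Finite V] {G : SimpleGraph V} {x : V} (hCH : CH G) (hx : Elig G x)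
    (h : Ham (cpl G x)) : Ham G := by
  by_contra hnot
  obtain ⟨L, hL, hmax⟩ := (Set.toFinite
    {L : SimpleGraph V | G ≤ L ∧ L ≤ cpl G x ∧ ¬ Ham L}).exists_maximal
    ⟨G, le_rfl, le_cpl G x, hnot⟩
  obtain ⟨hGL, hLG, hLn⟩ := hL
  have hedge : ∀ a b, a ≠ b → G.Adj x a → G.Adj x b → ¬ L.Adj a b →
      Ham (L ⊔ SimpleGraph.edge a b) := by
    intro a b hab ha hb hn
    by_contra hH
    have hle : L ⊔ SimpleGraph.edge a b ≤ cpl G x := by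
      refine sup_le hLG ?_
      intro c d hcd
      rw [SimpleGraph.edge_adj] at hcd
      rcases hcd with ⟨⟨rfl, rfl⟩ | ⟨rfl, rfl⟩, -⟩
      · exact Or.inr ⟨hab, ha, hb⟩
      · exact Or.inr ⟨hab.symm, hb, ha⟩
    have := hmax ⟨hGL.trans le_sup_left, hle, hH⟩ le_sup_left
    refine hn (this ?_)
    rw [SimpleGraph.sup_adj, SimpleGraph.edge_adj]
    exact Or.inr ⟨Or.inl ⟨rfl, rfl⟩, hab⟩
  have hK : ∀ a b, G.Adj x a → G.Adj x b → (hc G).Adj a b → L.Adj a b := by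
    intro a b ha hb hab
    by_contra hn
    exact hLn (ham_of_sup_edge (hedge a b hab.1 ha hb hn)
      ((hab.2.resolve_left fun h => hn (hGL h)).mono hGL))
  have hub : ∀ y z w, y ≠ z → G.Adj x y → G.Adj x z → ¬ L.Adj y z → L.Adj w y → L.Adj w z →
      (hc L).Adj x w → False := by
    intro y z w hne hy hz hyz hwy hwz hxw
    rcases ham_or_path_of_sup_edge (hedge y z hne hy hz hyz) with h | ⟨p, hp, hn, hm, -⟩
    · exact hLn h
    · exact hLn (ham_of_hub hGL hCH hLG hK hy hz hyz hwy hwz hxw hp hn hm)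
  -- a connected neighbourhood is impossible
  have hconn : ¬ ∀ A : Set V, A ⊆ G.neighborSet x → A.Nonempty → A ≠ G.neighborSet x →
      ∃ a ∈ A, ∃ b ∈ G.neighborSet x \ A, L.Adj a b := by
    intro hcut
    have : ∀ a b, a ≠ b → G.Adj x a → G.Adj x b → L.Adj a b := by
      intro a b hab ha hb
      by_contra hn
      obtain ⟨c, hc1, d, hd, hcd⟩ := hcut {t | G.Adj x t ∧ (t = a ∨ L.Adj a t)}
        (fun t ht => ht.1) ⟨a, ha, Or.inl rfl⟩ (by
          intro e
          have : b ∈ {t | G.Adj x t ∧ (t = a ∨ L.Adj a t)} := by rw [e]; exact hb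
          rcases this.2 with h | h
          · exact hab h.symm
          · exact hn h)
      have hd2 : ¬ (d = a ∨ L.Adj a d) := fun h => hd.2 ⟨hd.1, h⟩
      push Not at hd2
      rcases hc1.2 with rfl | hac
      · exact hd2.2 hcd
      · exact hub a d c hd2.1.symm ha hd.1 hd2.2 hac.symm hcd (le_hc L (hGL hc1.1))
    refine hLn (h.mono ?_)
    intro a b hab
    rcases hab with hab | hab
    · exact hGL hab
    · exact this a b hab.1 hab.2.1 hab.2.2
  rcases hx with hx | ⟨j, hxj, hxj', C₁, C₂, hC, hC₁, hC₂, ⟨a, ha, hja⟩, b, hb, hjb⟩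
  · refine hconn fun A h1 h2 h3 => ?_
    obtain ⟨a, ha, b, hb, hab⟩ := hx A h1 h2 h3
    exact ⟨a, ha, b, hb, hK a b (h1 ha) hb.1 hab⟩
  · have hC₁x : ∀ t ∈ C₁, G.Adj x t := fun t ht => by
      have : t ∈ G.neighborSet x := by rw [hC]; exact Or.inl ht
      exact this
    have hC₂x : ∀ t ∈ C₂, G.Adj x t := fun t ht => by
      have : t ∈ G.neighborSet x := by rw [hC]; exact Or.inr ht
      exact this
    by_cases hab : a = b ∨ L.Adj a b
    · refine hconn fun A h1 h2 h3 => ?_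
      by_contra hno
      push Not at hno
      have step : ∀ s t, G.Adj x s → G.Adj x t → (s = t ∨ L.Adj s t) → (s ∈ A ↔ t ∈ A) := by
        intro s t hs ht hst
        rcases hst with rfl | hst
        · rfl
        constructor
        · intro hsA
          by_contra htA
          exact hno s hsA t ⟨ht, htA⟩ hst
        · intro htA
          by_contra hsA
          exact hno t htA s ⟨hs, hsA⟩ hst.symm
      have hall : ∀ t, G.Adj x t → (t ∈ A ↔ a ∈ A) := by
        intro t ht
        have ht' : t ∈ C₁ ∪ C₂ := by rw [← hC]; exact ht
        rcases ht' with h | h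
        · by_cases e : t = a
          · rw [e]
          · exact step t a ht (hC₁x a ha) (Or.inr (hK _ _ ht (hC₁x a ha) (hC₁ h ha e)))
        · rw [step a b (hC₁x a ha) (hC₂x b hb) hab]
          by_cases e : t = b
          · rw [e]
          · exact step t b ht (hC₂x b hb) (Or.inr (hK _ _ ht (hC₂x b hb) (hC₂ h hb e)))
      obtain ⟨t, ht⟩ := h2
      have haA := (hall t (h1 ht)).1 ht
      exact h3 (Set.Subset.antisymm h1 fun s hs => (hall s hs).2 haA)
    · push Not at hab
      exact hub a b j hab.1 (hC₁x a ha) (hC₂x b hb) hab.2 (hGL hja) (hGL hjb) (hc_mono hGL hxj')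

end Completion

section Closure

variable {V : Type*}

/-- A vertex whose neighbourhood is a clique. -/
def Simp (H : SimpleGraph V) (v : V) : Prop := H.IsClique (H.neighborSet v)

/-- The graph `G` restricted to the simplicial vertices of `H` and the two vertices `a`, `b`. -/
def GS (G H : SimpleGraph V) (a b : V) : SimpleGraph V where
  Adj u v := G.Adj u v ∧ (Simp H u ∨ u = a ∨ u = b) ∧ (Simp H v ∨ v = a ∨ v = b)
  symm := ⟨fun _ _ h => ⟨h.1.symm, h.2.2, h.2.1⟩⟩
  loopless := ⟨fun _ h => h.1.ne rfl⟩

/-- The invariant kept while forming the closure. -/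
def ClosureInv [Finite V] (G H : SimpleGraph V) : Prop :=
  G ≤ H ∧ CH H ∧ ¬ Ham H ∧ ∀ a b, H.Adj a b → (GS G H a b).Reachable a b

theorem cpl_adj_self {G : SimpleGraph V} {x a : V} : (cpl G x).Adj x a ↔ G.Adj x a := by
  constructor
  · rintro (h | h)
    · exact h
    · exact absurd h.2.1 (G.loopless.irrefl _)
  · exact Or.inl

theorem CH.cpl [Finite V] {M : SimpleGraph V} (hM : CH M) (x : V) : CH (cpl M x) := by
  -- a claw with a new edge at its centre
  have new : ∀ y b₁ b₂ b₃, b₁ ≠ b₂ → b₁ ≠ b₃ → b₂ ≠ b₃ → (_root_.cpl M x).Adj y b₂ →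
      (_root_.cpl M x).Adj y b₃ → ¬ M.Adj y b₁ → M.Adj x y → M.Adj x b₁ →
      (hc (_root_.cpl M x)).Adj b₁ b₂ ∨ (hc (_root_.cpl M x)).Adj b₁ b₃ ∨
        (hc (_root_.cpl M x)).Adj b₂ b₃ := by
    intro y b₁ b₂ b₃ h12 h13 h23 hy2 hy3 hn hxy hx1
    have hle := le_cpl M x
    by_cases hx2 : M.Adj x b₂
    · exact Or.inl (le_hc _ (Or.inr ⟨h12, hx1, hx2⟩))
    by_cases hx3 : M.Adj x b₃
    · exact Or.inr (Or.inl (le_hc _ (Or.inr ⟨h13, hx1, hx3⟩)))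
    have hy2' : M.Adj y b₂ := hy2.resolve_right fun h => hx2 h.2.2
    have hy3' : M.Adj y b₃ := hy3.resolve_right fun h => hx3 h.2.2
    by_cases e2 : x = b₂
    · exact Or.inl (le_hc _ (hle (e2 ▸ hx1.symm)))
    by_cases e3 : x = b₃
    · exact Or.inr (Or.inl (le_hc _ (hle (e3 ▸ hx1.symm))))
    have hd : nd M x ≤ nd (_root_.cpl M x) b₁ := by
      have hs : insert x (M.neighborSet x \ {b₁}) ⊆ (_root_.cpl M x).neighborSet b₁ := by
        intro t ht
        rcases ht with rfl | ht
        · exact Or.inl hx1.symm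
        · exact Or.inr ⟨fun e => ht.2 e.symm, hx1, ht.1⟩
      have h1 := Set.ncard_le_ncard hs (Set.toFinite _)
      rw [Set.ncard_insert_of_notMem (fun h => M.loopless.irrefl _ h.1) (Set.toFinite _)] at h1
      have h2 := Set.ncard_sdiff_singleton_add_one (show b₁ ∈ M.neighborSet x from hx1)
        (Set.toFinite _)
      unfold nd
      omega
    have hv : ∀ b, Hv M x b → Hv (_root_.cpl M x) b₁ b := by
      intro b hb
      have := nd_mono hle b
      unfold Hv at *
      omega
    rcases hM y x b₂ b₃ e2 e3 h23 hxy.symm hy2' hy3' with h | h | h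
    · exact Or.inl ⟨h12, Or.inr (hv _ (h.2.resolve_left hx2))⟩
    · exact Or.inr (Or.inl ⟨h13, Or.inr (hv _ (h.2.resolve_left hx3))⟩)
    · exact Or.inr (Or.inr (hc_mono hle h))
  intro y b₁ b₂ b₃ h12 h13 h23 hy1 hy2 hy3
  by_cases n1 : M.Adj y b₁
  swap
  · have := hy1.resolve_left n1
    exact new y b₁ b₂ b₃ h12 h13 h23 hy2 hy3 n1 this.2.1 this.2.2
  by_cases n2 : M.Adj y b₂
  swap
  · have := hy2.resolve_left n2
    rcases new y b₂ b₁ b₃ h12.symm h23 h13 hy1 hy3 n2 this.2.1 this.2.2 with h | h | h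
    · exact Or.inl h.symm
    · exact Or.inr (Or.inr h)
    · exact Or.inr (Or.inl h)
  by_cases n3 : M.Adj y b₃
  swap
  · have := hy3.resolve_left n3
    rcases new y b₃ b₁ b₂ h13.symm h23.symm h12 hy1 hy2 n3 this.2.1 this.2.2 with h | h | h
    · exact Or.inr (Or.inl h.symm)
    · exact Or.inr (Or.inr h.symm)
    · exact Or.inl h
  have hle := hc_mono (le_cpl M x)
  exact (hM y b₁ b₂ b₃ h12 h13 h23 n1 n2 n3).imp (fun h => hle h)
    (Or.imp (fun h => hle h) fun h => hle h)

theorem simp_cpl_self {M : SimpleGraph V} (x : V) : Simp (cpl M x) x := by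
  intro a ha b hb hab
  exact Or.inr ⟨hab, cpl_adj_self.1 ha, cpl_adj_self.1 hb⟩

theorem Simp.cpl {M : SimpleGraph V} {v : V} (hv : Simp M v) (x : V) : Simp (cpl M x) v := by
  have h : ∀ a, (_root_.cpl M x).Adj v a → M.Adj v a ∨ (M.Adj x v ∧ M.Adj x a) :=
    fun a ha => ha.imp id fun h => h.2
  have h1 : ∀ a, M.Adj v a → M.Adj x v → x = a ∨ M.Adj x a := by
    intro a ha hx
    by_cases e : x = a
    · exact Or.inl e
    · exact Or.inr (hv hx.symm ha e)
  intro a ha b hb hab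
  rcases h a ha with ha | ha <;> rcases h b hb with hb | hb
  · exact Or.inl (hv ha hb hab)
  · rcases h1 a ha hb.1 with rfl | h2
    · exact Or.inl hb.2
    · exact Or.inr ⟨hab, h2, hb.2⟩
  · rcases h1 b hb ha.1 with rfl | h2
    · exact Or.inl ha.2.symm
    · exact Or.inr ⟨hab, ha.2, h2⟩
  · exact Or.inr ⟨hab, ha.2, hb.2⟩

theorem GS_mono {G H H' : SimpleGraph V} {a b a' b' : V} (hs : ∀ v, Simp H v → Simp H' v)
    (ha : Simp H' a ∨ a = a' ∨ a = b') (hb : Simp H' b ∨ b = a' ∨ b = b') :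
    GS G H a b ≤ GS G H' a' b' := by
  intro u v h
  refine ⟨h.1, ?_, ?_⟩
  · rcases h.2.1 with h | rfl | rfl
    · exact Or.inl (hs _ h)
    · exact ha
    · exact hb
  · rcases h.2.2 with h | rfl | rfl
    · exact Or.inl (hs _ h)
    · exact ha
    · exact hb

theorem exists_closure [Finite V] {G : SimpleGraph V} (hCH : CH G) (hG : ¬ Ham G) :
    ∃ H, ClosureInv G H ∧ ∀ x, Elig H x → Simp H x := by
  obtain ⟨H, hH, hmax⟩ := (Set.toFinite {H : SimpleGraph V | ClosureInv G H}).exists_maximal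
    ⟨G, le_rfl, hCH, hG, fun a b hab => SimpleGraph.Adj.reachable
      ⟨hab, Or.inr (Or.inl rfl), Or.inr (Or.inr rfl)⟩⟩
  refine ⟨H, hH, fun x hx => ?_⟩
  obtain ⟨h1, h2, h3, h4⟩ := hH
  have hs : ∀ v, Simp H v → Simp (cpl H x) v := fun v hv => hv.cpl x
  have hxs := simp_cpl_self (M := H) x
  have : ClosureInv G (cpl H x) := by
    refine ⟨h1.trans (le_cpl H x), h2.cpl x, fun h => h3 (ham_of_ham_cpl h2 hx h), ?_⟩
    rintro a b (hab | ⟨-, ha, hb⟩)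
    · exact (h4 a b hab).mono (GS_mono hs (Or.inr (Or.inl rfl)) (Or.inr (Or.inr rfl)))
    · exact ((h4 a x ha.symm).mono (GS_mono hs (Or.inr (Or.inl rfl)) (Or.inl hxs))).trans
        ((h4 x b hb).mono (GS_mono hs (Or.inl hxs) (Or.inr (Or.inr rfl))))
  have hle := hmax this (le_cpl H x)
  intro a ha b hb hab
  exact hle (Or.inr ⟨hab, ha, hb⟩)

/-- The neighbourhood of a vertex which is not simplicial splits in two parts. -/
theorem exists_parts [Finite V] {H : SimpleGraph V} (hCH : CH H)
    (hel : ∀ x, Elig H x → Simp H x) {x : V} (hx : ¬ Simp H x) :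
    ∃ A B : Set V, H.neighborSet x = A ∪ B ∧ A.Nonempty ∧ B.Nonempty ∧
      (∀ a ∈ A, ∀ b ∈ B, a ≠ b ∧ ¬ (hc H).Adj a b) ∧ (hc H).IsClique A ∧ (hc H).IsClique B := by
  have h : ¬ Elig H x := mt (hel x) hx
  rw [Elig, not_or] at h
  have h := h.1
  push Not at h
  obtain ⟨A, h1, ⟨a₀, ha₀⟩, h3, h4⟩ := h
  obtain ⟨b₀, hb₀, hb₀'⟩ := Set.exists_of_ssubset (h1.ssubset_of_ne h3)
  have hne : ∀ a ∈ A, ∀ b ∈ H.neighborSet x \ A, a ≠ b := by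
    rintro a ha b hb rfl
    exact hb.2 ha
  refine ⟨A, H.neighborSet x \ A, by rw [Set.union_sdiff_cancel h1], ⟨a₀, ha₀⟩, ⟨b₀, hb₀, hb₀'⟩,
    fun a ha b hb => ⟨hne a ha b hb, h4 a ha b hb⟩, ?_, ?_⟩
  · intro a ha a' ha' haa
    have hb : b₀ ∈ H.neighborSet x \ A := ⟨hb₀, hb₀'⟩
    rcases hCH x a a' b₀ haa (hne a ha _ hb) (hne a' ha' _ hb) (h1 ha) (h1 ha') hb₀ with h | h | h
    · exact h
    · exact absurd h (h4 a ha _ hb)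
    · exact absurd h (h4 a' ha' _ hb)
  · intro b hb b' hb' hbb
    rcases hCH x a₀ b b' (hne _ ha₀ _ hb) (hne _ ha₀ _ hb') hbb (h1 ha₀) hb.1 hb'.1 with h | h | h
    · exact absurd h (h4 _ ha₀ _ hb)
    · exact absurd h (h4 _ ha₀ _ hb')
    · exact h

theorem adj_of_hc_adj [Finite V] {H : SimpleGraph V} (hCH : CH H)
    (hel : ∀ x, Elig H x → Simp H x) {p q : V} (hpq : (hc H).Adj p q) : H.Adj p q := by
  by_contra hn
  have hv : Hv H p q := hpq.2.resolve_left hn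
  have hparts : ∀ x, H.Adj x p → H.Adj x q → ∃ A B : Set V, H.neighborSet x = A ∪ B ∧
      (∀ a ∈ A, ∀ b ∈ B, a ≠ b ∧ ¬ (hc H).Adj a b) ∧ (hc H).IsClique A ∧ (hc H).IsClique B ∧
      p ∈ A ∧ q ∈ A ∧ B.Nonempty := by
    intro x hxp hxq
    have hx : ¬ Simp H x := fun h => hn (h hxp hxq hpq.1)
    obtain ⟨A, B, h1, h2, h3, h4, h5, h6⟩ := exists_parts hCH hel hx
    have hp : p ∈ A ∪ B := h1 ▸ hxp
    have hq : q ∈ A ∪ B := h1 ▸ hxq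
    rcases hp with hp | hp
    · rcases hq with hq | hq
      · exact ⟨A, B, h1, h4, h5, h6, hp, hq, h3⟩
      · exact absurd hpq (h4 p hp q hq).2
    · rcases hq with hq | hq
      · exact absurd hpq.symm (h4 q hq p hp).2
      · exact ⟨B, A, h1.trans (Set.union_comm _ _), fun a ha b hb =>
          ⟨(h4 b hb a ha).1.symm, fun h => (h4 b hb a ha).2 h.symm⟩, h6, h5, hp, hq, h2⟩
  set J : Set V := H.neighborSet p ∩ H.neighborSet q with hJ
  set Z : Set V := (insert p (insert q (H.neighborSet p ∪ H.neighborSet q)))ᶜ with hZ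
  have hcard : Z.ncard < J.ncard := by
    have h1 := Set.ncard_union_add_ncard_inter (H.neighborSet p) (H.neighborSet q)
    have h2 := Set.ncard_add_ncard_compl (insert p (insert q (H.neighborSet p ∪ H.neighborSet q)))
    rw [Set.ncard_insert_of_notMem, Set.ncard_insert_of_notMem] at h2
    · unfold Hv nd at hv
      rw [hJ, hZ]
      omega
    · rintro (h | h)
      · exact hn h
      · exact H.loopless.irrefl _ h
    · rintro (h | h | h)
      · exact hpq.1 h
      · exact H.loopless.irrefl _ h
      · exact hn (H.adj_symm h)
  have hz : ∀ x, ∃ z, x ∈ J → z ∈ Z ∧ ∃ A B : Set V, H.neighborSet x = A ∪ B ∧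
      (∀ a ∈ A, ∀ b ∈ B, a ≠ b ∧ ¬ (hc H).Adj a b) ∧ (hc H).IsClique A ∧ (hc H).IsClique B ∧
      p ∈ A ∧ q ∈ A ∧ z ∈ B := by
    intro x
    by_cases hx : x ∈ J
    · obtain ⟨A, B, h1, h2, h3, h4, h5, h6, z, hz⟩ := hparts x (H.adj_symm hx.1) (H.adj_symm hx.2)
      refine ⟨z, fun _ => ⟨?_, A, B, h1, h2, h3, h4, h5, h6, hz⟩⟩
      rintro (h | h | h | h)
      · exact (h2 p h5 z hz).1 h.symm
      · exact (h2 q h6 z hz).1 h.symm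
      · exact (h2 p h5 z hz).2 (le_hc _ h)
      · exact (h2 q h6 z hz).2 (le_hc _ h)
    · exact ⟨x, fun h => absurd h hx⟩
  choose f hf using hz
  obtain ⟨x, hx, x', hx', hne, he⟩ := Set.exists_ne_map_eq_of_ncard_lt_of_maps_to hcard
    (f := f) (fun x hx => (hf x hx).1) (Set.toFinite _)
  obtain ⟨-, A, B, h1, h2, h3, h4, h5, h6, h7⟩ := hf x hx
  obtain ⟨-, A', B', h1', h2', h3', h4', h5', h6', h7'⟩ := hf x' hx'
  have hx'z : H.Adj x' (f x) := by
    have : f x' ∈ H.neighborSet x' := by rw [h1']; exact Or.inr h7'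
    rw [he]; exact this
  have hxx : ¬ H.Adj x x' := by
    intro h
    have : x' ∈ A ∪ B := h1 ▸ h
    rcases this with h | h
    · exact (h2 _ h _ h7).2 (le_hc _ hx'z)
    · exact (h2 _ h5 _ h).2 (le_hc _ hx'.1)
  have hxs : ¬ Simp H x := fun h => hn (h hx.1.symm hx.2.symm hpq.1)
  by_cases hh : (hc H).Adj x x'
  · exact hxs (hel x (Or.inr ⟨x', hxx, hh, A, B, h1, h3, h4, ⟨p, h5, hx'.1.symm⟩, f x, h7, hx'z⟩))
  · have hps : ¬ Simp H p := fun h => hxx (h hx.1 hx'.1 hne)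
    obtain ⟨C, D, g1, -, -, -, g5, g6⟩ := exists_parts hCH hel hps
    have hxC : x ∈ C ∪ D := g1 ▸ hx.1
    have hx'C : x' ∈ C ∪ D := g1 ▸ hx'.1
    refine hps (hel p (Or.inr ⟨q, hn, hpq, C, D, g1, g5, g6, ?_⟩))
    rcases hxC with h | h <;> rcases hx'C with h' | h'
    · exact absurd (g5 h h' hne) hh
    · exact ⟨⟨x, h, hx.2⟩, x', h', hx'.2⟩
    · exact ⟨⟨x', h', hx'.2⟩, x, h, hx.2⟩
    · exact absurd (g6 h h' hne) hh

/-- In a closed graph each neighbourhood consists of at most two cliques. -/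
theorem exists_cliques [Finite V] {H : SimpleGraph V} (hCH : CH H)
    (hel : ∀ x, Elig H x → Simp H x) (x : V) :
    ∃ A ⊆ H.neighborSet x, H.IsClique A ∧ H.IsClique (H.neighborSet x \ A) ∧
      ∀ a ∈ A, ∀ b ∈ H.neighborSet x \ A, ¬ H.Adj a b := by
  by_cases hx : Simp H x
  · exact ⟨_, subset_rfl, hx, by simp, by simp⟩
  · obtain ⟨A, B, h1, -, -, h4, h5, h6⟩ := exists_parts hCH hel hx
    have hB : H.neighborSet x \ A = B := by
      rw [h1]
      ext t
      constructor
      · rintro ⟨h | h, h'⟩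
        · exact absurd h h'
        · exact h
      · intro h
        exact ⟨Or.inr h, fun h' => (h4 t h' t h).1 rfl⟩
    refine ⟨A, h1 ▸ Set.subset_union_left, fun a ha b hb hab => adj_of_hc_adj hCH hel (h5 ha hb hab),
      ?_, ?_⟩
    · rw [hB]
      exact fun a ha b hb hab => adj_of_hc_adj hCH hel (h6 ha hb hab)
    · rw [hB]
      exact fun a ha b hb h => (h4 a ha b hb).2 (le_hc _ h)

end Closure

section Representation

variable {V W : Type*}

/-- `φ` represents `H` as the line graph of a triangle-free graph on `W`. -/
structure IsRep (H : SimpleGraph V) (φ : V → Sym2 W) : Prop where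
  ndiag : ∀ v, ¬ (φ v).IsDiag
  inj : Function.Injective φ
  adj : ∀ u v, H.Adj u v ↔ u ≠ v ∧ ∃ w, w ∈ φ u ∧ w ∈ φ v
  tri : ∀ h₁ h₂ h₃ A B C, φ h₁ = s(A, B) → φ h₂ = s(B, C) → φ h₃ = s(A, C) → False

/-- The root graph of a representation, using only the edges in `U`. -/
def FU (φ : V → Sym2 W) (U : Set V) : SimpleGraph W where
  Adj A B := A ≠ B ∧ ∃ v ∈ U, φ v = s(A, B)
  symm := ⟨fun _ _ h => ⟨h.1.symm, h.2.imp fun _ hv => ⟨hv.1, hv.2.trans Sym2.eq_swap⟩⟩⟩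
  loopless := ⟨fun _ h => h.1 rfl⟩

theorem exists_rep [Finite V] {H : SimpleGraph V} (hd : ∀ v, ∃ u, H.Adj v u)
    (hc : ∀ x, ∃ A ⊆ H.neighborSet x, H.IsClique A ∧ H.IsClique (H.neighborSet x \ A) ∧
      ∀ a ∈ A, ∀ b ∈ H.neighborSet x \ A, ¬ H.Adj a b) :
    ∃ φ : V → Sym2 (Set V), IsRep H φ := by
  choose S hS hS1 hS2 hS3 using hc
  set K : V → V → Set V := fun u v => {u, v} ∪ (H.neighborSet u ∩ H.neighborSet v) with hK
  have hKsymm : ∀ u v, K u v = K v u := by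
    intro u v
    simp only [hK]
    rw [Set.pair_comm, Set.inter_comm]
  have hK1 : ∀ u v, v ∈ S u → insert u (S u) = K u v := by
    intro u v hv
    ext t
    simp only [hK, Set.mem_insert_iff, Set.mem_union, Set.mem_singleton_iff, Set.mem_inter_iff,
      SimpleGraph.mem_neighborSet]
    constructor
    · rintro (rfl | ht)
      · exact Or.inl (Or.inl rfl)
      · by_cases e : t = v
        · exact Or.inl (Or.inr e)
        · exact Or.inr ⟨hS u ht, hS1 u hv ht (Ne.symm e)⟩
    · rintro ((rfl | rfl) | ⟨h1, h2⟩)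
      · exact Or.inl rfl
      · exact Or.inr hv
      · right
        by_contra hn
        exact hS3 u v hv t ⟨h1, hn⟩ h2
  have hK2 : ∀ u v, v ∈ H.neighborSet u \ S u → insert u (H.neighborSet u \ S u) = K u v := by
    intro u v hv
    ext t
    simp only [hK, Set.mem_insert_iff, Set.mem_union, Set.mem_singleton_iff, Set.mem_inter_iff,
      SimpleGraph.mem_neighborSet]
    constructor
    · rintro (rfl | ht)
      · exact Or.inl (Or.inl rfl)
      · by_cases e : t = v
        · exact Or.inl (Or.inr e)
        · exact Or.inr ⟨ht.1, hS2 u hv ht (Ne.symm e)⟩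
    · rintro ((rfl | rfl) | ⟨h1, h2⟩)
      · exact Or.inl rfl
      · exact Or.inr hv
      · right
        refine ⟨h1, fun hn => hS3 u t hn v hv h2.symm⟩
  set φ : V → Sym2 (Set V) :=
    fun u => s(insert u (S u), insert u (H.neighborSet u \ S u)) with hφ
  have hKφ : ∀ u v, H.Adj u v → K u v ∈ φ u := by
    intro u v huv
    by_cases hv : v ∈ S u
    · rw [← hK1 u v hv]
      exact Sym2.mem_mk_left _ _
    · rw [← hK2 u v ⟨huv, hv⟩]
      exact Sym2.mem_mk_right _ _
  have hself : ∀ u, ∀ A ∈ φ u, u ∈ A := by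
    intro u A hA
    rcases Sym2.mem_iff.1 hA with rfl | rfl <;> exact Set.mem_insert _ _
  have hAK : ∀ u v, ∀ A ∈ φ u, v ∈ A → v ≠ u → H.Adj u v ∧ A = K u v := by
    intro u v A hA hv hne
    rcases Sym2.mem_iff.1 hA with rfl | rfl
    · have := hv.resolve_left hne
      exact ⟨hS u this, hK1 u v this⟩
    · have := hv.resolve_left hne
      exact ⟨this.1, hK2 u v this⟩
  have hmem : ∀ u v, ∀ A ∈ φ u, v ∈ A → A ∈ φ v := by
    intro u v A hA hv
    by_cases e : v = u
    · rw [e]; exact hA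
    · obtain ⟨h1, h2⟩ := hAK u v A hA hv e
      rw [h2, hKsymm]
      exact hKφ v u h1.symm
  have hinter : ∀ u v, (∀ A ∈ φ u, v ∈ A) → v = u := by
    intro u v h
    have h1 := h _ (Sym2.mem_mk_left _ _)
    have h2 := h _ (Sym2.mem_mk_right _ _)
    by_contra hne
    exact (h2.resolve_left hne).2 (h1.resolve_left hne)
  have hnd : ∀ v, ¬ (φ v).IsDiag := by
    intro v hv
    have e : insert v (S v) = insert v (H.neighborSet v \ S v) := by simpa [hφ] using hv
    obtain ⟨u, hu⟩ := hd v
    by_cases h : u ∈ S v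
    · have : u ∈ insert v (H.neighborSet v \ S v) := e ▸ Set.mem_insert_of_mem _ h
      exact (this.resolve_left hu.ne').2 h
    · have : u ∈ insert v (S v) := e ▸ Set.mem_insert_of_mem _ ⟨hu, h⟩
      exact h (this.resolve_left hu.ne')
  refine ⟨φ, ⟨hnd, ?_, ?_, ?_⟩⟩
  · intro u v huv
    refine hinter v u fun A hA => ?_
    exact hself u A (huv ▸ hA)
  · intro u v
    constructor
    · intro h
      exact ⟨h.ne, K u v, hKφ u v h, hKsymm u v ▸ hKφ v u h.symm⟩
    · rintro ⟨hne, A, hA, hA'⟩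
      exact (hAK u v A hA (hself v A hA') hne.symm).1
  · intro h₁ h₂ h₃ A B C e1 e2 e3
    have hA1 : A ∈ φ h₁ := e1 ▸ Sym2.mem_mk_left _ _
    have hB1 : B ∈ φ h₁ := e1 ▸ Sym2.mem_mk_right _ _
    have hB2 : B ∈ φ h₂ := e2 ▸ Sym2.mem_mk_left _ _
    have hC2 : C ∈ φ h₂ := e2 ▸ Sym2.mem_mk_right _ _
    have hA3 : A ∈ φ h₃ := e3 ▸ Sym2.mem_mk_left _ _
    have hC3 : C ∈ φ h₃ := e3 ▸ Sym2.mem_mk_right _ _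
    have hd1 : ¬ (φ h₁).IsDiag ∧ ¬ (φ h₂).IsDiag ∧ ¬ (φ h₃).IsDiag := by
      exact ⟨hnd _, hnd _, hnd _⟩
    rw [e1, e2, e3] at hd1
    simp only [Sym2.mk_isDiag_iff] at hd1
    obtain ⟨hAB, hBC, hAC⟩ := hd1
    have e12 : h₂ ≠ h₁ := by
      rintro rfl
      have := e1.symm.trans e2
      simp [hAB, hAC] at this
    have e13 : h₃ ≠ h₁ := by
      rintro rfl
      have := e1.symm.trans e3
      simp [hBC] at this
      exact hAC this.1
    have e23 : h₃ ≠ h₂ := by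
      rintro rfl
      have := e2.symm.trans e3
      simp [Ne.symm hAB] at this
      tauto
    have a12 := hAK h₁ h₂ B hB1 (hself _ _ hB2) e12
    have a13 := hAK h₁ h₃ A hA1 (hself _ _ hA3) e13
    have a23 := hAK h₂ h₃ C hC2 (hself _ _ hC3) e23
    have : h₃ ∈ B := by
      rw [a12.2]
      exact Or.inr ⟨a13.1, a23.1⟩
    have hB3 := hmem h₁ h₃ B hB1 this
    rw [e3, Sym2.mem_iff] at hB3
    rcases hB3 with h | h
    · exact hAB h.symm
    · exact hBC h

end Representation

section Domination

variable {V W : Type*}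

theorem List.IsChain.ne_of_nodup {α : Type*} {R : α → α → Prop} {l : List α} (h : l.IsChain R)
    (hn : l.Nodup) : l.IsChain (fun a b => a ≠ b ∧ R a b) := by
  induction l with
  | nil => simp
  | cons a t ih =>
    cases t with
    | nil => simp
    | cons b t =>
      rw [List.isChain_cons_cons] at h ⊢
      rw [List.nodup_cons] at hn
      refine ⟨⟨?_, h.1⟩, ih h.2 hn.2⟩
      rintro rfl
      exact hn.1 (by simp)

theorem exists_edge_list {φ : V → Sym2 W} {U : Set V} : ∀ {C : List W} {b c : W},
    C.IsChain (FU φ U).Adj → C.getLast? = some b → (FU φ U).Adj b c →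
    ∃ es : List (W × V), es.map Prod.fst = C ∧
      es.IsChain (fun x y => φ x.2 = s(x.1, y.1)) ∧ (∀ x ∈ es.getLast?, φ x.2 = s(x.1, c)) ∧
      ∀ x ∈ es, x.2 ∈ U
  | [], _, _, _, h, _ => by simp at h
  | [a], b, c, _, h, hb => by
    have : a = b := by simpa using h
    subst this
    obtain ⟨-, v, hv, e⟩ := hb
    exact ⟨[(a, v)], by simp [hv, e]⟩
  | a :: a' :: C, b, c, h, hl, hb => by
    rw [List.isChain_cons_cons] at h
    obtain ⟨es, h1, h2, h3, h4⟩ := exists_edge_list (C := a' :: C) h.2 (by simpa using hl) hb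
    obtain ⟨-, v, hv, e⟩ := h.1
    cases es with
    | nil => simp at h1
    | cons x r =>
      obtain ⟨hx, hr⟩ : x.1 = a' ∧ r.map Prod.fst = C := by simpa using h1
      refine ⟨(a, v) :: x :: r, by simp [hx, hr], ?_, ?_, ?_⟩
      · rw [List.isChain_cons_cons]
        exact ⟨by rw [hx]; exact e, h2⟩
      · intro y hy
        exact h3 y (by simpa using hy)
      · intro y hy
        rcases List.mem_cons.1 hy with rfl | hy
        · exact hv
        · exact h4 y hy

theorem edge_list_mem {φ : V → Sym2 W} : ∀ {es : List (W × V)} {c : W},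
    es.IsChain (fun x y => φ x.2 = s(x.1, y.1)) → (∀ x ∈ es.getLast?, φ x.2 = s(x.1, c)) →
    ∀ z ∈ es, ∀ w ∈ φ z.2, w ∈ es.map Prod.fst ∨ w = c
  | [], _, _, _, z, hz, _, _ => by simp at hz
  | [x], c, _, h, z, hz, w, hw => by
    have e : z = x := by simpa using hz
    subst e
    rw [h z (by simp), Sym2.mem_iff] at hw
    simpa using hw
  | x :: y :: r, c, h, hl, z, hz, w, hw => by
    rw [List.isChain_cons_cons] at h
    rcases List.mem_cons.1 hz with rfl | hz
    · rw [h.1, Sym2.mem_iff] at hw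
      rcases hw with rfl | rfl <;> simp
    · rcases edge_list_mem h.2 (fun x hx => hl x (by simpa using hx)) z hz w hw with h | h
      · exact Or.inl (by rw [List.map_cons]; exact List.mem_cons_of_mem _ h)
      · exact Or.inr h

theorem edge_list_nodup_path {φ : V → Sym2 W} : ∀ {es : List (W × V)} {c : W},
    es.IsChain (fun x y => φ x.2 = s(x.1, y.1)) → (∀ x ∈ es.getLast?, φ x.2 = s(x.1, c)) →
    (es.map Prod.fst).Nodup → c ∉ es.map Prod.fst → (es.map Prod.snd).Nodup
  | [], _, _, _, _, _ => by simp
  | [x], _, _, _, _, _ => by simp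
  | x :: y :: r, c, h, hl, hn, hc => by
    rw [List.isChain_cons_cons] at h
    rw [List.map_cons, List.nodup_cons] at hn ⊢
    have hl' : ∀ x ∈ (y :: r).getLast?, φ x.2 = s(x.1, c) := fun x hx => hl x (by simpa using hx)
    rw [List.map_cons, List.mem_cons, not_or] at hc
    refine ⟨fun hx => ?_, edge_list_nodup_path h.2 hl' hn.2 hc.2⟩
    obtain ⟨z, hz, e⟩ := List.mem_map.1 hx
    rcases edge_list_mem h.2 hl' z hz x.1 (by rw [e, h.1]; simp) with h' | h'
    · exact hn.1 h'
    · exact hc.1 h'.symm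

theorem edge_list_nodup_cycle {φ : V → Sym2 W} {x : W × V} {es : List (W × V)}
    (h : (x :: es).IsChain (fun x y => φ x.2 = s(x.1, y.1)))
    (hl : ∀ y ∈ (x :: es).getLast?, φ y.2 = s(y.1, x.1))
    (hn : ((x :: es).map Prod.fst).Nodup) (h3 : 3 ≤ (x :: es).length) :
    ((x :: es).map Prod.snd).Nodup := by
  match es, h3 with
  | y :: z :: r, _ =>
    rw [List.isChain_cons_cons] at h
    have hl' : ∀ t ∈ (y :: z :: r).getLast?, φ t.2 = s(t.1, x.1) :=
      fun t ht => hl t (by simpa using ht)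
    rw [List.map_cons, List.nodup_cons] at hn ⊢
    refine ⟨fun hx => ?_, edge_list_nodup_path h.2 hl' hn.2 hn.1⟩
    obtain ⟨t, ht, e⟩ := List.mem_map.1 hx
    have hyz := h.2
    rw [List.isChain_cons_cons] at hyz
    have hn2 := hn.2
    rw [List.map_cons, List.nodup_cons] at hn2
    rcases List.mem_cons.1 ht with rfl | ht
    · have : x.1 ∈ φ t.2 := by rw [e, h.1]; simp
      rw [hyz.1, Sym2.mem_iff] at this
      rcases this with h' | h'
      · exact hn.1 (by simp [h'])
      · exact hn.1 (by simp [h'])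
    · rcases edge_list_mem hyz.2 (fun s hs => hl' s (by simpa using hs)) t ht y.1
        (by rw [e, h.1]; simp) with h' | h'
      · exact hn2.1 h'
      · exact hn.1 (by simp [h'])

theorem star_seg {φ : V → Sym2 W} {w : W} {e : V} (he : w ∈ φ e) : ∀ {l : List V},
    (∀ v ∈ l, w ∈ φ v) → ∃ u, w ∈ φ u ∧ Seg (fun u v => ∃ w, w ∈ φ u ∧ w ∈ φ v) u e (l ++ [e])
  | [], _ => ⟨e, he, Seg.singleton e⟩
  | a :: l, h => by
    obtain ⟨u, hu, hs⟩ := star_seg he (l := l) fun v hv => h v (by simp [hv])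
    exact ⟨a, h a (by simp), Seg.cons ⟨w, h a (by simp), hu⟩ hs⟩

theorem edge_list_seg {φ : V → Sym2 W} {g : W → List V} (hg : ∀ w, ∀ v ∈ g w, w ∈ φ v) :
    ∀ {es : List (W × V)} {x y : W × V}, (∀ z ∈ es, z.1 ∈ φ z.2) →
    es.IsChain (fun x y => φ x.2 = s(x.1, y.1)) → es.head? = some x → es.getLast? = some y →
    ∃ u, x.1 ∈ φ u ∧ Seg (fun u v => ∃ w, w ∈ φ u ∧ w ∈ φ v) u y.2
      (es.flatMap fun z => g z.1 ++ [z.2])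
  | [], _, _, _, _, h, _ => by simp at h
  | [z], x, y, hz, _, hx, hy => by
    have e1 : z = x := by simpa using hx
    have e2 : z = y := by simpa using hy
    subst e1 e2
    obtain ⟨u, hu, hs⟩ := star_seg (hz z (by simp)) (hg z.1)
    exact ⟨u, hu, by simpa using hs⟩
  | z :: z' :: r, x, y, hz, h, hx, hy => by
    have e1 : z = x := by simpa using hx
    subst e1
    rw [List.isChain_cons_cons] at h
    obtain ⟨u, hu, hs⟩ := star_seg (hz z (by simp)) (hg z.1)
    obtain ⟨u', hu', hs'⟩ := edge_list_seg hg (x := z') (y := y)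
      (fun t ht => hz t (List.mem_cons_of_mem _ ht)) h.2 rfl (by simpa using hy)
    refine ⟨u, hu, ?_⟩
    rw [List.flatMap_cons]
    exact hs.append hs' ⟨z'.1, by rw [h.1]; simp, hu'⟩

theorem hamOn_of_dominating [Finite V] {H : SimpleGraph V} {φ : V → Sym2 W} (hφ : IsRep H φ)
    {U : Set V} {C : List W} (hn : C.Nodup) (h3 : 3 ≤ C.length) (hC : IsCyc (FU φ U).Adj C)
    (hdom : ∀ v ∈ U, ∃ w ∈ C, w ∈ φ v) : HamOn H.Adj U := by
  classical
  obtain ⟨a, b, ⟨hc, hh, hl⟩, hba⟩ := hC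
  obtain ⟨es, e1, e2, e3, e4⟩ := exists_edge_list hc hl hba
  cases es with
  | nil => simp at e1; subst e1; simp at h3
  | cons x r =>
  have hxa : x.1 = a := by
    rw [← e1] at hh; simpa using hh
  subst hxa
  rw [← e1] at hn h3
  rw [List.length_map] at h3
  have hsnd := edge_list_nodup_cycle e2 e3 hn h3
  set es := x :: r with hes
  have hasg : ∀ v, ∃ w, v ∈ U → w ∈ C ∧ w ∈ φ v := by
    intro v
    by_cases hv : v ∈ U
    · obtain ⟨w, h1, h2⟩ := hdom v hv
      exact ⟨w, fun _ => ⟨h1, h2⟩⟩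
    · exact ⟨x.1, fun h => absurd h hv⟩
  choose asg hasg using hasg
  have hfin : ∀ w, {v | v ∈ U ∧ v ∉ es.map Prod.snd ∧ asg v = w}.Finite := fun w => Set.toFinite _
  set g : W → List V := fun w => (hfin w).toFinset.toList with hg
  have hgm : ∀ w v, v ∈ g w ↔ v ∈ U ∧ v ∉ es.map Prod.snd ∧ asg v = w := by
    intro w v
    simp [hg]
    tauto
  obtain ⟨y, hy⟩ : ∃ y, es.getLast? = some y := ⟨_, List.getLast?_eq_some_getLast (by simp [hes])⟩
  have hself : ∀ z ∈ es, z.1 ∈ φ z.2 := by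
    have : ∀ {es : List (W × V)} {c : W}, es.IsChain (fun x y => φ x.2 = s(x.1, y.1)) →
        (∀ x ∈ es.getLast?, φ x.2 = s(x.1, c)) → ∀ z ∈ es, z.1 ∈ φ z.2 := by
      intro es
      induction es with
      | nil => simp
      | cons a t ih =>
        intro c h1 h2 z hz
        cases t with
        | nil =>
          have : z = a := by simpa using hz
          subst this
          rw [h2 z (by simp)]; simp
        | cons b t =>
          rw [List.isChain_cons_cons] at h1
          rcases List.mem_cons.1 hz with rfl | hz
          · rw [h1.1]; simp
          · exact ih h1.2 (fun x hx => h2 x (by simpa using hx)) z hz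
    exact this e2 e3
  obtain ⟨u, hu, hs⟩ := edge_list_seg (g := g) (x := x) (y := y)
    (fun w v hv => by
      have := (hgm w v).1 hv
      rw [← this.2.2]
      exact (hasg v this.1).2) hself e2 rfl hy
  set l := es.flatMap fun z => g z.1 ++ [z.2] with hldef
  have hmem : ∀ v, v ∈ l ↔ v ∈ U := by
    intro v
    rw [hldef, List.mem_flatMap]
    constructor
    · rintro ⟨z, hz, hv⟩
      rcases List.mem_append.1 hv with hv | hv
      · exact ((hgm _ _).1 hv).1
      · rw [List.mem_singleton] at hv
        exact hv ▸ e4 z hz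
    · intro hv
      by_cases hve : v ∈ es.map Prod.snd
      · obtain ⟨z, hz, rfl⟩ := List.mem_map.1 hve
        exact ⟨z, hz, by simp⟩
      · have hw := (hasg v hv).1
        rw [← e1, List.mem_map] at hw
        obtain ⟨z, hz, hzw⟩ := hw
        exact ⟨z, hz, List.mem_append_left _ ((hgm _ _).2 ⟨hv, hve, hzw.symm⟩)⟩
  have hln : l.Nodup := by
    rw [hldef, List.nodup_flatMap]
    constructor
    · intro z hz
      rw [List.nodup_append]
      refine ⟨Finset.nodup_toList _, by simp, ?_⟩
      intro v hv v' hv' e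
      rw [List.mem_singleton] at hv'
      subst e hv'
      exact ((hgm _ _).1 hv).2.1 (List.mem_map_of_mem hz)
    · have h1 : es.Pairwise fun z z' => z.1 ≠ z'.1 := List.pairwise_map.1 hn
      have h2 : es.Pairwise fun z z' => z.2 ≠ z'.2 := List.pairwise_map.1 hsnd
      refine List.Pairwise.imp_of_mem ?_ (h1.and h2)
      intro z z' hz hz' hzz
      rw [Function.onFun, List.disjoint_left]
      intro v hv hv'
      rcases List.mem_append.1 hv with hv | hv <;> rcases List.mem_append.1 hv' with hv' | hv'
      · exact hzz.1 (((hgm _ _).1 hv).2.2.symm.trans ((hgm _ _).1 hv').2.2)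
      · rw [List.mem_singleton] at hv'
        exact ((hgm _ _).1 hv).2.1 (hv' ▸ List.mem_map_of_mem hz')
      · rw [List.mem_singleton] at hv
        exact ((hgm _ _).1 hv').2.1 (hv ▸ List.mem_map_of_mem hz)
      · rw [List.mem_singleton] at hv hv'
        exact hzz.2 (hv.symm.trans hv')
  have hlen : 3 ≤ l.length := by
    have hsub : es.map Prod.snd ⊆ l := by
      intro v hv
      obtain ⟨z, hz, rfl⟩ := List.mem_map.1 hv
      exact (hmem _).2 (e4 z hz)
    have := (hsnd.subperm hsub).length_le
    rw [List.length_map] at this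
    omega
  refine ⟨l, hln, hmem, hlen, u, y.2, ⟨?_, hs.2⟩, ?_⟩
  · exact (hs.1.ne_of_nodup hln).imp fun a b hab => (hφ.adj a b).2 hab
  · rw [hφ.adj]
    refine ⟨fun e => ?_, x.1, by rw [e3 y hy]; simp, hu⟩
    have := hs.eq_singleton hln e.symm
    rw [this] at hlen
    simp at hlen

end Domination

section Theta

variable {V W : Type*}

/-- A branch of a theta graph with hubs `a` and `b`: the inner path `I` inside a set `S` which
offers a neighbour to each end of `I`, and all of which can be reached from both hubs. -/
structure Branch (F : SimpleGraph W) (a b : W) (I : List W) (S : Set W) : Prop where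
  nodup : I.Nodup
  sub : ∀ w ∈ I, w ∈ S
  ha : a ∉ S
  hb : b ∉ S
  seg : ∃ u v, Seg F.Adj u v I ∧ F.Adj a u ∧ F.Adj v b ∧ (∃ u' ∈ S, F.Adj u u') ∧
    ∃ v' ∈ S, F.Adj v v'
  toA : ∀ z ∈ S, ∃ l u, l.Nodup ∧ (∀ w ∈ l, w ∈ S) ∧ Seg F.Adj u z l ∧ F.Adj a u
  toB : ∀ z ∈ S, ∃ l u, l.Nodup ∧ (∀ w ∈ l, w ∈ S) ∧ Seg F.Adj u z l ∧ F.Adj b u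

/-- Three branches with common hubs. -/
def IsTheta (F : SimpleGraph W) : Prop :=
  ∃ a b, a ≠ b ∧ ∃ (I : Fin 3 → List W) (S : Fin 3 → Set W),
    (∀ i, Branch F a b (I i) (S i)) ∧ ∀ i j, i ≠ j → Disjoint (S i) (S j)

theorem Branch.symm {F : SimpleGraph W} {a b : W} {I : List W} {S : Set W} (h : Branch F a b I S) :
    Branch F b a I.reverse S := by
  obtain ⟨h1, h2, h3, h4, ⟨u, v, h5, h6, h7, h8, h9⟩, h10, h11⟩ := h
  exact ⟨List.nodup_reverse.2 h1, fun w hw => h2 w (List.mem_reverse.1 hw), h4, h3,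
    ⟨v, u, h5.reverse fun _ _ h => h.symm, h7.symm, h6.symm, h9, h8⟩, h11, h10⟩

theorem Branch.mono {F F' : SimpleGraph W} (hF : F ≤ F') {a b : W} {I : List W} {S : Set W}
    (h : Branch F a b I S) : Branch F' a b I S := by
  obtain ⟨h1, h2, h3, h4, ⟨u, v, h5, h6, h7, ⟨u', h8, h8'⟩, v', h9, h9'⟩, h10, h11⟩ := h
  refine ⟨h1, h2, h3, h4, ⟨u, v, h5.mono fun _ _ h => hF h, hF h6, hF h7, ⟨u', h8, hF h8'⟩,
    v', h9, hF h9'⟩, fun z hz => ?_, fun z hz => ?_⟩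
  · obtain ⟨l, u, g1, g2, g3, g4⟩ := h10 z hz
    exact ⟨l, u, g1, g2, g3.mono fun _ _ h => hF h, hF g4⟩
  · obtain ⟨l, u, g1, g2, g3, g4⟩ := h11 z hz
    exact ⟨l, u, g1, g2, g3.mono fun _ _ h => hF h, hF g4⟩

theorem IsTheta.mono {F F' : SimpleGraph W} (hF : F ≤ F') (h : IsTheta F) : IsTheta F' := by
  obtain ⟨a, b, hab, I, S, h1, h2⟩ := h
  exact ⟨a, b, hab, I, S, fun i => (h1 i).mono hF, h2⟩

theorem Seg.exists_second {R : W → W → Prop} {u v : W} {l : List W} (h : Seg R u v l)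
    (hl : 2 ≤ l.length) : ∃ u' ∈ l, R u u' := by
  match l, hl with
  | x :: y :: t, _ =>
    obtain ⟨h1, h2, -⟩ := h
    have : x = u := by simpa using h2
    subst this
    rw [List.isChain_cons_cons] at h1
    exact ⟨y, by simp, h1.1⟩

theorem Seg.prefix_to {R : W → W → Prop} {u v z : W} {l : List W} (h : Seg R u v l)
    (hz : z ∈ l) (hn : l.Nodup) : ∃ l', l'.Nodup ∧ (∀ w ∈ l', w ∈ l) ∧ Seg R u z l' := by
  obtain ⟨P, Q, rfl⟩ := List.append_of_mem hz
  rcases eq_or_ne Q [] with rfl | hQ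
  · have : z = v := by simpa using h.2.2
    exact ⟨_, hn, fun _ hw => hw, by rw [this] at h ⊢; exact h⟩
  · have e : P ++ z :: Q = (P ++ [z]) ++ Q := by simp
    rw [e] at h hn ⊢
    obtain ⟨a, b, h1, -, -⟩ := h.split (by simp) hQ
    have : z = a := by simpa using h1.2.2
    exact ⟨P ++ [z], (List.nodup_append.1 hn).1, fun w hw => List.mem_append_left _ hw, this ▸ h1⟩

theorem branch_of_long {F : SimpleGraph W} {a b u v : W} {I : List W} (hs : Seg F.Adj u v I)
    (hn : I.Nodup) (hl : 2 ≤ I.length) (hau : F.Adj a u) (hvb : F.Adj v b) (ha : a ∉ I)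
    (hb : b ∉ I) : Branch F a b I {w | w ∈ I} := by
  have hr := hs.reverse fun _ _ h => h.symm
  refine ⟨hn, fun _ h => h, ha, hb, ⟨u, v, hs, hau, hvb, hs.exists_second hl, ?_⟩, ?_, ?_⟩
  · obtain ⟨v', h1, h2⟩ := hr.exists_second (by simpa using hl)
    exact ⟨v', List.mem_reverse.1 h1, h2⟩
  · intro z hz
    obtain ⟨l, h1, h2, h3⟩ := hs.prefix_to hz hn
    exact ⟨l, u, h1, h2, h3, hau⟩
  · intro z hz
    obtain ⟨l, h1, h2, h3⟩ := hr.prefix_to (List.mem_reverse.2 hz) (List.nodup_reverse.2 hn)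
    exact ⟨l, v, h1, fun w hw => List.mem_reverse.1 (h2 w hw), h3, hvb.symm⟩

theorem branch_of_stub {F : SimpleGraph W} {a b q c : W} (haq : F.Adj a q) (hqb : F.Adj q b)
    (hqc : F.Adj q c) (hca : c ≠ a) (hcb : c ≠ b) : Branch F a b [q] {q, c} := by
  have key : ∀ a, F.Adj a q → ∀ z ∈ ({q, c} : Set W), ∃ l u, l.Nodup ∧ (∀ w ∈ l, w ∈ ({q, c} : Set W)) ∧
      Seg F.Adj u z l ∧ F.Adj a u := by
    intro a ha z hz
    rcases hz with rfl | rfl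
    · exact ⟨[z], z, by simp, by simp, Seg.singleton _, ha⟩
    · exact ⟨[q, z], q, by simp [hqc.ne], by simp, Seg.cons hqc (Seg.singleton _), ha⟩
  refine ⟨by simp, by simp, ?_, ?_, ⟨q, q, Seg.singleton q, haq, hqb, ⟨c, by simp, hqc⟩, c, by simp,
    hqc⟩, key a haq, key b hqb.symm⟩
  · rintro (h | h)
    · exact haq.ne h
    · exact hca h.symm
  · rintro (h | h)
    · exact hqb.ne h.symm
    · exact hcb h.symm

theorem seg_of_reachable {K : SimpleGraph W} {u v : W} (h : K.Reachable u v) :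
    ∃ l, Seg K.Adj u v l ∧ l.Nodup ∧ ∀ w ∈ l, K.Reachable u w := by
  classical
  obtain ⟨p, hp⟩ := h.exists_isPath
  refine ⟨p.support, ⟨p.isChain_adj_support, ?_, ?_⟩, hp.support_nodup, fun w hw => ⟨p.takeUntil w hw⟩⟩
  · rw [List.head?_eq_some_head p.support_ne_nil, SimpleGraph.Walk.head_support]
  · rw [List.getLast?_eq_some_getLast p.support_ne_nil, SimpleGraph.Walk.getLast_support]

/-- 2-connectedness of the subgraph induced by `U`, in cut form. -/
def TC (H : SimpleGraph V) (U : Set V) : Prop :=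
  3 ≤ U.ncard ∧ ∀ z, ∀ A ⊆ U \ {z}, A.Nonempty → A ≠ U \ {z} →
    ∃ a ∈ A, ∃ b ∈ (U \ {z}) \ A, H.Adj a b

theorem TC.conn [Finite V] {H : SimpleGraph V} {U : Set V} (h : TC H U) {A : Set V} (hA : A ⊆ U)
    (hne : A.Nonempty) (hAU : A ≠ U) : ∃ a ∈ A, ∃ b ∈ U \ A, H.Adj a b := by
  obtain ⟨z, hz⟩ := hne
  obtain ⟨y, hy, hyA⟩ := Set.exists_of_ssubset (hA.ssubset_of_ne hAU)
  by_cases hs : (A \ {z}).Nonempty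
  · obtain ⟨a, ha, b, hb, hab⟩ := h.2 z (A \ {z}) (fun t ht => ⟨hA ht.1, ht.2⟩) hs (by
      intro e
      have : y ∈ U \ {z} := ⟨hy, fun e => hyA (by rw [Set.mem_singleton_iff] at e; rwa [e])⟩
      rw [← e] at this
      exact hyA this.1)
    exact ⟨a, ha.1, b, ⟨hb.1.1, fun hbA => hb.2 ⟨hbA, hb.1.2⟩⟩, hab⟩
  · have hAz : A = {z} := by
      ext t
      constructor
      · intro ht
        by_contra htz
        exact hs ⟨t, ht, htz⟩
      · rintro rfl
        exact hz
    obtain ⟨a, ha, b, hb, hab⟩ := h.2 y A (fun t ht => ⟨hA ht, fun e => hyA (by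
      rw [Set.mem_singleton_iff] at e; rwa [← e])⟩) ⟨z, hz⟩ (by
      intro e
      have h1 := Set.ncard_sdiff_singleton_add_one hy (Set.toFinite _)
      rw [← e, hAz, Set.ncard_singleton] at h1
      have := h.1
      omega)
    exact ⟨a, ha, b, ⟨hb.1.1, hb.2⟩, hab⟩

theorem TC.glue [Finite V] {H : SimpleGraph V} {V₁ V₂ K₁ : Set V} (h : TC H (V₁ ∪ V₂))
    (hd : Disjoint V₁ V₂) (hcross : ∀ a ∈ V₁, ∀ b ∈ V₂, H.Adj a b → a ∈ K₁)
    (hK : H.IsClique K₁) {k : V} (hk : k ∈ V₂) (hkK : ∀ a ∈ K₁, H.Adj k a) (h1 : 2 ≤ V₁.ncard)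
    (h2 : 2 ≤ V₂.ncard) : TC H (insert k V₁) := by
  have hk1 : k ∉ V₁ := fun h' => Set.disjoint_left.1 hd h' hk
  refine ⟨by rw [Set.ncard_insert_of_notMem hk1 (Set.toFinite _)]; omega, ?_⟩
  intro z A hA hne hAU
  by_contra hno
  push Not at hno
  set B := (insert k V₁ \ {z}) \ A with hB
  have hBne : B.Nonempty := Set.sdiff_nonempty.2 fun hh => hAU (Set.Subset.antisymm hA hh)
  have hpart : ∀ t ∈ insert k V₁, t ≠ z → t ∈ A ∨ t ∈ B := by
    intro t ht htz
    by_cases h' : t ∈ A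
    · exact Or.inl h'
    · exact Or.inr ⟨⟨ht, htz⟩, h'⟩
  have hdAB : ∀ t ∈ A, t ∉ B := fun t ht ht' => ht'.2 ht
  have hAz : ∀ t ∈ A, t ≠ z := fun t ht => (hA ht).2
  have hBz : ∀ t ∈ B, t ≠ z := fun t ht => ht.1.2
  -- a part inside `V₁` avoiding `K₁`
  have key : ∀ X Y : Set V, X.Nonempty → X ⊆ V₁ → (∀ t ∈ X, t ∉ K₁) → (∀ t ∈ X, t ≠ z) →
      (∀ t ∈ V₁, t ≠ z → t ∈ X ∨ t ∈ Y) → (∀ a ∈ X, ∀ b ∈ Y, ¬ H.Adj a b) → False := by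
    intro X Y hX hX1 hXK hXz hXY hXYn
    obtain ⟨y, hy, hyz⟩ : ∃ y ∈ V₂, y ≠ z := by
      by_contra hcon
      push Not at hcon
      have : V₂ ⊆ {z} := fun t ht => hcon t ht
      have := Set.ncard_le_ncard this (Set.toFinite _)
      rw [Set.ncard_singleton] at this
      omega
    obtain ⟨a, ha, b, hb, hab⟩ := h.2 z X (fun t ht => ⟨Or.inl (hX1 ht), hXz t ht⟩) hX (by
      intro e
      have : y ∈ X := by rw [e]; exact ⟨Or.inr hy, hyz⟩
      exact Set.disjoint_left.1 hd (hX1 this) hy)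
    rcases hb.1.1 with hb1 | hb2
    · rcases hXY b hb1 hb.1.2 with h' | h'
      · exact hb.2 h'
      · exact hXYn a ha b h' hab
    · exact hXK a ha (hcross a (hX1 ha) b hb2 hab)
  have hV₁ : ∀ X : Set V, X ⊆ insert k V₁ → k ∉ X → X ⊆ V₁ := by
    intro X hX hkX t ht
    rcases hX ht with rfl | h'
    · exact absurd ht hkX
    · exact h'
  have hAi : A ⊆ insert k V₁ := fun t ht => (hA ht).1
  have hBi : B ⊆ insert k V₁ := fun t ht => ht.1.1
  have sA : k ∉ A → (∀ t ∈ A, t ∉ K₁) → False := fun g1 g2 =>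
    key A B hne (hV₁ A hAi g1) g2 hAz (fun t ht => hpart t (Or.inr ht)) fun a ha b hb => hno a ha b hb
  have sB : k ∉ B → (∀ t ∈ B, t ∉ K₁) → False := fun g1 g2 =>
    key B A hBne (hV₁ B hBi g1) g2 hBz (fun t ht htz => (hpart t (Or.inr ht) htz).symm)
      fun a ha b hb hab => hno b hb a ha hab.symm
  by_cases hkz : k = z
  · have hkA : k ∉ A := fun h' => hAz k h' hkz
    have hkB : k ∉ B := fun h' => hBz k h' hkz
    by_cases hx : ∀ t ∈ A, t ∉ K₁
    · exact sA hkA hx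
    · push Not at hx
      obtain ⟨x, hx, hxK⟩ := hx
      refine sB hkB fun t ht htK => ?_
      exact hno x hx t ht (hK hxK htK fun e => hdAB x hx (e ▸ ht))
  · rcases hpart k (Or.inl rfl) hkz with hk' | hk'
    · exact sB (hdAB k hk') fun t ht htK => hno k hk' t ht (hkK t htK)
    · exact sA (fun h' => hdAB k h' hk') fun t ht htK => hno t ht k hk' (hkK t htK).symm

theorem hamOn_path [Finite V] {H : SimpleGraph V} {X : Set V} {k : V} (hk : k ∉ X)
    (h : HamOn H.Adj (insert k X)) :
    ∃ l u v, l.Nodup ∧ (∀ w, w ∈ l ↔ w ∈ X) ∧ 2 ≤ l.length ∧ Seg H.Adj u v l ∧ H.Adj k u ∧ H.Adj k v := by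
  obtain ⟨l, h1, h2, h3, h4⟩ := h
  obtain ⟨P, Q, rfl⟩ := List.append_of_mem ((h2 k).2 (Set.mem_insert _ _))
  have h5 := h4.rotate
  have hp : (k :: (Q ++ P)).Perm (P ++ k :: Q) := by
    rw [← List.cons_append]; exact List.perm_append_comm
  have h6 := hp.nodup_iff.2 h1
  have h7 := hp.length_eq
  rw [List.cons_append] at h5
  set l' := Q ++ P
  obtain ⟨a, b, hs, hba⟩ := h5
  have hne : l' ≠ [] := by
    intro e
    rw [← h7, e] at h3
    simp at h3
  obtain ⟨c, d, g1, g2, g3⟩ := Seg.split (l := [k]) (l' := l') hs (by simp) hne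
  have e1 : k = a := by simpa using g1.2.1
  have e2 : k = c := by simpa using g1.2.2
  subst e1
  subst e2
  refine ⟨l', d, b, (List.nodup_cons.1 h6).2, fun w => ?_, ?_, g2, g3, hba.symm⟩
  · have := (hp.mem_iff (a := w)).trans (h2 w)
    rw [List.mem_cons, Set.mem_insert_iff] at this
    have hkl := (List.nodup_cons.1 h6).1
    constructor
    · intro hw
      exact (this.1 (Or.inr hw)).resolve_left fun e => hkl (e ▸ hw)
    · intro hw
      exact (this.2 (Or.inr hw)).resolve_left fun e => hk (e ▸ hw)
  · rw [List.length_cons] at h7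
    omega

theorem hamOn_glue [Finite V] {H : SimpleGraph V} {V₁ V₂ : Set V} {k₁ k₂ : V}
    (hd : Disjoint V₁ V₂) (hk₁ : k₁ ∈ V₁) (hk₂ : k₂ ∈ V₂)
    (hadj : ∀ a ∈ V₁, ∀ b ∈ V₂, H.Adj k₂ a → H.Adj k₁ b → H.Adj a b)
    (h₁ : HamOn H.Adj (insert k₂ V₁)) (h₂ : HamOn H.Adj (insert k₁ V₂)) :
    HamOn H.Adj (V₁ ∪ V₂) := by
  obtain ⟨l, u, v, a1, a2, a3, a4, a5, a6⟩ :=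
    hamOn_path (fun h => Set.disjoint_left.1 hd h hk₂) h₁
  obtain ⟨l', u', v', b1, b2, b3, b4, b5, b6⟩ :=
    hamOn_path (fun h => Set.disjoint_left.1 hd hk₁ h) h₂
  have hu := (a2 u).1 a4.head_mem
  have hv := (a2 v).1 a4.last_mem
  have hu' := (b2 u').1 b4.head_mem
  have hv' := (b2 v').1 b4.last_mem
  refine ⟨l ++ l', ?_, ?_, ?_, u, v', a4.append b4 (hadj v hv u' hu' a6 b5), (hadj u hu v' hv' a5 b6).symm⟩
  · rw [List.nodup_append]
    refine ⟨a1, b1, ?_⟩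
    rintro a ha _ hb rfl
    exact Set.disjoint_left.1 hd ((a2 a).1 ha) ((b2 a).1 hb)
  · intro w
    rw [List.mem_append, a2, b2]
    rfl
  · simp; omega

theorem exists_cycle [Finite V] {H : SimpleGraph V} {φ : V → Sym2 W} (hφ : IsRep H φ) {U : Set V}
    (hU : TC H U) (hn : ¬ HamOn H.Adj U) :
    ∃ C : List W, C.Nodup ∧ 3 ≤ C.length ∧ IsCyc (FU φ U).Adj C := by
  classical
  -- `U` is not a clique
  have hcl : ¬ H.IsClique U := by
    intro hcl
    apply hn
    set l := (Set.toFinite U).toFinset.toList with hl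
    have hmem : ∀ v, v ∈ l ↔ v ∈ U := by simp [hl]
    have hnd : l.Nodup := Finset.nodup_toList _
    have hlen : 3 ≤ l.length := by
      rw [hl, Finset.length_toList, ← Set.ncard_eq_toFinset_card]
      exact hU.1
    have hne : l ≠ [] := by rintro e; rw [e] at hlen; simp at hlen
    have hs : Seg (fun a b => a ≠ b ∧ a ∈ U ∧ b ∈ U) (l.head hne) (l.getLast hne) l := by
      refine ⟨?_, List.head?_eq_some_head hne, List.getLast?_eq_some_getLast hne⟩
      refine List.IsChain.ne_of_nodup (R := fun a b => a ∈ U ∧ b ∈ U) ?_ hnd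
      have : ∀ m : List V, (∀ v ∈ m, v ∈ U) → m.IsChain fun a b => a ∈ U ∧ b ∈ U := by
        intro m
        induction m with
        | nil => simp
        | cons a t ih =>
          intro h
          cases t with
          | nil => simp
          | cons b t =>
            rw [List.isChain_cons_cons]
            exact ⟨⟨h a (by simp), h b (by simp)⟩, ih fun v hv => h v (List.mem_cons_of_mem _ hv)⟩
      exact this l fun v hv => (hmem v).1 hv
    refine ⟨l, hnd, hmem, hlen, _, _, hs.mono fun a b h => hcl h.2.1 h.2.2 h.1, ?_⟩
    refine hcl ((hmem _).1 hs.last_mem) ((hmem _).1 hs.head_mem) fun e => ?_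
    have := hs.eq_singleton hnd e.symm
    rw [this] at hlen
    simp at hlen
  have : ∃ h₁ ∈ U, ∃ h₂ ∈ U, ∃ h₃ ∈ U, h₁ ≠ h₃ ∧ H.Adj h₁ h₂ ∧ H.Adj h₂ h₃ ∧ ¬ H.Adj h₁ h₃ := by
    rw [SimpleGraph.isClique_iff, Set.Pairwise] at hcl
    push Not at hcl
    obtain ⟨a, ha, b, hb, hab, hnab⟩ := hcl
    obtain ⟨c, hc, d, hd, hcd⟩ := hU.conn (A := {t | t ∈ U ∧ (t = a ∨ H.Adj a t)}) (fun t ht => ht.1)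
      ⟨a, ha, Or.inl rfl⟩ (by
        intro e
        have : b ∈ {t | t ∈ U ∧ (t = a ∨ H.Adj a t)} := by rw [e]; exact hb
        rcases this.2 with h | h
        · exact hab h.symm
        · exact hnab h)
    have hd2 : ¬ (d = a ∨ H.Adj a d) := fun h => hd.2 ⟨hd.1, h⟩
    push Not at hd2
    rcases hc.2 with rfl | h
    · exact absurd hcd hd2.2
    · exact ⟨a, ha, c, hc.1, d, hd.1, hd2.1.symm, h, hcd, hd2.2⟩
  obtain ⟨h₁, m₁, h₂, m₂, h₃, m₃, hne, h12, h23, h13⟩ := this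
  obtain ⟨-, p, hp1, hp2⟩ := (hφ.adj _ _).1 h12
  obtain ⟨-, q, hq2, hq3⟩ := (hφ.adj _ _).1 h23
  have hpq : p ≠ q := by
    rintro rfl
    exact h13 ((hφ.adj _ _).2 ⟨hne, p, hp1, hq3⟩)
  have he : φ h₂ = s(p, q) := ((Sym2.mem_and_mem_iff hpq).1 ⟨hp2, hq2⟩)
  set K := FU φ (U \ {h₂}) with hK
  have hreach : K.Reachable p q := by
    by_contra hr
    -- the edges meeting the component of `p`
    have hboth : ∀ v ∈ U \ {h₂}, ∀ w ∈ φ v, ∀ w' ∈ φ v, K.Reachable p w → K.Reachable p w' := by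
      intro v hv w hw w' hw' hpw
      by_cases e : w = w'
      · rwa [← e]
      · exact hpw.trans (SimpleGraph.Adj.reachable ⟨e, v, hv, (Sym2.mem_and_mem_iff e).1 ⟨hw, hw'⟩⟩)
    obtain ⟨a, ha, b, hb, hab⟩ := hU.2 h₂ {v | v ∈ U \ {h₂} ∧ ∃ w ∈ φ v, K.Reachable p w}
      (fun v hv => hv.1) ⟨h₁, ⟨m₁, h12.ne⟩, p, hp1, SimpleGraph.Reachable.refl _⟩ (by
        intro e
        have : h₃ ∈ {v | v ∈ U \ {h₂} ∧ ∃ w ∈ φ v, K.Reachable p w} := by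
          rw [e]; exact ⟨m₃, h23.ne'⟩
        obtain ⟨h3, w, hw, hpw⟩ := this
        exact hr (hboth h₃ h3 w hw q hq3 hpw))
    obtain ⟨-, w, hwa, hwb⟩ := (hφ.adj _ _).1 hab
    obtain ⟨ha1, w', hw', hpw'⟩ := ha
    exact hb.2 ⟨hb.1, w, hwb, hboth a ha1 w' hw' w hwa hpw'⟩
  obtain ⟨l, hs, hnd, -⟩ := seg_of_reachable hreach
  have hKU : ∀ a b, K.Adj a b → (FU φ U).Adj a b := fun a b h =>
    ⟨h.1, h.2.imp fun v hv => ⟨hv.1.1, hv.2⟩⟩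
  refine ⟨l, hnd, ?_, p, q, hs.mono hKU, hpq.symm, h₂, m₂, he.trans Sym2.eq_swap⟩
  by_contra hlen
  match l, hs, hlen with
  | [], hs, _ => exact hs.ne_nil rfl
  | [x], hs, _ =>
    have e1 : x = p := by simpa using hs.2.1
    have e2 : x = q := by simpa using hs.2.2
    exact hpq (e1.symm.trans e2)
  | [x, y], hs, _ =>
    have e1 : x = p := by simpa using hs.2.1
    have e2 : y = q := by simpa using hs.2.2
    have h := hs.1
    rw [List.isChain_pair] at h
    rw [e1, e2] at h
    obtain ⟨-, v, hv, e⟩ := h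
    exact hv.2 (hφ.inj (e.trans he.symm))
  | _ :: _ :: _ :: _, _, hlen => simp at hlen

end Theta

section ThetaExistence

variable {V W : Type*}

/-- A cycle `C` together with a connected set `R` off the cycle, such that no cycle meeting `R`
dominates all the edges dominated by `C`. -/
structure Ear (F : SimpleGraph W) (C : List W) (R : Set W) : Prop where
  nodup : C.Nodup
  len : 3 ≤ C.length
  cyc : IsCyc F.Adj C
  disj : ∀ ρ ∈ R, ρ ∉ C
  nbr : ∀ ρ ∈ R, ∃ ρ' ∈ R, F.Adj ρ ρ'
  closed : ∀ ρ ∈ R, ∀ w, F.Adj ρ w → w ∈ R ∨ w ∈ C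
  conn : ∀ ρ ∈ R, ∀ ρ' ∈ R, ∃ l, l.Nodup ∧ (∀ w ∈ l, w ∈ R) ∧ Seg F.Adj ρ ρ' l
  improve : ∀ C' : List W, C'.Nodup → 3 ≤ C'.length → IsCyc F.Adj C' → (∃ ρ ∈ R, ρ ∈ C') →
    ∃ u v, F.Adj u v ∧ u ∈ C ∧ u ∉ C' ∧ v ∉ C'

theorem Ear.rotate {F : SimpleGraph W} {l l' : List W} {R : Set W} (h : Ear F (l ++ l') R) :
    Ear F (l' ++ l) R := by
  have hp : (l' ++ l).Perm (l ++ l') := List.perm_append_comm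
  obtain ⟨h1, h2, h3, h4, h5, h6, h7, h8⟩ := h
  refine ⟨hp.nodup_iff.2 h1, by rw [hp.length_eq]; exact h2, h3.rotate,
    fun ρ hρ => by rw [hp.mem_iff]; exact h4 ρ hρ, h5,
    fun ρ hρ w hw => by rw [hp.mem_iff]; exact h6 ρ hρ w hw, h7, fun C' a1 a2 a3 a4 => ?_⟩
  obtain ⟨u, v, b1, b2, b3⟩ := h8 C' a1 a2 a3 a4
  exact ⟨u, v, b1, hp.mem_iff.2 b2, b3⟩

theorem IsCyc.seg_tail {R : W → W → Prop} {t : W} {l : List W} (h : IsCyc R (t :: l)) (hl : l ≠ []) :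
    ∃ a b, Seg R a b l ∧ R t a ∧ R b t := by
  obtain ⟨u, v, hs, hvu⟩ := h
  obtain ⟨c, d, g1, g2, g3⟩ := Seg.split (l := [t]) (l' := l) hs (by simp) hl
  have e1 : t = u := by simpa using g1.2.1
  have e2 : t = c := by simpa using g1.2.2
  subst e1
  subst e2
  exact ⟨d, v, g2, g3, hvu⟩

theorem Seg.head_eq {R : W → W → Prop} {u v t : W} {l : List W} (h : Seg R u v (t :: l)) : t = u := by
  simpa using h.2.1

theorem Ear.detour {F : SimpleGraph W} {R : Set W} {t₁ t₂ : W} {Q₁ Q₂ : List W}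
    (h : Ear F (t₁ :: (Q₁ ++ t₂ :: Q₂)) R) (h₁ : ∃ ρ ∈ R, F.Adj t₁ ρ) (h₂ : ∃ ρ ∈ R, F.Adj t₂ ρ) :
    ∃ q ∈ Q₁, ∃ v, F.Adj q v ∧ v ∉ t₁ :: t₂ :: Q₂ := by
  obtain ⟨ρ₁, m₁, a₁⟩ := h₁
  obtain ⟨ρ₂, m₂, a₂⟩ := h₂
  obtain ⟨I, i1, i2, i3⟩ := h.conn ρ₁ m₁ ρ₂ m₂
  have hs : ∃ b, Seg F.Adj t₂ b (t₂ :: Q₂) ∧ F.Adj b t₁ := by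
    obtain ⟨a, b, g1, -, g3⟩ := h.cyc.seg_tail (by simp)
    rcases eq_or_ne Q₁ [] with rfl | hQ
    · have := Seg.head_eq g1
      subst this
      exact ⟨b, g1, g3⟩
    · obtain ⟨c, d, k1, k2, k3⟩ := g1.split hQ (by simp)
      have := k2.head_eq
      subst this
      exact ⟨b, k2, g3⟩
  obtain ⟨b, hs, hb⟩ := hs
  have hn := h.nodup
  have hdis := h.disj
  obtain ⟨u, v, c1, c2, c3, c4⟩ := h.improve (t₁ :: (I ++ t₂ :: Q₂)) (by
      rw [List.nodup_cons, List.nodup_append] at hn ⊢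
      refine ⟨?_, i1, hn.2.2.1, ?_⟩
      · rw [List.mem_append]
        rintro (h' | h')
        · exact hdis _ (i2 _ h') (by simp)
        · exact hn.1 (List.mem_append_right _ h')
      · rintro x hx _ hy rfl
        exact hdis _ (i2 _ hx) (List.mem_cons_of_mem _ (List.mem_append_right _ hy))) (by
      have := List.length_pos_iff.2 i3.ne_nil
      simp; omega)
    ⟨t₁, b, Seg.cons a₁ (i3.append hs a₂.symm), hb⟩ ⟨ρ₁, m₁, by simp [i3.head_mem]⟩
  have hu : u ∈ Q₁ := by
    simp only [List.mem_cons, List.mem_append] at c2 c3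
    tauto
  refine ⟨u, hu, v, c1, ?_⟩
  simp only [List.mem_cons, List.mem_append] at c4 ⊢
  tauto

theorem Ear.not_adjacent {F : SimpleGraph W} {R : Set W} {t₁ t₂ : W} {Q : List W}
    (h : Ear F (t₁ :: t₂ :: Q) R) (h₁ : ∃ ρ ∈ R, F.Adj t₁ ρ) (h₂ : ∃ ρ ∈ R, F.Adj t₂ ρ) : False := by
  obtain ⟨q, h', -⟩ := Ear.detour (Q₁ := []) h h₁ h₂
  simp at h'

theorem Ear.exists_branch {F : SimpleGraph W} {R : Set W} {t₁ t₂ : W} {Q₁ Q₂ : List W}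
    (h : Ear F (t₁ :: (Q₁ ++ t₂ :: Q₂)) R) (h₁ : ∃ ρ ∈ R, F.Adj t₁ ρ) (h₂ : ∃ ρ ∈ R, F.Adj t₂ ρ) :
    ∃ S, Branch F t₁ t₂ Q₁ S ∧ ∀ w ∈ S, w ∈ Q₁ ∨
      (w ∉ t₁ :: (Q₁ ++ t₂ :: Q₂) ∧ w ∉ R ∧ ∃ q, Q₁ = [q] ∧ F.Adj q w) := by
  have hQ : Q₁ ≠ [] := by
    rintro rfl
    exact h.not_adjacent h₁ h₂
  obtain ⟨a, b, g1, g2, g3⟩ := h.cyc.seg_tail (by simp)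
  obtain ⟨c, d, k1, k2, k3⟩ := g1.split hQ (by simp)
  have := k2.head_eq
  subst this
  have hn := h.nodup
  rw [List.nodup_cons, List.nodup_append] at hn
  have ht1 : t₁ ∉ Q₁ := fun h' => hn.1 (List.mem_append_left _ h')
  have ht2 : t₂ ∉ Q₁ := fun h' => hn.2.2.2 _ h' _ (by simp) rfl
  match Q₁, hQ with
  | [q], _ =>
    have e1 := k1.head_eq
    subst e1
    have e2 : q = c := by simpa using k1.2.2
    subst e2
    obtain ⟨q', hq', v, v1, v2⟩ := h.detour h₁ h₂
    have : q' = q := by simpa using hq'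
    subst this
    by_cases v3 : v ∈ R
    · exact (Ear.not_adjacent (Q := t₂ :: Q₂) h h₁ ⟨v, v3, v1⟩).elim
    refine ⟨{q', v}, branch_of_stub g2 k3 v1 ?_ ?_, ?_⟩
    · rintro rfl; simp at v2
    · rintro rfl; simp at v2
    · rintro w (rfl | rfl)
      · simp
      · refine Or.inr ⟨?_, v3, q', rfl, v1⟩
        have := v1.ne'
        simp only [List.mem_cons, List.cons_append, List.nil_append] at v2 ⊢
        tauto
  | q :: q' :: l, _ =>
    exact ⟨{w | w ∈ q :: q' :: l}, branch_of_long k1 hn.2.1 (by simp) g2 k3 ht1 ht2,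
      fun w hw => Or.inl hw⟩

theorem Ear.isTheta {F : SimpleGraph W} {C : List W} {R : Set W} (h : Ear F C R) {t₁ t₂ : W}
    (hC₁ : t₁ ∈ C) (hC₂ : t₂ ∈ C) (hne : t₁ ≠ t₂) (h₁ : ∃ ρ ∈ R, F.Adj t₁ ρ)
    (h₂ : ∃ ρ ∈ R, F.Adj t₂ ρ) : IsTheta F := by
  obtain ⟨P, Q, rfl⟩ := List.append_of_mem hC₁
  have h := h.rotate
  have hm : t₂ ∈ Q ++ P := by
    simp only [List.mem_append, List.mem_cons] at hC₂ ⊢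
    rcases hC₂ with h' | h' | h'
    · exact Or.inr h'
    · exact absurd h'.symm hne
    · exact Or.inl h'
  rw [List.cons_append] at h
  obtain ⟨Q₁, Q₂, e⟩ := List.append_of_mem hm
  rw [e] at h
  clear e hm hC₁ hC₂
  have h' : Ear F (t₂ :: (Q₂ ++ t₁ :: Q₁)) R := Ear.rotate (l := t₁ :: Q₁) (l' := t₂ :: Q₂) h
  obtain ⟨S₁, B₁, s₁⟩ := h.exists_branch h₁ h₂
  obtain ⟨S₂, B₂, s₂⟩ := h'.exists_branch h₂ h₁
  have hQ₂ : Q₂ ≠ [] := by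
    rintro rfl
    exact h'.not_adjacent h₂ h₁
  have hQ₁ : Q₁ ≠ [] := by
    rintro rfl
    exact h.not_adjacent h₁ h₂
  have hn := h.nodup
  have hdis := h.disj
  obtain ⟨ρ₁, m₁, a₁⟩ := h₁
  obtain ⟨ρ₂, m₂, a₂⟩ := h₂
  obtain ⟨I, i1, i2, i3⟩ := h.conn ρ₁ m₁ ρ₂ m₂
  have hI1 : t₁ ∉ I := fun hh => hdis _ (i2 _ hh) (by simp)
  have hI2 : t₂ ∉ I := fun hh => hdis _ (i2 _ hh) (by simp)
  obtain ⟨S₀, B₀, s₀⟩ : ∃ S, Branch F t₁ t₂ I S ∧ ∀ w ∈ S, w ∈ R := by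
    match I, i3 with
    | [], i3 => exact absurd rfl i3.ne_nil
    | [ρ], i3 =>
      have e1 := i3.head_eq
      subst e1
      have e2 : ρ = ρ₂ := by simpa using i3.2.2
      subst e2
      obtain ⟨ρ', r1, r2⟩ := h.nbr ρ m₁
      refine ⟨{ρ, ρ'}, branch_of_stub a₁ a₂.symm r2 ?_ ?_, ?_⟩
      · rintro rfl; exact hdis _ r1 (by simp)
      · rintro rfl; exact hdis _ r1 (by simp)
      · rintro w (rfl | rfl) <;> assumption
    | x :: y :: l, i3 =>
      exact ⟨_, branch_of_long i3 i1 (by simp) a₁ a₂.symm hI1 hI2, fun w hw => i2 w hw⟩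
  have hS₁R : ∀ w ∈ S₁, w ∉ R := by
    intro w hw hR
    rcases s₁ w hw with hh | hh
    · exact hdis _ hR (by simp [hh])
    · exact hh.2.1 hR
  have hS₂R : ∀ w ∈ S₂, w ∉ R := by
    intro w hw hR
    rcases s₂ w hw with hh | hh
    · exact hdis _ hR (by simp [hh])
    · exact hh.2.1 hR
  have hd : Disjoint S₁ S₂ := by
    rw [Set.disjoint_left]
    intro w w1 w2
    rcases s₁ w w1 with hh | ⟨n1, n2, q, rfl, hq⟩
    · rcases s₂ w w2 with hh' | hh'
      · rw [List.nodup_cons, List.nodup_append] at hn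
        exact hn.2.2.2 w hh w (List.mem_cons_of_mem _ hh') rfl
      · exact hh'.1 (by simp [hh])
    · rcases s₂ w w2 with hh' | ⟨n3, n4, q', rfl, hq'⟩
      · exact n1 (by simp [hh'])
      · -- a better cycle through `w`
        obtain ⟨a, b, g1, g2, g3⟩ := h.cyc.seg_tail (by simp)
        have e1 : q = a := by simpa using g1.2.1
        have e2 : q' = b := by simpa using g1.2.2
        have g4 := g1.1
        simp only [List.cons_append, List.nil_append, List.isChain_cons_cons, List.isChain_singleton,
          and_true] at g4
        subst e1
        subst e2
        obtain ⟨u, v, c1, c2, c3, -⟩ := h.improve (t₁ :: (I ++ [t₂, q, w, q'])) (by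
            have k1 := n1
            simp only [List.nodup_cons, List.nodup_append, List.mem_append, List.mem_cons,
              List.not_mem_nil, or_false, not_or, List.nodup_nil, and_true, List.cons_append,
              List.nil_append, not_false_iff] at hn k1 ⊢
            refine ⟨⟨hI1, hn.1.2.1, hn.1.1, Ne.symm k1.1, hn.1.2.2⟩, i1,
              ⟨⟨Ne.symm hn.2.1.1, Ne.symm k1.2.2.1, hn.2.2⟩,
              ⟨Ne.symm k1.2.1, hn.2.1.2⟩, k1.2.2.2⟩, ?_⟩
            rintro x hx y hy rfl
            have := hdis x (i2 x hx)
            have hxw : x ≠ w := by rintro rfl; exact n2 (i2 _ hx)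
            simp only [List.cons_append, List.nil_append, List.mem_cons, List.not_mem_nil, or_false, not_or] at this
            tauto) (by simp)
          ⟨t₁, q', Seg.cons a₁ (i3.append (Seg.cons g4.1.symm (Seg.cons hq (Seg.cons hq'.symm (Seg.singleton q')))) a₂.symm), g3⟩ ⟨ρ₁, m₁, by simp [i3.head_mem]⟩
        simp only [List.mem_append, List.mem_cons, List.not_mem_nil, or_false, not_or,
          List.cons_append, List.nil_append] at c2 c3
        tauto
  refine ⟨t₁, t₂, hne, ![I, Q₁, Q₂.reverse], ![S₀, S₁, S₂], ?_, ?_⟩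
  · intro i
    fin_cases i
    · exact B₀
    · exact B₁
    · exact B₂.symm
  · have d1 : Disjoint S₀ S₁ := Set.disjoint_left.2 fun w w1 w2 => hS₁R w w2 (s₀ w w1)
    have d2 : Disjoint S₀ S₂ := Set.disjoint_left.2 fun w w1 w2 => hS₂R w w2 (s₀ w w1)
    intro i j hij
    fin_cases i <;> fin_cases j
    · exact absurd rfl hij
    · exact d1
    · exact d2
    · exact d1.symm
    · exact absurd rfl hij
    · exact hd
    · exact d2.symm
    · exact hd.symm
    · exact absurd rfl hij

end ThetaExistence

section NonHamiltonian

variable {V W : Type*}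

/-- The elements of `U` whose edge meets `C`. -/
def domSet (φ : V → Sym2 W) (U : Set V) (C : List W) : Set V := {v | v ∈ U ∧ ∃ w ∈ C, w ∈ φ v}

theorem IsRep.exists_eq {H : SimpleGraph V} {φ : V → Sym2 W} (hφ : IsRep H φ) {v : V} {w : W}
    (h : w ∈ φ v) : ∃ w', φ v = s(w, w') ∧ w ≠ w' := by
  obtain ⟨w', e⟩ := Sym2.mem_iff_exists.1 h
  refine ⟨w', e, fun hh => hφ.ndiag v ?_⟩
  rw [e, hh]
  exact rfl

theorem exists_max_cycle [Finite V] {F : SimpleGraph W} (φ : V → Sym2 W) (U : Set V)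
    (h : ∃ C : List W, C.Nodup ∧ 3 ≤ C.length ∧ IsCyc F.Adj C) :
    ∃ C : List W, C.Nodup ∧ 3 ≤ C.length ∧ IsCyc F.Adj C ∧
      ∀ C' : List W, C'.Nodup → 3 ≤ C'.length → IsCyc F.Adj C' →
        (domSet φ U C').ncard ≤ (domSet φ U C).ncard := by
  obtain ⟨C, hC, hmin⟩ := (measure fun C : List W => U.ncard - (domSet φ U C).ncard).wf.has_min
    {C : List W | C.Nodup ∧ 3 ≤ C.length ∧ IsCyc F.Adj C} h
  refine ⟨C, hC.1, hC.2.1, hC.2.2, fun C' h1 h2 h3 => ?_⟩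
  have := hmin C' ⟨h1, h2, h3⟩
  have hle : ∀ C, (domSet φ U C).ncard ≤ U.ncard := fun C =>
    Set.ncard_le_ncard (fun v hv => hv.1) (Set.toFinite _)
  have h4 := hle C
  have h5 := hle C'
  have : ¬ (U.ncard - (domSet φ U C').ncard < U.ncard - (domSet φ U C).ncard) := this
  omega

theorem exists_ear [Finite V] {H : SimpleGraph V} {φ : V → Sym2 W} (hφ : IsRep H φ) {U : Set V}
    (hU : TC H U) (hn : ¬ HamOn H.Adj U) :
    ∃ (C : List W) (R : Set W), Ear (FU φ U) C R ∧ ∃ e ∈ U, ∀ w ∈ φ e, w ∈ R := by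
  obtain ⟨C, c1, c2, c3, hmax⟩ := exists_max_cycle φ U (exists_cycle hφ hU hn)
  obtain ⟨e, he, hdom⟩ : ∃ e ∈ U, ∀ w ∈ C, w ∉ φ e := by
    by_contra hcon
    push Not at hcon
    exact hn (hamOn_of_dominating hφ c1 c2 c3 hcon)
  obtain ⟨⟨r, r'⟩, hr⟩ : ∃ p : W × W, φ e = s(p.1, p.2) := by
    induction h : φ e using Sym2.ind with
    | h x y => exact ⟨(x, y), rfl⟩
  dsimp only at hr
  have hrr : r ≠ r' := fun h => hφ.ndiag e (by rw [hr, h]; exact rfl)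
  have hrC : r ∉ C := fun h => hdom r h (by rw [hr]; simp)
  have hrC' : r' ∉ C := fun h => hdom r' h (by rw [hr]; simp)
  let K : SimpleGraph W :=
    { Adj := fun a b => (FU φ U).Adj a b ∧ a ∉ C ∧ b ∉ C
      symm := ⟨fun a b h => ⟨h.1.symm, h.2.2, h.2.1⟩⟩
      loopless := ⟨fun a h => h.1.ne rfl⟩ }
  have hrr' : K.Adj r r' := ⟨⟨hrr, e, he, hr⟩, hrC, hrC'⟩
  have hRC : ∀ ρ, K.Reachable r ρ → ρ ∉ C := by
    intro ρ h
    rcases eq_or_ne r ρ with rfl | hne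
    · exact hrC
    · obtain ⟨l, hs, hnd, -⟩ := seg_of_reachable h.symm
      match l, hs with
      | [], hs => exact absurd rfl hs.ne_nil
      | [x], hs =>
        have e1 := hs.head_eq
        have e2 : x = r := by simpa using hs.2.2
        exact absurd (e2.symm.trans e1) hne
      | x :: y :: l, hs =>
        have e1 := hs.head_eq
        subst e1
        exact (List.isChain_cons_cons.1 hs.1).1.2.1
  have hnbr : ∀ ρ, K.Reachable r ρ → ∃ ρ', K.Reachable r ρ' ∧ K.Adj ρ ρ' := by
    intro ρ h
    rcases eq_or_ne r ρ with rfl | hne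
    · exact ⟨r', hrr'.reachable, hrr'⟩
    · obtain ⟨l, hs, hnd, hl⟩ := seg_of_reachable h.symm
      match l, hs with
      | [], hs => exact absurd rfl hs.ne_nil
      | [x], hs =>
        have e1 := hs.head_eq
        have e2 : x = r := by simpa using hs.2.2
        exact absurd (e2.symm.trans e1) hne
      | x :: y :: l, hs =>
        have e1 := hs.head_eq
        subst e1
        have := (List.isChain_cons_cons.1 hs.1).1
        exact ⟨y, h.trans this.reachable, this⟩
  refine ⟨C, {ρ | K.Reachable r ρ}, ⟨c1, c2, c3, hRC, ?_, ?_, ?_, ?_⟩, e, he, ?_⟩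
  · intro ρ h
    obtain ⟨ρ', h1, h2⟩ := hnbr ρ h
    exact ⟨ρ', h1, h2.1⟩
  · intro ρ h w hw
    by_cases hwC : w ∈ C
    · exact Or.inr hwC
    · exact Or.inl (SimpleGraph.Reachable.trans h (SimpleGraph.Adj.reachable (G := K) ⟨hw, hRC ρ h, hwC⟩))
  · intro ρ h ρ' h'
    obtain ⟨l, hs, hnd, hl⟩ := seg_of_reachable (K := K) (SimpleGraph.Reachable.trans (SimpleGraph.Reachable.symm h) h')
    exact ⟨l, hnd, fun w hw => SimpleGraph.Reachable.trans h (hl w hw), hs.mono fun _ _ h => h.1⟩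
  · intro C' d1 d2 d3 ⟨ρ, hρ, hρC'⟩
    by_contra hcon
    push Not at hcon
    have hsub : domSet φ U C ⊆ domSet φ U C' := by
      rintro v ⟨hv, w, hw, hwv⟩
      obtain ⟨w', e, hne⟩ := hφ.exists_eq hwv
      refine ⟨hv, ?_⟩
      by_cases hwC' : w ∈ C'
      · exact ⟨w, hwC', hwv⟩
      · exact ⟨w', hcon w w' ⟨hne, v, hv, e⟩ hw hwC', by rw [e]; simp⟩
    obtain ⟨ρ', h1, h2⟩ := hnbr ρ hρ
    obtain ⟨⟨-, v, hv, hve⟩, n1, n2⟩ := h2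
    have hlt := Set.ncard_lt_ncard (Set.ssubset_iff_of_subset hsub |>.2
      ⟨v, ⟨hv, ρ, hρC', by rw [hve]; simp⟩, by
        rintro ⟨-, w, hw, hwv⟩
        rw [hve, Sym2.mem_iff] at hwv
        rcases hwv with rfl | rfl
        · exact n1 hw
        · exact n2 hw⟩) (Set.toFinite _)
    have := hmax C' d1 d2 d3
    omega
  · intro w hw
    rw [hr, Sym2.mem_iff] at hw
    rcases hw with rfl | rfl
    · exact SimpleGraph.Reachable.refl _
    · exact hrr'.reachable

theorem FU_mono (φ : V → Sym2 W) {U U' : Set V} (h : U ⊆ U') : FU φ U ≤ FU φ U' :=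
  fun _ _ hab => ⟨hab.1, hab.2.imp fun _ hv => ⟨h hv.1, hv.2⟩⟩

theorem isTheta_of_not_hamOn [Finite V] {H : SimpleGraph V} {φ : V → Sym2 W} (hφ : IsRep H φ)
    (U : Set V) (hU : TC H U) (hn : ¬ HamOn H.Adj U) : IsTheta (FU φ Set.univ) := by
  induction hcard : U.ncard using Nat.strong_induction_on generalizing U with
  | _ N ih =>
  obtain ⟨C, R, hE, e, he, heR⟩ := exists_ear hφ hU hn
  by_cases hatt : ∃ t₁ ∈ C, ∃ t₂ ∈ C, t₁ ≠ t₂ ∧ (∃ ρ ∈ R, (FU φ U).Adj t₁ ρ) ∧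
      ∃ ρ ∈ R, (FU φ U).Adj t₂ ρ
  · obtain ⟨t₁, m₁, t₂, m₂, hne, h₁, h₂⟩ := hatt
    exact (hE.isTheta m₁ m₂ hne h₁ h₂).mono (FU_mono φ (Set.subset_univ U))
  by_contra hnT
  push Not at hatt
  set V₁ : Set V := {v | v ∈ U ∧ ∃ w ∈ R, w ∈ φ v} with hV₁
  set V₂ : Set V := U \ V₁ with hV₂
  have hV₁U : V₁ ⊆ U := fun v hv => hv.1
  have hunion : V₁ ∪ V₂ = U := Set.union_sdiff_cancel hV₁U
  have hd : Disjoint V₁ V₂ := Set.disjoint_sdiff_right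
  obtain ⟨⟨r, r'⟩, hr⟩ : ∃ p : W × W, φ e = s(p.1, p.2) := by
    induction h : φ e using Sym2.ind with
    | h x y => exact ⟨(x, y), rfl⟩
  have heV₁ : e ∈ V₁ := ⟨he, r, heR r (by rw [hr]; simp), by rw [hr]; simp⟩
  have hc1 : 2 ≤ V₁.ncard := by
    obtain ⟨a, rfl, b, hb, hab⟩ := hU.conn (A := {e}) (by simpa using he) ⟨e, rfl⟩ (by
      intro h
      have := hU.1
      rw [← h, Set.ncard_singleton] at this
      omega)
    obtain ⟨-, w, hwa, hwb⟩ := (hφ.adj _ _).1 hab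
    have hb1 : b ∈ V₁ := ⟨hb.1, w, heR w hwa, hwb⟩
    have : ({a, b} : Set V) ⊆ V₁ := by
      rintro x (rfl | rfl) <;> assumption
    have h2 := Set.ncard_le_ncard this (Set.toFinite _)
    rwa [Set.ncard_pair hab.ne] at h2
  have hCV : ∀ v ∈ U, ∀ x ∈ C, ∀ y ∈ C, φ v = s(x, y) → v ∈ V₂ := by
    intro v hv x hx y hy e
    refine ⟨hv, ?_⟩
    rintro ⟨-, w, hw, hwv⟩
    rw [e, Sym2.mem_iff] at hwv
    rcases hwv with rfl | rfl
    · exact hE.disj _ hw hx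
    · exact hE.disj _ hw hy
  have hc2 : 2 ≤ V₂.ncard := by
    obtain ⟨u, v, hs, -⟩ := hE.cyc
    have hl := hE.len
    have hnd := hE.nodup
    match C, hs, hl, hnd, hCV with
    | x :: y :: z :: l, hs, _, hnd, hCV =>
      have h1 := hs.1
      rw [List.isChain_cons_cons, List.isChain_cons_cons] at h1
      obtain ⟨⟨-, v1, m1, e1⟩, ⟨-, v2, m2, e2⟩, -⟩ := h1
      have k1 := hCV v1 m1 x (by simp) y (by simp) e1
      have k2 := hCV v2 m2 y (by simp) z (by simp) e2
      have hne : v1 ≠ v2 := by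
        rintro rfl
        rw [e1, Sym2.eq_swap, Sym2.congr_right] at e2
        rw [e2] at hnd
        simp at hnd
      have : ({v1, v2} : Set V) ⊆ V₂ := by
        rintro x (rfl | rfl) <;> assumption
      have h2 := Set.ncard_le_ncard this (Set.toFinite _)
      rwa [Set.ncard_pair hne] at h2
  have hcross : ∀ a ∈ V₁, ∀ b ∈ V₂, H.Adj a b →
      ∃ t ∈ C, (∃ ρ ∈ R, (FU φ U).Adj t ρ) ∧ t ∈ φ a ∧ t ∈ φ b := by
    rintro a ⟨haU, ρ, hρ, hρa⟩ b hb hab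
    obtain ⟨-, w, hwa, hwb⟩ := (hφ.adj _ _).1 hab
    have hwR : w ∉ R := fun hw => hb.2 ⟨hb.1, w, hw, hwb⟩
    have hne : w ≠ ρ := by rintro rfl; exact hwR hρ
    have hadj : (FU φ U).Adj w ρ := ⟨hne, a, haU, (Sym2.mem_and_mem_iff hne).1 ⟨hwa, hρa⟩⟩
    exact ⟨w, (hE.closed ρ hρ w hadj.symm).resolve_left hwR, ⟨ρ, hρ, hadj⟩, hwa, hwb⟩
  obtain ⟨k₁, hk₁, k₂, hk₂, hk⟩ := hU.conn hV₁U ⟨e, heV₁⟩ (by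
    intro h
    rw [hV₂, h, Set.sdiff_self, Set.ncard_empty] at hc2
    omega)
  obtain ⟨t, htC, hta, ht1, ht2⟩ := hcross k₁ hk₁ k₂ hk₂ hk
  have hcr : ∀ a ∈ V₁, ∀ b ∈ V₂, H.Adj a b → t ∈ φ a ∧ t ∈ φ b := by
    intro a ha b hb hab
    obtain ⟨t', h1, h2, h3, h4⟩ := hcross a ha b hb hab
    rcases eq_or_ne t t' with rfl | hne
    · exact ⟨h3, h4⟩
    · obtain ⟨ρ, hρ, hρ'⟩ := h2
      exact absurd hρ' (hatt t htC t' h1 hne hta ρ hρ)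
  have hne12 : ∀ a ∈ V₁, ∀ b ∈ V₂, a ≠ b := by
    rintro a ha _ hb rfl
    exact Set.disjoint_left.1 hd ha hb
  have hadj12 : ∀ a ∈ V₁, ∀ b ∈ V₂, t ∈ φ a → t ∈ φ b → H.Adj a b := fun a ha b hb h1 h2 =>
    (hφ.adj _ _).2 ⟨hne12 a ha b hb, t, h1, h2⟩
  have hcl : ∀ X : Set V, H.IsClique {v | v ∈ X ∧ t ∈ φ v} := by
    intro X a ha b hb hab
    exact (hφ.adj _ _).2 ⟨hab, t, ha.2, hb.2⟩
  have hsum : V₁.ncard + V₂.ncard = N := by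
    rw [← Set.ncard_union_eq hd (Set.toFinite _) (Set.toFinite _), hunion, hcard]
  rw [← hunion] at hU hn
  have T1 : TC H (insert k₂ V₁) := hU.glue (K₁ := {v | v ∈ V₁ ∧ t ∈ φ v}) hd
    (fun a ha b hb hab => ⟨ha, (hcr a ha b hb hab).1⟩) (hcl V₁) hk₂
    (fun a ha => (hadj12 a ha.1 k₂ hk₂ ha.2 ht2).symm) hc1 hc2
  rw [Set.union_comm] at hU
  have T2 : TC H (insert k₁ V₂) := hU.glue (K₁ := {v | v ∈ V₂ ∧ t ∈ φ v}) hd.symm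
    (fun a ha b hb hab => ⟨ha, (hcr b hb a ha hab.symm).2⟩) (hcl V₂) hk₁
    (fun a ha => hadj12 k₁ hk₁ a ha.1 ht1 ha.2) hc2 hc1
  have n1 : (insert k₂ V₁).ncard = V₁.ncard + 1 :=
    Set.ncard_insert_of_notMem (fun h => hne12 k₂ h k₂ hk₂ rfl) (Set.toFinite _)
  have n2 : (insert k₁ V₂).ncard = V₂.ncard + 1 :=
    Set.ncard_insert_of_notMem (fun h => hne12 k₁ hk₁ k₁ h rfl) (Set.toFinite _)
  have H1 : HamOn H.Adj (insert k₂ V₁) := by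
    by_contra h
    exact hnT (ih _ (by omega) _ T1 h rfl)
  have H2 : HamOn H.Adj (insert k₁ V₂) := by
    by_contra h
    exact hnT (ih _ (by omega) _ T2 h rfl)
  refine hn (hamOn_glue hd hk₁ hk₂ (fun a ha b hb h1 h2 => ?_) H1 H2)
  exact hadj12 a ha b hb (hcr a ha k₂ hk₂ h1.symm).1 (hcr k₁ hk₁ b hb h2).2

end NonHamiltonian

section HeavyPairs

variable {V W : Type*}

/-- A graph `G` with a closure `H`, represented by `φ`, and an edge `XY` close to all heavy
pairs. -/
structure HeavyCtx (G H : SimpleGraph V) (φ : V → Sym2 W) (X Y : W) : Prop where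
  le : G ≤ H
  rep : IsRep H φ
  conn : ∀ a b, H.Adj a b → (GS G H a b).Reachable a b
  adj_of_hv : ∀ u v, Hv G u v → u ≠ v → H.Adj u v
  near : ∀ u v, Hv G u v → X ∈ φ u ∨ Y ∈ φ u
  edge : (FU φ Set.univ).Adj X Y

/-- The graph `G` restricted to `a`, `b` and the simplicial vertices of `H` in the clique `c`. -/
def starGraph (G H : SimpleGraph V) (φ : V → Sym2 W) (c : W) (a b : V) : SimpleGraph V where
  Adj u v := G.Adj u v ∧ ((Simp H u ∧ c ∈ φ u) ∨ u = a ∨ u = b) ∧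
    ((Simp H v ∧ c ∈ φ v) ∨ v = a ∨ v = b)
  symm := ⟨fun _ _ h => ⟨h.1.symm, h.2.2, h.2.1⟩⟩
  loopless := ⟨fun _ h => h.1.ne rfl⟩

theorem SimpleGraph.Reachable.mem_of_closed {K : SimpleGraph V} {a b : V} (h : K.Reachable a b)
    {S : Set V} (hS : ∀ u ∈ S, ∀ v, K.Adj u v → v ∈ S) (ha : a ∈ S) : b ∈ S := by
  obtain ⟨p⟩ := h
  induction p with
  | nil => exact ha
  | cons hadj _ ih => exact ih (hS _ ha _ hadj)

namespace IsRep

variable {H : SimpleGraph V} {φ : V → Sym2 W} (hφ : IsRep H φ)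
include hφ

theorem adj_of_mem {c : W} {u v : V} (hu : c ∈ φ u) (hv : c ∈ φ v) (hne : u ≠ v) : H.Adj u v :=
  (hφ.adj _ _).2 ⟨hne, c, hu, hv⟩

theorem eq_of_mem {c d : W} {u v : V} (hcd : c ≠ d) (hu : c ∈ φ u) (hu' : d ∈ φ u) (hv : c ∈ φ v)
    (hv' : d ∈ φ v) : u = v :=
  hφ.inj (((Sym2.mem_and_mem_iff hcd).1 ⟨hu, hu'⟩).trans ((Sym2.mem_and_mem_iff hcd).1 ⟨hv, hv'⟩).symm)

theorem not_triangle {A B C : W} (h₁ : (FU φ Set.univ).Adj A B) (h₂ : (FU φ Set.univ).Adj B C)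
    (h₃ : (FU φ Set.univ).Adj A C) : False := by
  obtain ⟨-, a, -, ha⟩ := h₁
  obtain ⟨-, b, -, hb⟩ := h₂
  obtain ⟨-, c, -, hc⟩ := h₃
  exact hφ.tri a b c A B C ha hb hc

theorem adj_of_eq {v : V} {A B : W} (h : φ v = s(A, B)) : (FU φ Set.univ).Adj A B :=
  ⟨fun e => hφ.ndiag v (by rw [h, e]; exact rfl), v, trivial, h⟩

/-- A common neighbour of two members of a clique lies in the clique. -/
theorem mem_of_common {c : W} {u v w : V} (hu : c ∈ φ u) (hv : c ∈ φ v) (huv : u ≠ v)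
    (h₁ : H.Adj u w) (h₂ : H.Adj v w) : c ∈ φ w := by
  obtain ⟨A, eu, -⟩ := hφ.exists_eq hu
  obtain ⟨B, ev, -⟩ := hφ.exists_eq hv
  have hAB : A ≠ B := by
    rintro rfl
    exact huv (hφ.inj (eu.trans ev.symm))
  obtain ⟨-, p, hp, hp'⟩ := (hφ.adj _ _).1 h₁
  obtain ⟨-, q, hq, hq'⟩ := (hφ.adj _ _).1 h₂
  rw [eu, Sym2.mem_iff] at hp
  rw [ev, Sym2.mem_iff] at hq
  rcases hp with rfl | rfl
  · exact hp'
  rcases hq with rfl | rfl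
  · exact hq'
  exact (hφ.not_triangle (hφ.adj_of_eq eu) (hφ.adj_of_eq ((Sym2.mem_and_mem_iff hAB).1 ⟨hp', hq'⟩))
    (hφ.adj_of_eq ev)).elim

/-- Neighbours of a simplicial vertex lie in its clique. -/
theorem mem_of_simp {c : W} {v a w : V} (hv : Simp H v) (hcv : c ∈ φ v) (hca : c ∈ φ a)
    (hav : a ≠ v) (hvw : H.Adj v w) : c ∈ φ w := by
  rcases eq_or_ne a w with rfl | haw
  · exact hca
  · exact hφ.mem_of_common hcv hca hav.symm hvw
      (hv (show a ∈ H.neighborSet v from hφ.adj_of_mem hcv hca hav.symm) hvw haw)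

theorem exists_other {c D : W} {w : V} (hw : φ w = s(c, D)) (hs : ¬ Simp H w) :
    ∃ t, t ≠ w ∧ D ∈ φ t := by
  by_contra hcon
  push Not at hcon
  refine hs fun p hp q hq hpq => ?_
  have : ∀ p, H.Adj w p → c ∈ φ p := by
    intro p hp
    obtain ⟨h1, z, hz, hz'⟩ := (hφ.adj _ _).1 hp
    rw [hw, Sym2.mem_iff] at hz
    rcases hz with rfl | rfl
    · exact hz'
    · exact absurd hz' (hcon p h1.symm)
  exact hφ.adj_of_mem (this p hp) (this q hq) hpq

theorem starGraph_reachable {G : SimpleGraph V} (hle : G ≤ H) {c : W} {a b : V} (ha : c ∈ φ a)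
    (hb : c ∈ φ b) (hab : a ≠ b) (h : (GS G H a b).Reachable a b) :
    (starGraph G H φ c a b).Reachable a b := by
  by_contra hn
  obtain ⟨A, ea, -⟩ := hφ.exists_eq ha
  have hAa : A ∈ φ a := by rw [ea]; simp
  have := h.mem_of_closed (S := {v | (starGraph G H φ c a b).Reachable a v ∨
    (Simp H v ∧ A ∈ φ v ∧ c ∉ φ v)}) (by
      rintro u hu v ⟨huv, h1, h2⟩
      rcases hu with hu | ⟨hu1, hu2, hu3⟩
      · have hu' : (Simp H u ∧ c ∈ φ u) ∨ u = a := by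
          rcases h1 with h1 | h1 | rfl
          · by_cases hua : u = a
            · exact Or.inr hua
            · refine Or.inl ⟨h1, ?_⟩
              have : u ∈ {v | v = a ∨ (Simp H v ∧ c ∈ φ v) ∨ v = b} := hu.mem_of_closed (by
                intro x _ y hxy
                rcases hxy.2.2 with h | h | h
                · exact Or.inr (Or.inl h)
                · exact Or.inl h
                · exact Or.inr (Or.inr h)) (Or.inl rfl)
              rcases this with h | h | rfl
              · exact absurd h hua
              · exact h.2
              · exact hb
          · exact Or.inr h1
          · exact absurd hu hn
        by_cases hcv : c ∈ φ v
        · refine Or.inl (hu.trans (SimpleGraph.Adj.reachable ⟨huv, ?_, ?_⟩))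
          · exact hu'.imp_right Or.inl
          · exact h2.imp_left fun h => ⟨h, hcv⟩
        · right
          have hv : Simp H v := by
            rcases h2 with h2 | rfl | rfl
            · exact h2
            · exact absurd ha hcv
            · exact absurd hb hcv
          refine ⟨hv, ?_, hcv⟩
          have hua : u = a := by
            by_contra hua
            exact hcv (hφ.mem_of_simp (hu'.resolve_right hua).1 (hu'.resolve_right hua).2 ha
              (Ne.symm hua) (hle huv))
          subst hua
          obtain ⟨-, z, hz, hz'⟩ := (hφ.adj _ _).1 (hle huv)
          rw [ea, Sym2.mem_iff] at hz
          rcases hz with rfl | rfl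
          · exact absurd hz' hcv
          · exact hz'
      · have hau : a ≠ u := by
          rintro rfl
          exact hu3 ha
        have hAv := hφ.mem_of_simp hu1 hu2 hAa hau (hle huv)
        by_cases hva : v = a
        · exact Or.inl (hva ▸ SimpleGraph.Reachable.refl _)
        have hcv : c ∉ φ v := by
          intro hcv
          refine hva (hφ.inj (((Sym2.mem_and_mem_iff ?_).1 ⟨hcv, hAv⟩).trans ea.symm))
          rintro rfl
          exact hφ.ndiag a (by rw [ea]; exact rfl)
        refine Or.inr ⟨?_, hAv, hcv⟩
        rcases h2 with h2 | rfl | rfl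
        · exact h2
        · exact absurd rfl hva
        · exact absurd hb hcv) (Or.inl (SimpleGraph.Reachable.refl _))
  rcases this with h' | h'
  · exact hn h'
  · exact h'.2.2 hb

end IsRep

theorem hv_common [Finite V] {G : SimpleGraph V} {u v : V} (h : Hv G u v) (huv : u ≠ v)
    (hn : ¬ G.Adj u v) :
    {t | t ≠ u ∧ t ≠ v ∧ ¬ G.Adj u t ∧ ¬ G.Adj v t}.ncard + 2 ≤
      {w | G.Adj u w ∧ G.Adj v w}.ncard := by
  set Z := {t | t ≠ u ∧ t ≠ v ∧ ¬ G.Adj u t ∧ ¬ G.Adj v t}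
  have h1 := Set.ncard_union_add_ncard_inter (G.neighborSet u) (G.neighborSet v)
    (Set.toFinite _) (Set.toFinite _)
  have h2 : G.neighborSet u ∩ G.neighborSet v = {w | G.Adj u w ∧ G.Adj v w} := rfl
  have h3 : (Set.univ : Set V) = (G.neighborSet u ∪ G.neighborSet v) ∪ (Z ∪ {u, v}) := by
    ext t
    simp only [Set.mem_univ, Set.mem_union, SimpleGraph.mem_neighborSet, Z, Set.mem_ofPred_eq,
      Set.mem_insert_iff, Set.mem_singleton_iff, true_iff]
    tauto
  have hd1 : Disjoint (G.neighborSet u ∪ G.neighborSet v) (Z ∪ {u, v}) := by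
    rw [Set.disjoint_left]
    rintro t (ht | ht) (ht' | rfl | rfl)
    · exact ht'.2.2.1 ht
    · exact G.loopless.irrefl _ ht
    · exact hn ht
    · exact ht'.2.2.2 ht
    · exact hn (G.symm.symm _ _ ht)
    · exact G.loopless.irrefl _ ht
  have hd2 : Disjoint Z {u, v} := by
    rw [Set.disjoint_left]
    rintro t ht (rfl | rfl)
    · exact ht.1 rfl
    · exact ht.2.1 rfl
  have h4 : Nat.card V = (G.neighborSet u ∪ G.neighborSet v).ncard + (Z.ncard + 2) := by
    rw [← Set.ncard_univ, h3, Set.ncard_union_eq hd1 (Set.toFinite _) (Set.toFinite _),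
      Set.ncard_union_eq hd2 (Set.toFinite _) (Set.toFinite _), Set.ncard_pair huv]
  unfold Hv nd at h
  rw [h2] at h1
  omega

/-- Heavy pairs are adjacent or have a common simplicial neighbour in their clique. -/
theorem HeavyCtx.exists_common [Finite V] {G H : SimpleGraph V} {φ : V → Sym2 W} {X Y : W}
    (hc : HeavyCtx G H φ X Y) {u v : V} (h : Hv G u v) (huv : u ≠ v) (hn : ¬ G.Adj u v) {c : W}
    (hu : c ∈ φ u) (hv : c ∈ φ v) : ∃ w, Simp H w ∧ c ∈ φ w ∧ G.Adj u w ∧ G.Adj w v := by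
  have hφ := hc.rep
  by_contra hcon
  push Not at hcon
  have hJ : ∀ w ∈ {w | G.Adj u w ∧ G.Adj v w}, ∃ t ∈ {t | t ≠ u ∧ t ≠ v ∧ ¬ G.Adj u t ∧ ¬ G.Adj v t},
      ∃ D, φ w = s(c, D) ∧ D ∈ φ t := by
    rintro w ⟨hw1, hw2⟩
    have hcw := hφ.mem_of_common hu hv huv (hc.le hw1) (hc.le hw2)
    have hns : ¬ Simp H w := fun hs => hcon w hs hcw hw1 hw2.symm
    obtain ⟨D, ew, hcD⟩ := hφ.exists_eq hcw
    obtain ⟨t, ht, htD⟩ := hφ.exists_other ew hns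
    have hDw : D ∈ φ w := by rw [ew]; simp
    have hr := hφ.starGraph_reachable hc.le hDw htD ht.symm
      (hc.conn w t (hφ.adj_of_mem hDw htD ht.symm))
    obtain ⟨l, hs, hnd, -⟩ := seg_of_reachable hr
    obtain ⟨t', ht', hDt'⟩ : ∃ t', G.Adj w t' ∧ D ∈ φ t' := by
      match l, hs with
      | [], hs => exact absurd rfl hs.ne_nil
      | [x], hs =>
        have e1 := hs.head_eq
        have e2 : x = t := by simpa using hs.2.2
        exact absurd (e2.symm.trans e1) ht
      | x :: y :: l, hs =>
        have e1 := hs.head_eq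
        subst e1
        have := (List.isChain_cons_cons.1 hs.1).1
        refine ⟨y, this.1, ?_⟩
        rcases this.2.2 with h' | rfl | rfl
        · exact h'.2
        · exact absurd rfl this.1.ne
        · exact htD
    have hct' : c ∉ φ t' := fun h' => ht'.ne (hφ.eq_of_mem hcD hcw hDw h' hDt')
    have hnadj : ∀ u, c ∈ φ u → G.Adj u w → ¬ G.Adj u t' := fun u hu huw hut =>
      hct' (hφ.mem_of_common hu hcw huw.ne (hc.le hut) (hc.le ht'))
    exact ⟨t', ⟨fun e => hct' (e ▸ hu), fun e => hct' (e ▸ hv), hnadj u hu hw1, hnadj v hv hw2⟩,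
      D, ew, hDt'⟩
  have hcard := hv_common h huv hn
  have : Nonempty W := ⟨c⟩
  choose! f hf D hD1 hD2 using hJ
  have hinj : Set.InjOn f {w | G.Adj u w ∧ G.Adj v w} := by
    intro w hw w' hw' e
    have e1 := hD1 w hw
    have e2 := hD1 w' hw'
    have m1 := hD2 w hw
    have m2 := hD2 w' hw'
    rw [← e] at m2
    by_cases hDD : D w = D w'
    · exact hφ.inj (e1.trans (by rw [e2, hDD]))
    · exact (hφ.not_triangle (hφ.adj_of_eq e1)
        (hφ.adj_of_eq ((Sym2.mem_and_mem_iff hDD).1 ⟨m1, m2⟩)) (hφ.adj_of_eq e2)).elim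
  have := Set.ncard_le_ncard_of_injOn f hf hinj (Set.toFinite _)
  omega

theorem HeavyCtx.near_right [Finite V] {G H : SimpleGraph V} {φ : V → Sym2 W} {X Y : W}
    (hc : HeavyCtx G H φ X Y) {u v : V} (h : Hv G u v) : X ∈ φ v ∨ Y ∈ φ v :=
  hc.near v u h.symm

/-- A simplicial vertex of a clique `c` (with another member) that is near `XY` forces `c` to be
one of `X`, `Y`. -/
theorem HeavyCtx.eq_of_simp {G H : SimpleGraph V} {φ : V → Sym2 W} {X Y : W}
    (hc : HeavyCtx G H φ X Y) {v a : V} {c : W} (hs : Simp H v) (hcv : c ∈ φ v) (hca : c ∈ φ a)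
    (hav : a ≠ v) (hN : X ∈ φ v ∨ Y ∈ φ v) : c = X ∨ c = Y := by
  obtain ⟨-, p, -, hp⟩ := hc.edge
  rw [← Sym2.mem_iff, ← hp]
  by_cases hpv : v = p
  · rwa [← hpv]
  · refine hc.rep.mem_of_simp hs hcv hca hav ((hc.rep.adj _ _).2 ⟨hpv, ?_⟩)
    rcases hN with h | h
    · exact ⟨X, h, by rw [hp]; simp⟩
    · exact ⟨Y, h, by rw [hp]; simp⟩

end HeavyPairs

section TaggedPath

variable {V W : Type*}

theorem exists_geodesic {K : SimpleGraph V} {u v : V} (h : K.Reachable u v) :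
    ∃ (m : ℕ) (s : ℕ → V), s 0 = u ∧ s m = v ∧ (∀ i < m, K.Adj (s i) (s (i + 1))) ∧
      ∀ i j, j ≤ m → ∀ q : K.Walk (s i) (s j), j ≤ i + q.length := by
  obtain ⟨p, hp⟩ := h.exists_walk_length_eq_dist
  refine ⟨p.length, p.getVert, p.getVert_zero, p.getVert_length,
    fun i hi => p.adj_getVert_succ hi, fun i j hj q => ?_⟩
  have h1 := SimpleGraph.dist_le (((p.take i).append q).append (p.drop j))
  rw [SimpleGraph.Walk.length_append, SimpleGraph.Walk.length_append,
    SimpleGraph.Walk.take_length, SimpleGraph.Walk.drop_length, ← hp] at h1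
  omega

/-- Tags of neighbouring vertices: at most two apart, and at most one apart if one is odd. -/
def Close (k l : ℕ) : Prop :=
  k ≤ l + 2 ∧ l ≤ k + 2 ∧ (k % 2 = 1 ∨ l % 2 = 1 → k ≤ l + 1 ∧ l ≤ k + 1)

theorem Close.symm {k l : ℕ} (h : Close k l) : Close l k :=
  ⟨h.2.1, h.1, fun hh => (h.2.2 hh.symm).symm⟩

theorem exists_crossing {κ : ℕ → ℕ} {m r : ℕ} (hκ : ∀ i < m, Close (κ i) (κ (i + 1))) {i j : ℕ}
    (hij : i < j) (hj : j ≤ m)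
    (h : (κ i < 2 * r ∧ 2 * r < κ j) ∨ (2 * r < κ i ∧ κ j < 2 * r)) :
    ∃ l, i < l ∧ l < j ∧ κ l = 2 * r := by
  induction j, hij using Nat.le_induction with
  | base =>
    obtain ⟨h1, h2, h3⟩ := hκ i (by omega)
    exfalso
    simp only [Nat.succ_eq_add_one] at h
    omega
  | succ j hij ih =>
    obtain ⟨h1, h2, h3⟩ := hκ j (by omega)
    by_cases hj2 : κ j = 2 * r
    · exact ⟨j, by omega, by omega, hj2⟩
    · obtain ⟨l, a1, a2, a3⟩ := ih (by omega) (by omega)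
      exact ⟨l, a1, by omega, a3⟩

/-- A geodesic of `K` through the cut vertices `h 0, …, h N`, at the indices `ι 0, …, ι N`. -/
structure Tagged (K : SimpleGraph V) (T : V → ℕ → Prop) (h : ℕ → V) (N m : ℕ) (s : ℕ → V)
    (κ ι : ℕ → ℕ) : Prop where
  adj : ∀ i < m, K.Adj (s i) (s (i + 1))
  geo : ∀ i j, j ≤ m → ∀ q : K.Walk (s i) (s j), j ≤ i + q.length
  tag : ∀ i ≤ m, T (s i) (κ i)
  zero : ι 0 = 0
  last : ι N = m
  le : ∀ r ≤ N, ι r ≤ m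
  at_cut : ∀ r ≤ N, s (ι r) = h r
  tag_cut : ∀ r ≤ N, κ (ι r) = 2 * r
  tag_lt : ∀ r ≤ N, ∀ i < ι r, κ i < 2 * r
  tag_gt : ∀ r ≤ N, ∀ i, ι r < i → i ≤ m → 2 * r < κ i

theorem exists_tagged {K : SimpleGraph V} {T : V → ℕ → Prop} {h : ℕ → V} {N : ℕ} (hN : 0 < N)
    (h0N : h 0 ≠ h N) (hT : ∀ v w, K.Adj v w → ∃ k, T v k)
    (hclose : ∀ v w k l, K.Adj v w → T v k → T w l → Close k l)
    (heven : ∀ v r, T v (2 * r) → v = h r) (h0 : ∀ k, T (h 0) k → k = 0)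
    (hl : ∀ k, T (h N) k → k = 2 * N) (hr : K.Reachable (h 0) (h N)) :
    ∃ m s κ ι, Tagged K T h N m s κ ι := by
  obtain ⟨m, s, s0, sm, hadj, hgeo⟩ := exists_geodesic hr
  have hinj : ∀ i j, i < j → j ≤ m → s i ≠ s j := by
    intro i j hij hj e
    have := hgeo i j hj (SimpleGraph.Walk.nil.copy rfl e)
    rw [SimpleGraph.Walk.length_copy, SimpleGraph.Walk.length_nil] at this
    omega
  have hm : 0 < m := by
    rcases Nat.eq_zero_or_pos m with rfl | hm
    · exact absurd (s0.symm.trans sm) h0N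
    · exact hm
  have htag : ∀ i ≤ m, ∃ k, T (s i) k := by
    intro i hi
    rcases Nat.lt_or_ge i m with h | h
    · exact hT _ _ (hadj i h)
    · obtain ⟨j, rfl⟩ : ∃ j, m = j + 1 := ⟨m - 1, by omega⟩
      have : i = j + 1 := by omega
      exact this ▸ hT _ _ (hadj j (by omega)).symm
  choose! κ hκ using htag
  have hcl : ∀ i < m, Close (κ i) (κ (i + 1)) := fun i hi =>
    hclose _ _ _ _ (hadj i hi) (hκ i (by omega)) (hκ (i + 1) (by omega))
  have hk0 : κ 0 = 0 := h0 _ (s0 ▸ hκ 0 (by omega))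
  have hkm : κ m = 2 * N := hl _ (sm ▸ hκ m le_rfl)
  have huniq : ∀ i ≤ m, ∀ j ≤ m, ∀ r, κ i = 2 * r → κ j = 2 * r → i = j := by
    intro i hi j hj r h1 h2
    have e : s i = s j := (heven _ _ (h1 ▸ hκ i hi)).trans (heven _ _ (h2 ▸ hκ j hj)).symm
    rcases Nat.lt_trichotomy i j with h | h | h
    · exact absurd e (hinj i j h hj)
    · exact h
    · exact absurd e.symm (hinj j i h hi)
  have hex : ∀ r ≤ N, ∃ i ≤ m, κ i = 2 * r := by
    intro r hrN
    rcases Nat.eq_zero_or_pos r with rfl | hr0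
    · exact ⟨0, by omega, by omega⟩
    rcases Nat.eq_or_lt_of_le hrN with rfl | hrN'
    · exact ⟨m, le_rfl, hkm⟩
    obtain ⟨l, a1, a2, a3⟩ := exists_crossing (r := r) hcl hm le_rfl (by omega)
    exact ⟨l, by omega, a3⟩
  choose! ι hι1 hι2 using hex
  refine ⟨m, s, κ, ι, hadj, hgeo, hκ, ?_, ?_, hι1, ?_, hι2, ?_, ?_⟩
  · exact huniq _ (hι1 0 (by omega)) _ (by omega) 0 (hι2 0 (by omega)) (by omega)
  · exact huniq _ (hι1 N le_rfl) _ le_rfl N (hι2 N le_rfl) hkm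
  · intro r hrN
    exact heven _ _ (hι2 r hrN ▸ hκ _ (hι1 r hrN))
  · intro r hrN i hi
    have h1 := hι1 r hrN
    have h2 := hι2 r hrN
    by_contra hlt
    rcases Nat.eq_or_lt_of_le (not_lt.1 hlt) with h3 | h3
    · have := huniq i (by omega) _ h1 r h3.symm h2
      omega
    · have hi0 : 0 < i := by
        rcases Nat.eq_zero_or_pos i with rfl | hi0
        · omega
        · exact hi0
      have hr0 : 0 < r := by
        rcases Nat.eq_zero_or_pos r with rfl | hr0
        · have := huniq _ h1 0 (by omega) 0 h2 (by omega)
          omega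
        · exact hr0
      obtain ⟨l, a1, a2, a3⟩ := exists_crossing (r := r) hcl hi0 (by omega) (by omega)
      have := huniq l (by omega) _ h1 r a3 h2
      omega
  · intro r hrN i hi him
    have h1 := hι1 r hrN
    have h2 := hι2 r hrN
    by_contra hlt
    rcases Nat.eq_or_lt_of_le (not_lt.1 hlt) with h3 | h3
    · have := huniq i (by omega) _ h1 r h3 h2
      omega
    · have hrN' : r < N := by
        rcases Nat.eq_or_lt_of_le hrN with rfl | hrN'
        · have := huniq _ h1 m le_rfl r h2 hkm
          omega
        · exact hrN'
      have him' : i < m := by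
        rcases Nat.eq_or_lt_of_le him with rfl | him'
        · omega
        · exact him'
      obtain ⟨l, a1, a2, a3⟩ := exists_crossing (r := r) hcl him' le_rfl (by omega)
      have := huniq l (by omega) _ h1 r a3 h2
      omega

namespace Tagged

variable {K : SimpleGraph V} {T : V → ℕ → Prop} {h : ℕ → V} {N m : ℕ} {s : ℕ → V} {κ ι : ℕ → ℕ}
  (ht : Tagged K T h N m s κ ι)
include ht

theorem inj {i j : ℕ} (hi : i ≤ m) (hj : j ≤ m) (e : s i = s j) : i = j := by
  have h1 := ht.geo i j hj (SimpleGraph.Walk.nil.copy rfl e)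
  have h2 := ht.geo j i hi (SimpleGraph.Walk.nil.copy rfl e.symm)
  rw [SimpleGraph.Walk.length_copy, SimpleGraph.Walk.length_nil] at h1 h2
  omega

theorem adj_iff {i j : ℕ} (hi : i ≤ m) (hj : j ≤ m) :
    K.Adj (s i) (s j) ↔ i + 1 = j ∨ j + 1 = i := by
  constructor
  · intro h
    have h1 := ht.geo i j hj h.toWalk
    have h2 := ht.geo j i hi h.symm.toWalk
    have h3 : i ≠ j := by
      rintro rfl
      exact h.ne rfl
    rw [SimpleGraph.Walk.length_cons, SimpleGraph.Walk.length_nil] at h1 h2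
    omega
  · rintro (rfl | rfl)
    · exact ht.adj i (by omega)
    · exact (ht.adj j (by omega)).symm

theorem le_of_common {i j : ℕ} (hj : j ≤ m) {w : V} (h₁ : K.Adj (s i) w) (h₂ : K.Adj w (s j)) :
    j ≤ i + 2 :=
  ht.geo i j hj (.cons h₁ (.cons h₂ .nil))

theorem lt_succ {r : ℕ} (hr : r < N) : ι r < ι (r + 1) := by
  by_contra hcon
  have h1 := ht.tag_cut r (by omega)
  have h2 := ht.tag_cut (r + 1) (by omega)
  rcases Nat.eq_or_lt_of_le (not_lt.1 hcon) with h3 | h3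
  · rw [h3] at h2
    omega
  · have := ht.tag_gt (r + 1) (by omega) _ h3 (ht.le r (by omega))
    omega

theorem le_cut {r : ℕ} (hr : r ≤ N) : r ≤ ι r := by
  induction r with
  | zero => omega
  | succ k ih =>
    have := ht.lt_succ (r := k) (by omega)
    have := ih (by omega)
    omega

theorem cut_add_le {r : ℕ} (hr : r ≤ N) : ι r + (N - r) ≤ m := by
  obtain ⟨d, rfl⟩ : ∃ d, N = r + d := ⟨N - r, by omega⟩
  have : ∀ e ≤ d, ι r + e ≤ ι (r + e) := by
    intro e
    induction e with
    | zero => intro _; exact le_rfl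
    | succ k ih =>
      intro hk
      have h1 := ih (by omega)
      have h2 := ht.lt_succ (r := r + k) (by omega)
      have e : r + (k + 1) = r + k + 1 := by omega
      rw [e]
      omega
  have h1 := this d le_rfl
  rw [ht.last] at h1
  omega

/-- Vertices strictly between consecutive cut vertices carry the odd tag between them. -/
theorem tag_between {r i : ℕ} (hr : r < N) (h₁ : ι r < i) (h₂ : i < ι (r + 1)) :
    κ i = 2 * r + 1 := by
  have h3 := ht.le (r + 1) (by omega)
  have h4 := ht.tag_gt r (by omega) i h₁ (by omega)
  have h5 := ht.tag_lt (r + 1) (by omega) i h₂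
  omega

theorem cut_le_of_tag {r i : ℕ} (hr : r ≤ N) (h : 2 * r ≤ κ i) : ι r ≤ i := by
  by_contra hcon
  have := ht.tag_lt r hr i (by omega)
  omega

theorem le_cut_of_tag {r i : ℕ} (hr : r ≤ N) (hi : i ≤ m) (h : κ i ≤ 2 * r) : i ≤ ι r := by
  by_contra hcon
  have := ht.tag_gt r hr i (by omega) hi
  omega

theorem eq_of_tag {r i : ℕ} (hr : r ≤ N) (hi : i ≤ m) (h : κ i = 2 * r) : i = ι r :=
  le_antisymm (ht.le_cut_of_tag hr hi h.le) (ht.cut_le_of_tag hr h.ge)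

end Tagged

end TaggedPath

section LiftedPath

variable {V W : Type*}

/-- The vertices `h 0, …, h N` represent the consecutive edges of the path `y 0, …, y (N + 1)`. -/
structure EdgePath (φ : V → Sym2 W) (y : ℕ → W) (h : ℕ → V) (N : ℕ) : Prop where
  inj : ∀ i j, i ≤ N + 1 → j ≤ N + 1 → y i = y j → i = j
  edge : ∀ r ≤ N, φ (h r) = s(y r, y (r + 1))

/-- Tag of a vertex near the path: even for the `h r`, odd for the other simplicial vertices. -/
def LiftTag (H : SimpleGraph V) (φ : V → Sym2 W) (y : ℕ → W) (h : ℕ → V) (N : ℕ) (v : V)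
    (k : ℕ) : Prop :=
  (∃ r ≤ N, v = h r ∧ k = 2 * r) ∨
    ∃ r < N, Simp H v ∧ y (r + 1) ∈ φ v ∧ (∀ q ≤ N, v ≠ h q) ∧ k = 2 * r + 1

def liftGraph (G H : SimpleGraph V) (φ : V → Sym2 W) (y : ℕ → W) (h : ℕ → V) (N : ℕ) :
    SimpleGraph V where
  Adj u v := G.Adj u v ∧ (∃ k, LiftTag H φ y h N u k) ∧ ∃ k, LiftTag H φ y h N v k
  symm := ⟨fun _ _ h => ⟨h.1.symm, h.2.2, h.2.1⟩⟩
  loopless := ⟨fun _ h => h.1.ne rfl⟩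

namespace EdgePath

variable {φ : V → Sym2 W} {y : ℕ → W} {h : ℕ → V} {N : ℕ} (hp : EdgePath φ y h N)
include hp

theorem mem_left {r : ℕ} (hr : r ≤ N) : y r ∈ φ (h r) := by
  rw [hp.edge r hr]; simp

theorem mem_right {r : ℕ} (hr : r ≤ N) : y (r + 1) ∈ φ (h r) := by
  rw [hp.edge r hr]; simp

theorem eq_or_of_mem {r q : ℕ} (hr : r ≤ N) (hq : q ≤ N + 1) (hm : y q ∈ φ (h r)) :
    q = r ∨ q = r + 1 := by
  rw [hp.edge r hr, Sym2.mem_iff] at hm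
  exact hm.imp (hp.inj _ _ hq (by omega)) (hp.inj _ _ hq (by omega))

theorem h_inj {r q : ℕ} (hr : r ≤ N) (hq : q ≤ N) (e : h r = h q) : r = q := by
  have h1 := hp.eq_or_of_mem hq (by omega) (e ▸ hp.mem_left hr)
  have h2 := hp.eq_or_of_mem hq (by omega) (e ▸ hp.mem_right hr)
  omega

variable {H : SimpleGraph V} (hφ : IsRep H φ)
include hφ

theorem clique_unique {r q : ℕ} (hr : r < N) (hq : q < N) {v : V} (hs : Simp H v)
    (h₁ : y (r + 1) ∈ φ v) (h₂ : y (q + 1) ∈ φ v) (hv : ∀ q ≤ N, v ≠ h q) : r = q := by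
  have key : ∀ t ≤ N, y (r + 1) ∈ φ (h t) → y (q + 1) ∈ φ (h t) := fun t ht hm =>
    hφ.mem_of_simp hs h₂ (hp.mem_right hq.le) (hv q hq.le).symm (hφ.adj_of_mem h₁ hm (hv t ht))
  have h1 := hp.eq_or_of_mem hr.le (by omega) (key r hr.le (hp.mem_right hr.le))
  have h2 := hp.eq_or_of_mem (r := r + 1) hr (by omega) (key (r + 1) hr (hp.mem_left hr))
  omega

theorem mem_of_tag_odd {r : ℕ} (hr : r < N) {v w : V} (hs : Simp H v)
    (h₁ : y (r + 1) ∈ φ v) (hv : ∀ q ≤ N, v ≠ h q) (hvw : H.Adj v w) : y (r + 1) ∈ φ w :=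
  hφ.mem_of_simp hs h₁ (hp.mem_right hr.le) (hv r hr.le).symm hvw

theorem close {v w : V} {k l : ℕ} (hvw : H.Adj v w) (hk : LiftTag H φ y h N v k)
    (hl : LiftTag H φ y h N w l) : Close k l := by
  unfold Close
  rcases hk with ⟨r, hr, rfl, rfl⟩ | ⟨r, hr, hs, hm, hv, rfl⟩
  · rcases hl with ⟨q, hq, rfl, rfl⟩ | ⟨q, hq, hs, hm, hv, rfl⟩
    · obtain ⟨-, z, hz, hz'⟩ := (hφ.adj _ _).1 hvw
      rw [hp.edge r hr, Sym2.mem_iff] at hz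
      rcases hz with rfl | rfl
      · have := hp.eq_or_of_mem hq (by omega) hz'
        omega
      · have := hp.eq_or_of_mem hq (by omega) hz'
        omega
    · have := hp.eq_or_of_mem hr (by omega) (hp.mem_of_tag_odd hφ hq hs hm hv hvw.symm)
      omega
  · have h1 := hp.mem_of_tag_odd hφ hr hs hm hv hvw
    rcases hl with ⟨q, hq, rfl, rfl⟩ | ⟨q, hq, hs', hm', hv', rfl⟩
    · have := hp.eq_or_of_mem hq (by omega) h1
      omega
    · have := hp.clique_unique hφ hr hq hs' h1 hm' hv'
      omega

theorem exists_lift {G : SimpleGraph V} (hN : 0 < N) (hle : G ≤ H)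
    (hconn : ∀ a b, H.Adj a b → (GS G H a b).Reachable a b) :
    ∃ m s κ ι, Tagged (liftGraph G H φ y h N) (LiftTag H φ y h N) h N m s κ ι := by
  refine exists_tagged hN (fun e => ?_) (fun v w hvw => hvw.2.1)
    (fun v w k l hvw hk hl => hp.close hφ (hle hvw.1) hk hl) ?_ ?_ ?_ ?_
  · have := hp.h_inj (by omega) le_rfl e
    omega
  · rintro v r (⟨q, hq, rfl, e⟩ | ⟨q, hq, -, -, -, e⟩)
    · congr 1
      omega
    · omega
  · rintro k (⟨q, hq, e, rfl⟩ | ⟨q, hq, -, -, hv, e⟩)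
    · have := hp.h_inj (by omega) hq e
      omega
    · exact absurd rfl (hv 0 (by omega))
  · rintro k (⟨q, hq, e, rfl⟩ | ⟨q, hq, -, -, hv, e⟩)
    · have := hp.h_inj (by omega) hq e
      omega
    · exact absurd rfl (hv N le_rfl)
  · have step : ∀ r < N, (liftGraph G H φ y h N).Reachable (h r) (h (r + 1)) := by
      intro r hr
      have hne : h r ≠ h (r + 1) := fun e => by
        have := hp.h_inj hr.le hr e
        omega
      have h1 := hp.mem_right hr.le
      have h2 := hp.mem_left (r := r + 1) hr
      refine (hφ.starGraph_reachable hle h1 h2 hne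
        (hconn _ _ (hφ.adj_of_mem h1 h2 hne))).mono ?_
      have key : ∀ u, (Simp H u ∧ y (r + 1) ∈ φ u) ∨ u = h r ∨ u = h (r + 1) →
          ∃ k, LiftTag H φ y h N u k := by
        intro u hu
        by_cases hq : ∃ q ≤ N, u = h q
        · obtain ⟨q, hq, e⟩ := hq
          exact ⟨_, Or.inl ⟨q, hq, e, rfl⟩⟩
        · push Not at hq
          rcases hu with hu | rfl | rfl
          · exact ⟨_, Or.inr ⟨r, hr, hu.1, hu.2, hq, rfl⟩⟩
          · exact absurd rfl (hq r hr.le)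
          · exact absurd rfl (hq (r + 1) hr)
      exact fun u v huv => ⟨huv.1, key _ huv.2.1, key _ huv.2.2⟩
    have : ∀ r ≤ N, (liftGraph G H φ y h N).Reachable (h 0) (h r) := by
      intro r
      induction r with
      | zero => exact fun _ => .refl _
      | succ r ih => exact fun hr => (ih (by omega)).trans (step r hr)
    exact this N le_rfl

end EdgePath

section Lift

variable {G H : SimpleGraph V} {φ : V → Sym2 W} {X Y : W} {y : ℕ → W} {h : ℕ → V} {N m : ℕ}
  {s : ℕ → V} {κ ι : ℕ → ℕ} (hp : EdgePath φ y h N)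
  (ht : Tagged (liftGraph G H φ y h N) (LiftTag H φ y h N) h N m s κ ι)

include ht

theorem Tagged.lift_adj_iff {i j : ℕ} (hi : i ≤ m) (hj : j ≤ m) :
    G.Adj (s i) (s j) ↔ i + 1 = j ∨ j + 1 = i := by
  rw [← ht.adj_iff hi hj]
  exact ⟨fun h => ⟨h, ⟨_, ht.tag i hi⟩, _, ht.tag j hj⟩, fun h => h.1⟩

theorem Tagged.lift_between {r i : ℕ} (hr : r < N) (h₁ : ι r < i) (h₂ : i < ι (r + 1)) :
    Simp H (s i) ∧ y (r + 1) ∈ φ (s i) ∧ ∀ q ≤ N, s i ≠ h q := by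
  have h3 := ht.tag_between hr h₁ h₂
  have h4 := ht.le (r + 1) (by omega)
  rcases ht.tag i (by omega) with ⟨q, -, -, e⟩ | ⟨q, -, h5, h6, h7, e⟩
  · omega
  · obtain rfl : q = r := by omega
    exact ⟨h5, h6, h7⟩

include hp

theorem Tagged.lift_clique (hφ : IsRep H φ) {i j : ℕ} (hij : i < j) (hj : j ≤ m)
    (hadj : H.Adj (s i) (s j)) : ∃ r < N, ι r ≤ i ∧ j ≤ ι (r + 1) ∧ y (r + 1) ∈ φ (s i) ∧
      y (r + 1) ∈ φ (s j) ∧ ((κ i = 2 * r ∧ κ j = 2 * r + 2) ∨ κ i = 2 * r + 1 ∨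
      κ j = 2 * r + 1) := by
  have hi := ht.tag i (by omega)
  have hj' := ht.tag j hj
  obtain ⟨c1, c2, c3⟩ := hp.close hφ hadj hi hj'
  have mono : ∀ q ≤ N, ¬ (2 * q ≤ κ i ∧ κ j ≤ 2 * q) := fun q hq h' => by
    have h1 := ht.cut_le_of_tag hq h'.1
    have h2 := ht.le_cut_of_tag hq hj h'.2
    omega
  have fin : ∀ r < N, 2 * r ≤ κ i → κ j ≤ 2 * (r + 1) → ι r ≤ i ∧ j ≤ ι (r + 1) := fun r hr h1 h2 =>
    ⟨ht.cut_le_of_tag hr.le h1, ht.le_cut_of_tag hr hj h2⟩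
  rcases hi with ⟨r, hr, e1, e2⟩ | ⟨r, hr, hs, hm, hv, e⟩
  · have h1 := mono r hr
    rcases hj' with ⟨q, hq, e3, e4⟩ | ⟨q, hq, hs, hm, hv, e4⟩
    · obtain rfl : q = r + 1 := by omega
      obtain ⟨f1, f2⟩ := fin r (by omega) (by omega) (by omega)
      exact ⟨r, by omega, f1, f2, e1 ▸ hp.mem_right hr, e3 ▸ hp.mem_left hq, by omega⟩
    · obtain rfl : q = r := by omega
      obtain ⟨f1, f2⟩ := fin q (by omega) (by omega) (by omega)
      exact ⟨q, hq, f1, f2, e1 ▸ hp.mem_right hr, hm, by omega⟩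
  · have h1 := mono (r + 1) (by omega)
    have h2 := mono r (by omega)
    have h3 := hp.mem_of_tag_odd hφ hr hs hm hv hadj
    have h4 : κ j ≤ 2 * (r + 1) ∨ κ j = 2 * r := by omega
    obtain ⟨f1, f2⟩ := fin r (by omega) (by omega) (by omega)
    exact ⟨r, hr, f1, f2, hm, h3, by omega⟩

theorem Tagged.lift_near_odd (hc : HeavyCtx G H φ X Y) {r i : ℕ} (hi : i ≤ m) (hr : κ i = 2 * r + 1)
    (hN : X ∈ φ (s i) ∨ Y ∈ φ (s i)) : y (r + 1) = X ∨ y (r + 1) = Y := by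
  rcases ht.tag i hi with ⟨q, -, -, e⟩ | ⟨q, hq, h5, h6, h7, e⟩
  · omega
  · obtain rfl : q = r := by omega
    exact hc.eq_of_simp h5 h6 (hp.mem_right hq.le) (h7 q hq.le).symm hN

theorem Tagged.lift_near_even {r i : ℕ} (hi : i ≤ m) (hr : κ i = 2 * r)
    (hN : X ∈ φ (s i) ∨ Y ∈ φ (s i)) : r ≤ N ∧
    ((y r = X ∨ y r = Y) ∨ (y (r + 1) = X ∨ y (r + 1) = Y)) := by
  rcases ht.tag i hi with ⟨q, hq, h5, e⟩ | ⟨q, -, -, -, -, e⟩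
  · obtain rfl : q = r := by omega
    rw [h5, hp.edge q hq, Sym2.mem_iff, Sym2.mem_iff] at hN
    refine ⟨hq, ?_⟩
    rcases hN with (h | h) | h | h
    all_goals simp [h]
  · omega

/-- A heavy pair on a lifted path lies within one segment, at distance at most two, and the
clique of that segment is `X` or `Y`. -/
theorem Tagged.lift_heavy [Finite V] (hc : HeavyCtx G H φ X Y) {i j : ℕ} (hij : i < j)
    (hj : j ≤ m) (hh : Hv G (s i) (s j)) : j ≤ i + 2 ∧
      ∃ r < N, ι r ≤ i ∧ j ≤ ι (r + 1) ∧ (y (r + 1) = X ∨ y (r + 1) = Y) := by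
  have hφ := hc.rep
  have hne : s i ≠ s j := fun e => by
    have := ht.inj (by omega) hj e
    omega
  obtain ⟨r, hr, h1, h2, hi', hj', h3⟩ := ht.lift_clique hp hφ hij hj (hc.adj_of_hv _ _ hh hne)
  refine ⟨?_, r, hr, h1, h2, ?_⟩
  · by_cases ha : G.Adj (s i) (s j)
    · have := (ht.lift_adj_iff (by omega) hj).1 ha
      omega
    · obtain ⟨w, hw1, hw2, hw3, hw4⟩ := hc.exists_common hh hne ha hi' hj'
      have htw : ∃ k, LiftTag H φ y h N w k := by
        by_cases hq : ∃ q ≤ N, w = h q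
        · obtain ⟨q, hq, e⟩ := hq
          exact ⟨_, Or.inl ⟨q, hq, e, rfl⟩⟩
        · push Not at hq
          exact ⟨_, Or.inr ⟨r, hr, hw1, hw2, hq, rfl⟩⟩
      exact ht.le_of_common hj (w := w) ⟨hw3, ⟨_, ht.tag i (by omega)⟩, htw⟩
        ⟨hw4, htw, ⟨_, ht.tag j hj⟩⟩
  · rcases h3 with ⟨h3, h4⟩ | h3 | h3
    · by_contra hcon
      have a1 := (ht.lift_near_even hp (by omega) h3 (hc.near _ _ hh)).2.resolve_right hcon
      have a2 := (ht.lift_near_even hp (r := r + 1) hj (by omega)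
        (hc.near_right hh)).2.resolve_left hcon
      have b1 := hφ.adj_of_eq (hp.edge r hr.le)
      have b2 := hφ.adj_of_eq (hp.edge (r + 1) hr)
      have b3 := hc.edge
      have b4 : y r ≠ y (r + 1 + 1) := fun e => by
        have := hp.inj _ _ (by omega) (by omega) e
        omega
      refine hφ.not_triangle b1 b2 ?_
      rcases a1 with a1 | a1 <;> rcases a2 with a2 | a2
      · exact absurd (a1.trans a2.symm) b4
      · rw [a1, a2]; exact b3
      · rw [a1, a2]; exact b3.symm
      · exact absurd (a1.trans a2.symm) b4
    · exact ht.lift_near_odd hp hc (by omega) h3 (hc.near _ _ hh)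
    · exact ht.lift_near_odd hp hc hj h3 (hc.near_right hh)

end Lift

end LiftedPath

section Windows

variable {V W : Type*}

/-- There is an induced `P₆` none of whose `γ`-pairs is heavy. -/
def LightP6 (G : SimpleGraph V) (γ : Set (Sym2 (Fin 6))) : Prop :=
  ∃ v : Fin 6 → V, IsInducedP6 G v ∧ ∀ i j : Fin 6, s(i, j) ∈ γ → ¬ Hv G (v i) (v j)

theorem mem_gamma1 {i j : Fin 6} (h : s(i, j) ∈ gamma1) :
    (i.val ≤ 2 ∧ 3 ≤ j.val) ∨ (j.val ≤ 2 ∧ 3 ≤ i.val) := by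
  simp only [gamma1, Set.mem_insert_iff, Set.mem_singleton_iff, Sym2.eq_iff] at h
  omega

theorem mem_gamma2 {i j : Fin 6} (h : s(i, j) ∈ gamma2) :
    i.val + 3 ≤ j.val ∨ j.val + 3 ≤ i.val ∨ (i.val = 0 ∧ j.val = 0) ∨ (i.val = 5 ∧ j.val = 5) ∨
    (i.val = 0 ∧ j.val = 1) ∨ (i.val = 1 ∧ j.val = 0) ∨ (i.val = 4 ∧ j.val = 5) ∨
    (i.val = 5 ∧ j.val = 4) := by
  simp only [gamma2, Set.mem_insert_iff, Set.mem_singleton_iff, Sym2.eq_iff] at h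
  omega

theorem mem_gamma3 {i j : Fin 6} (h : s(i, j) ∈ gamma3) :
    (i.val + 3 ≤ j.val ∧ ¬ (i.val = 0 ∧ j.val = 5)) ∨
    (j.val + 3 ≤ i.val ∧ ¬ (i.val = 5 ∧ j.val = 0)) ∨
    (i.val = 0 ∧ j.val = 2) ∨ (i.val = 2 ∧ j.val = 0) ∨ (i.val = 3 ∧ j.val = 5) ∨
    (i.val = 5 ∧ j.val = 3) := by
  simp only [gamma3, Set.mem_insert_iff, Set.mem_singleton_iff, Sym2.eq_iff] at h
  omega

theorem Hv.cross {G : SimpleGraph V} {a b c d : V} (h₁ : Hv G a b) (h₂ : Hv G c d) :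
    Hv G a c ∨ Hv G b d := by
  unfold Hv at *
  omega

variable {G H : SimpleGraph V} {φ : V → Sym2 W} {X Y : W} {y : ℕ → W} {h : ℕ → V} {N m : ℕ}
  {s : ℕ → V} {κ ι : ℕ → ℕ}

theorem Tagged.cut_add_le_cut {K : SimpleGraph V} {T : V → ℕ → Prop}
    (ht : Tagged K T h N m s κ ι) {r q : ℕ} (hrq : r ≤ q) (hq : q ≤ N) :
    ι r + (q - r) ≤ ι q := by
  induction q, hrq using Nat.le_induction with
  | base => omega
  | succ q hrq ih =>
    have := ht.lt_succ (r := q) (by omega)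
    have := ih (by omega)
    omega

theorem Tagged.lightP6 (ht : Tagged (liftGraph G H φ y h N) (LiftTag H φ y h N) h N m s κ ι)
    {γ : Set (Sym2 (Fin 6))} {t : ℕ} (htm : t + 5 ≤ m)
    (hγ : ∀ i j : Fin 6, s(i, j) ∈ γ → ¬ Hv G (s (t + i)) (s (t + j))) : LightP6 G γ := by
  refine ⟨fun i => s (t + i), ⟨fun i j e => ?_, fun i j => ?_⟩, hγ⟩
  · have := ht.inj (by omega) (by omega) e
    omega
  · rw [ht.lift_adj_iff (by omega) (by omega)]
    omega

variable [Finite V] (hc : HeavyCtx G H φ X Y) (hp : EdgePath φ y h N)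
  (ht : Tagged (liftGraph G H φ y h N) (LiftTag H φ y h N) h N m s κ ι)
include hc hp ht

theorem Tagged.not_hv_of_far {i j : ℕ} (hij : i + 3 ≤ j) (hj : j ≤ m) : ¬ Hv G (s i) (s j) :=
  fun hh => by
    have := (ht.lift_heavy hp hc (by omega) hj hh).1
    omega

theorem Tagged.lightP6_gamma1 {r : ℕ} (h2 : 2 ≤ r) (h3 : r + 3 ≤ N)
    (hr : ¬ (y (r + 1) = X ∨ y (r + 1) = Y)) : LightP6 G gamma1 := by
  have a1 := ht.le_cut (r := r) (by omega)
  have a2 := ht.cut_add_le (r := r) (by omega)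
  have key : ∀ i j, i ≤ ι r → ι r < j → j ≤ m → ¬ Hv G (s i) (s j) := by
    intro i j hi hj hjm hh
    obtain ⟨-, q, hq, h4, h5, h6⟩ := ht.lift_heavy hp hc (by omega) hjm hh
    have : q = r := by
      rcases Nat.lt_trichotomy q r with h | h | h
      · have := ht.cut_add_le_cut (r := q + 1) (q := r) h (by omega)
        omega
      · exact h
      · have := ht.cut_add_le_cut (r := r) (q := q) h.le (by omega)
        omega
    exact hr (this ▸ h6)
  refine ht.lightP6 (t := ι r - 2) (by omega) fun i j hij => ?_
  rcases mem_gamma1 hij with h | h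
  · exact key _ _ (by omega) (by omega) (by omega)
  · exact fun hh => key _ _ (by omega) (by omega) (by omega) hh.symm

theorem Tagged.lightP6_gamma2 (hN : 5 ≤ N) (e0 : ¬ (y 0 = X ∨ y 0 = Y)) (e1 : ¬ (y 1 = X ∨ y 1 = Y))
    (e2 : ¬ (y N = X ∨ y N = Y)) (e3 : ¬ (y (N + 1) = X ∨ y (N + 1) = Y)) : LightP6 G gamma2 := by
  have hm := ht.le_cut (r := N) le_rfl
  rw [ht.last] at hm
  have hk0 := ht.tag_cut 0 (by omega)
  rw [ht.zero] at hk0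
  have hkm := ht.tag_cut N le_rfl
  rw [ht.last] at hkm
  have end0 : ∀ u, ¬ Hv G (s 0) u := fun u hu => by
    rcases (ht.lift_near_even hp (r := 0) (by omega) hk0 (hc.near _ _ hu)).2 with h | h
    · exact e0 h
    · exact e1 h
  have endm : ∀ u, ¬ Hv G (s m) u := fun u hu => by
    rcases (ht.lift_near_even hp (r := N) (by omega) hkm (hc.near _ _ hu)).2 with h | h
    · exact e2 h
    · exact e3 h
  have far := fun i j => ht.not_hv_of_far hc hp (i := i) (j := j)
  obtain ⟨t, htm, b1, b2, b3, b4⟩ : ∃ t, t + 5 ≤ m ∧ ¬ Hv G (s t) (s t) ∧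
      ¬ Hv G (s t) (s (t + 1)) ∧ ¬ Hv G (s (t + 4)) (s (t + 5)) ∧
      ¬ Hv G (s (t + 5)) (s (t + 5)) := by
    by_cases hex : ∃ i, i + 1 ≤ m ∧ (Hv G (s i) (s i) ∨ Hv G (s i) (s (i + 1)))
    · classical
      obtain ⟨c, ⟨hcm, hcc⟩, hmin⟩ : ∃ c, (c + 1 ≤ m ∧ (Hv G (s c) (s c) ∨ Hv G (s c) (s (c + 1)))) ∧
          ∀ i < c, ¬ (i + 1 ≤ m ∧ (Hv G (s i) (s i) ∨ Hv G (s i) (s (i + 1)))) :=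
        ⟨Nat.find hex, Nat.find_spec hex, fun i hi => Nat.find_min hex hi⟩
      have c0 : c ≠ 0 := by
        rintro rfl
        rcases hcc with h | h
        · exact end0 _ h
        · exact end0 _ h
      rcases Nat.lt_or_ge (c + 4) m with h4 | h4
      · obtain ⟨d, rfl⟩ : ∃ d, c = d + 1 := ⟨c - 1, by omega⟩
        have m1 := hmin d (by omega)
        refine ⟨d, by omega, fun hh => m1 ⟨by omega, Or.inl hh⟩,
          fun hh => m1 ⟨by omega, Or.inr hh⟩, fun hh => ?_, fun hh => ?_⟩
        · rcases hcc with h | h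
          · rcases h.cross hh with h' | h'
            · exact far _ _ (by omega) (by omega) h'
            · exact far _ _ (by omega) (by omega) h'
          · rcases h.cross hh with h' | h'
            · exact far _ _ (by omega) (by omega) h'
            · exact far _ _ (by omega) (by omega) h'
        · rcases hcc with h | h
          · rcases h.cross hh with h' | h'
            · exact far _ _ (by omega) (by omega) h'
            · exact far _ _ (by omega) (by omega) h'
          · rcases h.cross hh with h' | h'
            · exact far _ _ (by omega) (by omega) h'
            · exact far _ _ (by omega) (by omega) h'
      · obtain ⟨d, rfl⟩ : ∃ d, m = d + 5 := ⟨m - 5, by omega⟩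
        have m1 := hmin d (by omega)
        exact ⟨d, by omega, fun hh => m1 ⟨by omega, Or.inl hh⟩,
          fun hh => m1 ⟨by omega, Or.inr hh⟩, fun hh => endm _ hh.symm, fun hh => endm _ hh⟩
    · push Not at hex
      obtain ⟨d, rfl⟩ : ∃ d, m = d + 5 := ⟨m - 5, by omega⟩
      exact ⟨d, by omega, (hex d (by omega)).1, (hex d (by omega)).2, (hex (d + 4) (by omega)).2,
        endm _⟩
  refine ht.lightP6 htm fun i j hij => ?_
  rcases mem_gamma2 hij with h | h | ⟨h, h'⟩ | ⟨h, h'⟩ | ⟨h, h'⟩ | ⟨h, h'⟩ | ⟨h, h'⟩ | ⟨h, h'⟩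
  · exact far _ _ (by omega) (by omega)
  · exact fun hh => far _ _ (by omega) (by omega) hh.symm
  all_goals rw [h, h']
  · exact b1
  · exact b4
  · exact b2
  · exact fun hh => b2 hh.symm
  · exact b3
  · exact fun hh => b3 hh.symm

theorem Tagged.lightP6_gamma3 (hN : 5 ≤ N)
    (hcrit : ∀ r < N, r ≤ 3 → N ≤ r + 4 → (y (r + 1) = X ∨ y (r + 1) = Y) →
      ι (r + 1) ≤ ι r + 3) : LightP6 G gamma3 := by
  have hm := ht.le_cut (r := N) le_rfl
  rw [ht.last] at hm
  have far := fun i j => ht.not_hv_of_far hc hp (i := i) (j := j)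
  obtain ⟨t, htm, b1, b2⟩ : ∃ t, t + 5 ≤ m ∧ ¬ Hv G (s t) (s (t + 2)) ∧
      ¬ Hv G (s (t + 3)) (s (t + 5)) := by
    by_contra hcon
    push Not at hcon
    set D : ℕ → Prop := fun i => i + 2 ≤ m ∧ Hv G (s i) (s (i + 2)) with hDdef
    have hD : ∀ t, t + 5 ≤ m → D t ∨ D (t + 3) := by
      intro t htm
      by_cases h : Hv G (s t) (s (t + 2))
      · exact Or.inl ⟨by omega, h⟩
      · exact Or.inr ⟨by omega, hcon t htm h⟩
    have hDc : ∀ i j, D i → D j → j ≤ i + 2 := by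
      intro i j hi hj
      by_contra hlt
      rcases hi.2.cross hj.2 with h | h
      · exact far _ _ (by omega) (by have := hj.1; omega) h
      · exact far _ _ (by omega) (by have := hj.1; omega) h
    have hDs : ∀ i, D i → ∃ r < N, ι r ≤ i ∧ i + 2 ≤ ι (r + 1) ∧ r ≤ ι r ∧
        ι (r + 1) + (N - (r + 1)) ≤ m ∧ (y (r + 1) = X ∨ y (r + 1) = Y) := by
      intro i hi
      obtain ⟨-, r, hr, h1, h2, h3⟩ := ht.lift_heavy hp hc (by omega) hi.1 hi.2
      exact ⟨r, hr, h1, h2, ht.le_cut hr.le, ht.cut_add_le hr, h3⟩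
    have hex : ∃ i, D i := by
      rcases hD 0 (by omega) with h | h
      · exact ⟨_, h⟩
      · exact ⟨_, h⟩
    classical
    obtain ⟨c, hcc, hmin⟩ : ∃ c, D c ∧ ∀ i, D i → c ≤ i :=
      ⟨Nat.find hex, Nat.find_spec hex, fun i hi => Nat.find_min' hex hi⟩
    obtain ⟨r, hr, r1, r2, r3, r4, r5⟩ := hDs c hcc
    have same : ∀ q < N, ∀ i, ι q ≤ i → i < ι (q + 1) → ι r ≤ i → i < ι (r + 1) → q = r := by
      intro q hq i h1 h2 h3 h4
      rcases Nat.lt_trichotomy q r with h | h | h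
      · have := ht.cut_add_le_cut (r := q + 1) (q := r) h (by omega)
        omega
      · exact h
      · have := ht.cut_add_le_cut (r := r + 1) (q := q) h (by omega)
        omega
    have hloc : ∀ i, D i → i = c ∨ (i = c + 1 ∧ D (c + 1)) ∨ (i = c + 2 ∧ D (c + 2)) := by
      intro i hi
      have h1 := hmin i hi
      have h2 := hDc c i hcc hi
      obtain rfl | rfl | rfl : i = c ∨ i = c + 1 ∨ i = c + 2 := by omega
      · exact Or.inl rfl
      · exact Or.inr (Or.inl ⟨rfl, hi⟩)
      · exact Or.inr (Or.inr ⟨rfl, hi⟩)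
    have hDl : ∀ t, t + 5 ≤ m → (t = c ∨ (t = c + 1 ∧ D (c + 1)) ∨ (t = c + 2 ∧ D (c + 2))) ∨
        (t + 3 = c ∨ (t + 3 = c + 1 ∧ D (c + 1)) ∨ (t + 3 = c + 2 ∧ D (c + 2))) :=
      fun t htm => (hD t htm).imp (hloc _) (hloc _)
    have t0 := hDl 0 (by omega)
    have t1 := hDl 1 (by omega)
    by_cases d1 : D (c + 1) <;> by_cases d2 : D (c + 2)
    · obtain ⟨q, hq, q1, q2, q3, q4, q5⟩ := hDs _ d1
      obtain ⟨p, hp', p1, p2, p3, p4, p5⟩ := hDs _ d2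
      have e1 : q = r := same q hq (c + 1) (by omega) (by omega) (by omega) (by omega)
      subst e1
      have e2 : p = q := same p hp' (c + 2) (by omega) (by omega) (by omega) (by omega)
      subst e2
      obtain ⟨d, rfl⟩ : ∃ d, m = d + 5 := ⟨m - 5, by omega⟩
      have t2 := hDl d (by omega)
      have := hcrit p hr (by omega) (by omega) r5
      omega
    · obtain ⟨q, hq, q1, q2, q3, q4, q5⟩ := hDs _ d1
      have e1 : q = r := same q hq (c + 1) (by omega) (by omega) (by omega) (by omega)
      subst e1
      have t2 := hDl 2 (by omega)
      simp only [d1, d2, and_true, and_false, or_false] at t0 t1 t2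
      omega
    · obtain ⟨p, hp', p1, p2, p3, p4, p5⟩ := hDs _ d2
      have hm7 : 7 ≤ m := by
        rcases Nat.lt_trichotomy p r with h | h | h
        · have := ht.cut_add_le_cut (r := p + 1) (q := r) h (by omega)
          omega
        · subst h
          omega
        · have := ht.cut_add_le_cut (r := r + 1) (q := p) h (by omega)
          omega
      have t2 := hDl 2 (by omega)
      simp only [d1, d2, and_true, and_false, false_or] at t0 t1 t2
      omega
    · simp only [d1, d2, and_false, or_false] at t0 t1
      omega
  refine ht.lightP6 htm fun i j hij => ?_
  rcases mem_gamma3 hij with h | h | ⟨h, h'⟩ | ⟨h, h'⟩ | ⟨h, h'⟩ | ⟨h, h'⟩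
  · exact far _ _ (by omega) (by omega)
  · exact fun hh => far _ _ (by omega) (by omega) hh.symm
  all_goals rw [h, h']
  · exact b1
  · exact fun hh => b1 hh.symm
  · exact b2
  · exact fun hh => b2 hh.symm

end Windows

section ThetaPaths

variable {V W : Type*}

theorem exists_edgePath {φ : V → Sym2 W} {L : List W} {N : ℕ} (hn : L.Nodup)
    (hch : L.IsChain (FU φ Set.univ).Adj) (hl : L.length = N + 2) :
    ∃ y h, EdgePath φ y h N ∧ ∀ i < N + 2, L[i]? = some (y i) := by
  rw [List.isChain_iff_getElem] at hch
  have h0 : 0 < L.length := by omega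
  set y : ℕ → W := fun i => L.getD i L[0] with hy
  have hy' : ∀ i (hi : i < L.length), y i = L[i] := fun i hi => by simp [hy, hi]
  have hex : ∀ r ≤ N, ∃ v, φ v = s(y r, y (r + 1)) := by
    intro r hr
    obtain ⟨-, v, -, hv⟩ := hch r (by omega)
    exact ⟨v, by rw [hv, hy' r (by omega), hy' (r + 1) (by omega)]⟩
  have : Nonempty V := ⟨(hex 0 (by omega)).choose⟩
  choose! h hh using hex
  refine ⟨y, h, ⟨fun i j hi hj e => ?_, hh⟩, fun i hi => ?_⟩
  · rw [hy' i (by omega), hy' j (by omega)] at e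
    exact (List.Nodup.getElem_inj_iff hn).1 e
  · rw [hy' i (by omega)]
    exact List.getElem?_eq_getElem _

theorem Branch.exists_path {F : SimpleGraph W} {a b : W} {I₁ I₂ I₃ : List W} {S₁ S₂ S₃ : Set W}
    (hab : a ≠ b) (h₁ : Branch F a b I₁ S₁) (h₂ : Branch F a b I₂ S₂) (h₃ : Branch F a b I₃ S₃)
    (h₁₂ : Disjoint S₁ S₂) (h₁₃ : Disjoint S₁ S₃) (h₂₃ : Disjoint S₂ S₃) :
    ∃ u' u v v', u' ∈ S₁ ∧ u ∈ S₁ ∧ v ∈ S₃ ∧ v' ∈ S₃ ∧ F.Adj a u ∧ I₁.head? = some u ∧ I₂ ≠ [] ∧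
      (u' :: u :: a :: (I₂ ++ [b, v, v'])).Nodup ∧
      (u' :: u :: a :: (I₂ ++ [b, v, v'])).IsChain F.Adj := by
  obtain ⟨u, _, hs, hau, -, ⟨u', hu', huu'⟩, -⟩ := h₁.seg
  obtain ⟨p, q, hpq, hap, hqb, -, -⟩ := h₂.seg
  obtain ⟨_, v, hs', -, hvb, -, v', hv', hvv'⟩ := h₃.seg
  have hu := h₁.sub u hs.head_mem
  have hv := h₃.sub v hs'.last_mem
  have d12 := Set.disjoint_left.1 h₁₂
  have d13 := Set.disjoint_left.1 h₁₃
  have d23 := Set.disjoint_left.1 h₂₃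
  have ne : ∀ {S : Set W} {x y : W}, x ∈ S → y ∉ S → x ≠ y := fun hx hy e => hy (e ▸ hx)
  refine ⟨u', u, v, v', hu', hu, hv, hv', hau, hs.2.1, hpq.ne_nil, ?_, ?_⟩
  · have := h₂.nodup
    simp only [List.nodup_cons, List.mem_cons, List.mem_append, List.nodup_append, List.not_mem_nil,
      or_false, not_or]
    refine ⟨⟨huu'.ne', ne hu' h₁.ha, fun h => d12 hu' (h₂.sub _ h), ne hu' h₁.hb,
      ne hu' fun h => d13 h hv, ne hu' fun h => d13 h hv'⟩, ⟨ne hu h₁.ha,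
      fun h => d12 hu (h₂.sub _ h), ne hu h₁.hb, ne hu fun h => d13 h hv, ne hu fun h => d13 h hv'⟩,
      ⟨fun h => h₂.ha (h₂.sub _ h), hab, (ne hv h₃.ha).symm, (ne hv' h₃.ha).symm⟩, this,
      ⟨⟨(ne hv h₃.hb).symm, (ne hv' h₃.hb).symm⟩, hvv'.ne, not_false, List.nodup_nil⟩, ?_⟩
    rintro x hx _ (rfl | rfl | rfl)
    · exact ne (h₂.sub x hx) h₂.hb
    · exact ne (h₂.sub x hx) fun h => d23 h hv
    · exact ne (h₂.sub x hx) fun h => d23 h hv'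
  · exact (Seg.cons huu'.symm (Seg.cons hau.symm (Seg.cons hap (hpq.append
      (Seg.cons hvb.symm (Seg.cons hvv' (Seg.singleton v'))) hqb)))).1

theorem exists_clean {S : Fin 3 → Set W} (hd : ∀ i j, i ≠ j → Disjoint (S i) (S j)) (X Y : W) :
    ∃ j, X ∉ S j ∧ Y ∉ S j := by
  have key : ∀ Z i j, i ≠ j → Z ∈ S i → Z ∉ S j := fun Z i j hij hZ =>
    Set.disjoint_left.1 (hd i j hij) hZ
  by_contra hcon
  have h0 : ∀ j, X ∈ S j ∨ Y ∈ S j := fun j => by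
    by_contra h
    push Not at h
    exact hcon ⟨j, h⟩
  have k1 := key X 0 1 (by decide)
  have k2 := key X 0 2 (by decide)
  have k3 := key X 1 2 (by decide)
  have k1' := key Y 0 1 (by decide)
  have k2' := key Y 0 2 (by decide)
  have k3' := key Y 1 2 (by decide)
  have a0 := h0 0
  have a1 := h0 1
  have a2 := h0 2
  tauto

theorem exists_others : ∀ j : Fin 3, ∃ i k : Fin 3, i ≠ j ∧ j ≠ k ∧ i ≠ k := by decide

theorem HeavyCtx.swap {G H : SimpleGraph V} {φ : V → Sym2 W} {X Y : W}
    (hc : HeavyCtx G H φ X Y) : HeavyCtx G H φ Y X :=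
  ⟨hc.le, hc.rep, hc.conn, hc.adj_of_hv, fun u v h => (hc.near u v h).symm, hc.edge.symm⟩

variable [Finite V] {G H : SimpleGraph V} {φ : V → Sym2 W} {X Y : W}

theorem HeavyCtx.lightP6_gamma1 (hc : HeavyCtx G H φ X Y) (hθ : IsTheta (FU φ Set.univ)) :
    LightP6 G gamma1 := by
  obtain ⟨a, b, hab, I, S, hB, hd⟩ := hθ
  obtain ⟨j, hX, hY⟩ := exists_clean hd X Y
  obtain ⟨i, k, hij, hjk, hik⟩ := exists_others j
  obtain ⟨u', u, v, v', -, -, -, -, -, -, hne, hn, hch⟩ := (hB i).exists_path hab (hB j) (hB k)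
    (hd _ _ hij) (hd _ _ hik) (hd _ _ hjk)
  obtain ⟨p, t, hpt⟩ := List.exists_cons_of_ne_nil hne
  rw [hpt] at hn hch
  obtain ⟨y, h, hp, hy⟩ := exists_edgePath (N := t.length + 5) hn hch (by simp)
  obtain ⟨m, s, κ, ι, ht⟩ := hp.exists_lift hc.rep (by omega) hc.le hc.conn
  refine ht.lightP6_gamma1 hc hp (r := 2) le_rfl (by omega) ?_
  have h3 := hy 3 (by omega)
  have hpS := (hB j).sub p (by rw [hpt]; simp)
  simp only [List.cons_append, List.getElem?_cons_succ, List.getElem?_cons_zero,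
    Option.some.injEq] at h3
  rw [← h3]
  rintro (rfl | rfl)
  · exact hX hpS
  · exact hY hpS

theorem HeavyCtx.lightP6_gamma2_of_list (hc : HeavyCtx G H φ X Y) {u' u v v' : W} {l : List W}
    (hl : 3 ≤ l.length) (hn : (u' :: u :: (l ++ [v, v'])).Nodup)
    (hch : (u' :: u :: (l ++ [v, v'])).IsChain (FU φ Set.univ).Adj) (h₁ : ¬ (u' = X ∨ u' = Y))
    (h₂ : ¬ (u = X ∨ u = Y)) (h₃ : ¬ (v = X ∨ v = Y)) (h₄ : ¬ (v' = X ∨ v' = Y)) :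
    LightP6 G gamma2 := by
  obtain ⟨y, h, hp, hy⟩ := exists_edgePath (N := l.length + 2) hn hch (by simp)
  obtain ⟨m, s, κ, ι, ht⟩ := hp.exists_lift hc.rep (by omega) hc.le hc.conn
  have e0 := hy 0 (by omega)
  have e1 := hy 1 (by omega)
  have e2 := hy (l.length + 2) (by omega)
  have e3 := hy (l.length + 3) (by omega)
  simp only [List.getElem?_cons_succ, List.getElem?_cons_zero, Option.some.injEq] at e0 e1
  rw [show l.length + 2 = l.length + 1 + 1 from rfl, List.getElem?_cons_succ,
    List.getElem?_cons_succ, List.getElem?_append_right le_rfl, Nat.sub_self] at e2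
  rw [show l.length + 3 = l.length + 1 + 1 + 1 from rfl, List.getElem?_cons_succ,
    List.getElem?_cons_succ, List.getElem?_append_right (by omega), Nat.add_sub_cancel_left] at e3
  simp only [List.getElem?_cons_succ, List.getElem?_cons_zero, Option.some.injEq] at e2 e3
  exact ht.lightP6_gamma2 hc hp (by omega) (by rwa [← e0]) (by rwa [← e1]) (by rwa [← e2])
    (by rwa [show l.length + 2 + 1 = l.length + 1 + 1 + 1 from rfl, ← e3])

theorem HeavyCtx.lightP6_gamma2_of_stubs (hc : HeavyCtx G H φ X Y) {a b : W}
    {I₁ I₂ I₃ : List W} {S₁ S₂ S₃ : Set W}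
    (hab : a ≠ b) (h₁ : Branch (FU φ Set.univ) a b I₁ S₁) (h₂ : Branch (FU φ Set.univ) a b I₂ S₂)
    (h₃ : Branch (FU φ Set.univ) a b I₃ S₃) (h₁₂ : Disjoint S₁ S₂) (h₁₃ : Disjoint S₁ S₃)
    (h₂₃ : Disjoint S₂ S₃) (hX₁ : X ∉ S₁) (hY₁ : Y ∉ S₁) (hX₃ : X ∉ S₃) (hY₃ : Y ∉ S₃) :
    LightP6 G gamma2 := by
  obtain ⟨u', u, v, v', hu', hu, hv, hv', -, -, hne, hn, hch⟩ :=
    h₁.exists_path hab h₂ h₃ h₁₂ h₁₃ h₂₃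
  have key : ∀ {S : Set W} {x : W}, x ∈ S → X ∉ S → Y ∉ S → ¬ (x = X ∨ x = Y) := by
    rintro S x hx h1 h2 (rfl | rfl)
    · exact h1 hx
    · exact h2 hx
  have e : u' :: u :: a :: (I₂ ++ [b, v, v']) = u' :: u :: ((a :: (I₂ ++ [b])) ++ [v, v']) := by
    simp
  rw [e] at hn hch
  exact hc.lightP6_gamma2_of_list (by
    have := List.length_pos_iff.2 hne
    simp only [List.length_cons, List.length_append, List.length_nil]
    omega) hn hch (key hu' hX₁ hY₁) (key hu hX₁ hY₁) (key hv hX₃ hY₃) (key hv' hX₃ hY₃)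

theorem HeavyCtx.lightP6_gamma2_of_split (hc : HeavyCtx G H φ X Y) {a b : W}
    {I₁ I₂ I₃ : List W} {S₁ S₂ S₃ : Set W}
    (hab : a ≠ b) (h₁ : Branch (FU φ Set.univ) a b I₁ S₁) (h₂ : Branch (FU φ Set.univ) a b I₂ S₂)
    (h₃ : Branch (FU φ Set.univ) a b I₃ S₃) (h₁₂ : Disjoint S₁ S₂) (h₁₃ : Disjoint S₁ S₃)
    (h₂₃ : Disjoint S₂ S₃) (hX : X ∈ S₁) (hY : Y ∈ S₂) (hYa : ¬ (FU φ Set.univ).Adj a Y) :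
    LightP6 G gamma2 := by
  obtain ⟨_, v, hs', -, hvb, -, v', hv', hvv'⟩ := h₃.seg
  have hv := h₃.sub v hs'.last_mem
  obtain ⟨l, p, hl1, hl2, hl3, hl4⟩ := h₁.toB X hX
  obtain ⟨l', q, hk1, hk2, hk3, hk4⟩ := h₂.toA Y hY
  have d12 := Set.disjoint_left.1 h₁₂
  have d13 := Set.disjoint_right.1 h₁₃
  have d23 := Set.disjoint_right.1 h₂₃
  have ne : ∀ {S : Set W} {x y : W}, x ∈ S → y ∉ S → x ≠ y := fun hx hy e => hy (e ▸ hx)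
  have hqY : q ≠ Y := by
    rintro rfl
    exact hYa hk4
  obtain ⟨w, t, rfl⟩ := List.exists_cons_of_ne_nil hk3.ne_nil
  obtain rfl := hk3.head_eq
  have htne : t ≠ [] := by
    rintro rfl
    exact hqY (by simpa using hk3.2.2)
  have hseg : Seg (FU φ Set.univ).Adj v' a
      (v' :: v :: b :: (l ++ (((w :: t).reverse) ++ [a]))) :=
    Seg.cons hvv'.symm (Seg.cons hvb (Seg.cons hl4 (hl3.append
      ((hk3.reverse fun _ _ h => h.symm).append (Seg.singleton a) hk4.symm) hc.edge)))
  have e : v' :: v :: b :: (l ++ ((w :: t).reverse ++ [a])) =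
      v' :: v :: ((b :: (l ++ t.reverse)) ++ [w, a]) := by simp
  have hw := hk2 w (by simp)
  have hnd : (v' :: v :: b :: (l ++ ((w :: t).reverse ++ [a]))).Nodup := by
    have hk1' := List.nodup_reverse.2 hk1
    have hmem : ∀ x, x ∈ (w :: t).reverse → x ∈ S₂ := fun x hx => hk2 x (List.mem_reverse.1 hx)
    generalize (w :: t).reverse = r at hk1' hmem
    simp only [List.nodup_cons, List.mem_cons, List.mem_append, List.nodup_append, List.not_mem_nil,
      or_false, not_or]
    refine ⟨⟨hvv'.ne', ne hv' h₃.hb, fun h => d13 hv' (hl2 _ h), fun h => d23 hv' (hmem _ h),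
      ne hv' h₃.ha⟩, ⟨ne hv h₃.hb, fun h => d13 hv (hl2 _ h), fun h => d23 hv (hmem _ h),
      ne hv h₃.ha⟩, ⟨fun h => h₁.hb (hl2 _ h), fun h => h₂.hb (hmem _ h), hab.symm⟩, hl1,
      ⟨hk1', ⟨not_false, List.nodup_nil⟩, ?_⟩, ?_⟩
    · rintro x hx _ rfl
      exact ne (hmem x hx) h₂.ha
    · rintro x hx z (hz | rfl)
      · exact ne (hl2 x hx) fun h => d12 h (hmem z hz)
      · exact ne (hl2 x hx) h₁.ha
  have hch := hseg.1
  rw [e] at hnd hch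
  have c3 : ∀ {x}, x ∈ S₃ → ¬ (x = X ∨ x = Y) := by
    rintro x hx (rfl | rfl)
    · exact d13 hx hX
    · exact d23 hx hY
  refine hc.lightP6_gamma2_of_list ?_ hnd hch (c3 hv') (c3 hv) ?_ ?_
  · have h1 := List.length_pos_iff.2 hl3.ne_nil
    have h2 := List.length_pos_iff.2 htne
    simp only [List.length_cons, List.length_append, List.length_reverse]
    omega
  · rintro (rfl | rfl)
    · exact d12 hX hw
    · exact hqY rfl
  · rintro (rfl | rfl)
    · exact h₁.ha hX
    · exact h₂.ha hY

theorem HeavyCtx.lightP6_gamma2 (hc : HeavyCtx G H φ X Y) (hθ : IsTheta (FU φ Set.univ)) :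
    LightP6 G gamma2 := by
  obtain ⟨a, b, hab, I, S, hB, hd⟩ := hθ
  obtain ⟨k, hX, hY⟩ := exists_clean hd X Y
  obtain ⟨i, j, hik, hkj, hij⟩ := exists_others k
  by_cases hi : X ∉ S i ∧ Y ∉ S i
  · exact hc.lightP6_gamma2_of_stubs hab (hB i) (hB j) (hB k) (hd _ _ hij) (hd _ _ hik)
      (hd _ _ hkj.symm) hi.1 hi.2 hX hY
  by_cases hj : X ∉ S j ∧ Y ∉ S j
  · exact hc.lightP6_gamma2_of_stubs hab (hB j) (hB i) (hB k) (hd _ _ hij.symm) (hd _ _ hkj.symm)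
      (hd _ _ hik) hj.1 hj.2 hX hY
  have dij := hd i j hij
  have key : ∀ {X Y : W}, HeavyCtx G H φ X Y → X ∈ S i → Y ∈ S j → LightP6 G gamma2 := by
    intro X Y hc hX hY
    by_cases hYa : (FU φ Set.univ).Adj a Y
    · exact hc.swap.lightP6_gamma2_of_split hab (hB j) (hB i) (hB k) dij.symm (hd _ _ hkj.symm)
        (hd _ _ hik) hY hX fun hXa => hc.rep.not_triangle hXa hc.edge hYa
    · exact hc.lightP6_gamma2_of_split hab (hB i) (hB j) (hB k) dij (hd _ _ hik)
        (hd _ _ hkj.symm) hX hY hYa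
  have dl := Set.disjoint_left.1 dij
  by_cases hXi : X ∈ S i
  · have hXj : X ∉ S j := dl hXi
    have hYj : Y ∈ S j := by tauto
    exact key hc hXi hYj
  · have hYi : Y ∈ S i := by tauto
    have hYj : Y ∉ S j := dl hYi
    have hXj : X ∈ S j := by tauto
    exact key hc.swap hYi hXj

end ThetaPaths

section DetourWindow

variable {V W : Type*}

/-- A lifted path with a long segment in the clique `y 2 = X` can be closed up through a fourth
vertex adjacent to both `y 1` and `y 4`, giving a light induced `P₆` for `γ₃`. -/
theorem Tagged.lightP6_gamma3_of_long [Finite V] {G H : SimpleGraph V} {φ : V → Sym2 W}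
    {y : ℕ → W} {h : ℕ → V} {m : ℕ} {s : ℕ → V} {κ ι : ℕ → ℕ} {Y : W}
    (hc : HeavyCtx G H φ (y 2) Y) (hp : EdgePath φ y h 5)
    (ht : Tagged (liftGraph G H φ y h 5) (LiftTag H φ y h 5) h 5 m s κ ι)
    (hY1 : y 1 ≠ Y) (hY3 : y 3 ≠ Y) (hY4 : y 4 ≠ Y) (hF : (FU φ Set.univ).Adj (y 1) (y 4))
    (hlong : ι 1 + 4 ≤ ι 2) : LightP6 G gamma3 := by
  have hφ := hc.rep
  obtain ⟨-, g, -, hg⟩ := hF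
  have hne : ∀ i j, i ≤ 6 → j ≤ 6 → i ≠ j → y i ≠ y j := fun i j hi hj hij e =>
    hij (hp.inj i j (by omega) (by omega) e)
  have n12 := hne 1 2 (by omega) (by omega) (by omega)
  have n13 := hne 1 3 (by omega) (by omega) (by omega)
  have n14 := hne 1 4 (by omega) (by omega) (by omega)
  have n23 := hne 2 3 (by omega) (by omega) (by omega)
  have n24 := hne 2 4 (by omega) (by omega) (by omega)
  have n34 := hne 3 4 (by omega) (by omega) (by omega)
  have e1 : φ (h 1) = s(y 1, y 2) := hp.edge 1 (by omega)
  have e2 : φ (h 2) = s(y 2, y 3) := hp.edge 2 (by omega)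
  have e3 : φ (h 3) = s(y 3, y 4) := hp.edge 3 (by omega)
  have hιm := ht.le 2 (by omega)
  have s1 := ht.at_cut 1 (by omega)
  have s2 := ht.at_cut 2 (by omega)
  obtain ⟨a1, a2, a3⟩ := ht.lift_between (r := 1) (i := ι 1 + 1) (by omega) (by omega)
    (show _ < ι 2 by omega)
  obtain ⟨b1, b2, b3⟩ := ht.lift_between (r := 1) (i := ι 2 - 1) (by omega) (by omega)
    (show _ < ι 2 by omega)
  have hll : s (ι 1 + 1) ≠ s (ι 2 - 1) := fun e => by
    have := ht.inj (by omega) (by omega) e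
    omega
  have adj1 : G.Adj (s (ι 1 + 1)) (h 1) := by
    rw [← s1, ht.lift_adj_iff (by omega) (by omega)]
    omega
  have adj2 : G.Adj (h 2) (s (ι 2 - 1)) := by
    rw [← s2, ht.lift_adj_iff (by omega) (by omega)]
    omega
  have nadj1 : ¬ G.Adj (s (ι 1 + 1)) (h 2) := by
    rw [← s2, ht.lift_adj_iff (by omega) (by omega)]
    omega
  have nadj2 : ¬ G.Adj (h 1) (h 2) := by
    rw [← s1, ← s2, ht.lift_adj_iff (by omega) (by omega)]
    omega
  have nadj3 : ¬ G.Adj (h 1) (s (ι 2 - 1)) := by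
    rw [← s1, ht.lift_adj_iff (by omega) (by omega)]
    omega
  have nadj4 : ¬ G.Adj (s (ι 1 + 1)) (s (ι 2 - 1)) := by
    rw [ht.lift_adj_iff (by omega) (by omega)]
    omega
  have nhv1 : ¬ Hv G (s (ι 1 + 1)) (h 2) := by
    rw [← s2]
    exact ht.not_hv_of_far hc hp (by omega) (by omega)
  have nhv2 : ¬ Hv G (h 1) (h 2) := by
    rw [← s1, ← s2]
    exact ht.not_hv_of_far hc hp (by omega) (by omega)
  have nhv3 : ¬ Hv G (h 1) (s (ι 2 - 1)) := by
    rw [← s1]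
    exact ht.not_hv_of_far hc hp (by omega) (by omega)
  generalize s (ι 1 + 1) = l₁ at *
  generalize s (ι 2 - 1) = l₂ at *
  have t14 : ¬ (FU φ Set.univ).Adj (y 2) (y 4) := fun hh =>
    hφ.not_triangle (hφ.adj_of_eq e2) (hφ.adj_of_eq e3) hh
  have t13 : ¬ (FU φ Set.univ).Adj (y 1) (y 3) := fun hh =>
    hφ.not_triangle (hφ.adj_of_eq e1) (hφ.adj_of_eq e2) hh
  -- neighbours in `G` of `l₁` and `l₂` contain `y 2`
  have hl1 : ∀ w, G.Adj l₁ w → y 2 ∈ φ w := fun w hw =>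
    hφ.mem_of_simp a1 a2 (hp.mem_right (r := 1) (by omega)) (a3 1 (by omega)).symm (hc.le hw)
  have hl2 : ∀ w, G.Adj l₂ w → y 2 ∈ φ w := fun w hw =>
    hφ.mem_of_simp b1 b2 (hp.mem_right (r := 1) (by omega)) (b3 1 (by omega)).symm (hc.le hw)
  have hlc : ∀ l, y 2 ∈ φ l → (∀ q ≤ 5, l ≠ h q) → y 1 ∉ φ l ∧ y 3 ∉ φ l ∧ y 4 ∉ φ l := by
    intro l hl hq
    refine ⟨fun h' => hq 1 (by omega) ?_, fun h' => hq 2 (by omega) ?_, fun h' => t14 ?_⟩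
    · exact hφ.eq_of_mem n12 h' hl (by rw [e1]; simp) (by rw [e1]; simp)
    · exact hφ.eq_of_mem n23 hl h' (by rw [e2]; simp) (by rw [e2]; simp)
    · exact hφ.adj_of_eq ((Sym2.mem_and_mem_iff n24).1 ⟨hl, h'⟩)
  obtain ⟨c1, c2, c3⟩ := hlc l₁ a2 a3
  obtain ⟨d1, d2, d3⟩ := hlc l₂ b2 b3
  have hAg : y 2 ∉ φ g := by
    rw [hg]; simp [n12.symm, n24]
  have hA3 : y 2 ∉ φ (h 3) := by
    rw [e3]; simp [n23, n24]
  set f : ℕ → V := fun r => if r = 0 then l₁ else if r = 1 then h 1 else if r = 2 then g else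
    if r = 3 then h 3 else if r = 4 then h 2 else l₂ with hf
  have f0 : f 0 = l₁ := rfl
  have f1 : f 1 = h 1 := rfl
  have f2 : f 2 = g := rfl
  have f3 : f 3 = h 3 := rfl
  have f4 : f 4 = h 2 := rfl
  have f5 : f 5 = l₂ := rfl
  set c : ℕ → W := fun r => if r = 1 then y 1 else if r = 2 then y 4 else y 3 with hcdef
  have k1 : c 1 = y 1 := rfl
  have k2 : c 2 = y 4 := rfl
  have k3 : c 3 = y 3 := rfl
  clear_value f c
  have hcf : ∀ r, 1 ≤ r → r ≤ 3 → c r ∈ φ (f r) ∧ c r ∈ φ (f (r + 1)) ∧ c r ≠ y 2 ∧ c r ≠ Y := by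
    intro r h1 h3
    interval_cases r <;> simp [f1, f2, f3, f4, k1, k2, k3, e1, e2, e3, hg, n12, n24.symm, n23.symm,
      hY1, hY3, hY4]
  have hcm : ∀ r, 1 ≤ r → r ≤ 3 → ∀ q ≤ 5, c r ∈ φ (f q) → q = r ∨ q = r + 1 := by
    intro r h1 h3 q hq
    interval_cases r <;> interval_cases q <;>
      simp [f0, f1, f2, f3, f4, f5, k1, k2, k3, e1, e2, e3, hg, c1, c2, c3, d1, d2, d3, n12, n13,
        n14, n34, n13.symm, n14.symm, n23.symm, n24.symm, n34.symm]
  have hlt : ∀ q r, q + 2 ≤ r → r ≤ 5 → ¬ G.Adj (f q) (f r) := by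
    intro q r hqr hr
    have share : ∀ u v, G.Adj u v → ∃ z, z ∈ φ u ∧ z ∈ φ v := fun u v huv =>
      ((hφ.adj _ _).1 (hc.le huv)).2
    have n1 : ¬ G.Adj (h 1) (h 3) := fun hh => by
      obtain ⟨z, hz, hz'⟩ := share _ _ hh
      rw [e1, Sym2.mem_iff] at hz
      rw [e3, Sym2.mem_iff] at hz'
      rcases hz with rfl | rfl
      · exact hz'.elim n13 n14
      · exact hz'.elim n23 n24
    have n2 : ¬ G.Adj g (h 2) := fun hh => by
      obtain ⟨z, hz, hz'⟩ := share _ _ hh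
      rw [hg, Sym2.mem_iff] at hz
      rw [e2, Sym2.mem_iff] at hz'
      rcases hz with rfl | rfl
      · exact hz'.elim n12 n13
      · exact hz'.elim n24.symm n34.symm
    have hq3 : q ≤ 3 := by omega
    interval_cases q
    · have h0 : ∀ w, y 2 ∉ φ w → ¬ G.Adj (f 0) w := fun w hw hh => hw (hl1 w (f0 ▸ hh))
      interval_cases r
      · exact h0 _ (f2 ▸ hAg)
      · exact h0 _ (f3 ▸ hA3)
      · rwa [f0, f4]
      · rwa [f0, f5]
    · interval_cases r
      · rwa [f1, f3]
      · rwa [f1, f4]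
      · rwa [f1, f5]
    · interval_cases r
      · rwa [f2, f4]
      · rw [f2, f5]
        exact fun hh => hAg (hl2 _ hh.symm)
    · obtain rfl : r = 5 := by omega
      rw [f3, f5]
      exact fun hh => hA3 (hl2 _ hh.symm)
  set T : V → ℕ → Prop := fun v k => (∃ r ≤ 5, v = f r ∧ k = 2 * r) ∨
    ∃ r, 1 ≤ r ∧ r ≤ 3 ∧ Simp H v ∧ c r ∈ φ v ∧ (∀ q ≤ 5, v ≠ f q) ∧ k = 2 * r + 1 with hT
  set K : SimpleGraph V :=
    { Adj := fun u v => G.Adj u v ∧ (∃ k, T u k) ∧ ∃ k, T v k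
      symm := ⟨fun _ _ h => ⟨h.1.symm, h.2.2, h.2.1⟩⟩
      loopless := ⟨fun _ h => h.1.ne rfl⟩ } with hK
  have hodd : ∀ r v w, 1 ≤ r → r ≤ 3 → Simp H v → c r ∈ φ v → (∀ q ≤ 5, v ≠ f q) → H.Adj v w →
      c r ∈ φ w := fun r v w h1 h2 hs hm hv hvw =>
    hφ.mem_of_simp hs hm (hcf r h1 h2).1 (hv r (by omega)).symm hvw
  have huniq : ∀ r q v, 1 ≤ r → r < q → q ≤ 3 → c r ∈ φ v → c q ∈ φ v → ∃ q ≤ 5, v = f q := by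
    intro r q v h1 h2 h3 hr hq
    obtain ⟨rfl, rfl⟩ | ⟨rfl, rfl⟩ | ⟨rfl, rfl⟩ : (r = 1 ∧ q = 2) ∨ (r = 2 ∧ q = 3) ∨
        (r = 1 ∧ q = 3) := by omega
    · rw [k1] at hr; rw [k2] at hq
      exact ⟨2, by omega, f2 ▸ hφ.eq_of_mem n14 hr hq (by rw [hg]; simp) (by rw [hg]; simp)⟩
    · rw [k2] at hr; rw [k3] at hq
      exact ⟨3, by omega, f3 ▸ hφ.eq_of_mem n34 hq hr (by rw [e3]; simp) (by rw [e3]; simp)⟩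
    · rw [k1] at hr; rw [k3] at hq
      exact absurd (hφ.adj_of_eq ((Sym2.mem_and_mem_iff n13).1 ⟨hr, hq⟩)) t13
  have hclose : ∀ v w k l, K.Adj v w → T v k → T w l → Close k l := by
    rintro v w k l hvw (⟨r, hr, rfl, rfl⟩ | ⟨r, h1, h3, hs, hm, hv, rfl⟩)
      (⟨q, hq, rfl, rfl⟩ | ⟨q, h1', h3', hs', hm', hv', rfl⟩)
    · have p1 : ¬ q + 2 ≤ r := fun hh => hlt q r hh hr hvw.1.symm
      have p2 : ¬ r + 2 ≤ q := fun hh => hlt r q hh hq hvw.1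
      unfold Close
      omega
    · have := hcm q h1' h3' r hr (hodd q _ _ h1' h3' hs' hm' hv' (hc.le hvw.1.symm))
      unfold Close
      omega
    · have := hcm r h1 h3 q hq (hodd r _ _ h1 h3 hs hm hv (hc.le hvw.1))
      unfold Close
      omega
    · have hm'' := hodd r _ _ h1 h3 hs hm hv (hc.le hvw.1)
      rcases Nat.lt_trichotomy r q with hrq | rfl | hrq
      · obtain ⟨q', hq', e⟩ := huniq r q w h1 hrq h3' hm'' hm'
        exact absurd e (hv' q' hq')
      · unfold Close
        omega
      · obtain ⟨q', hq', e⟩ := huniq q r w h1' hrq h3 hm' hm''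
        exact absurd e (hv' q' hq')
  have htag : ∀ r ≤ 5, ∃ k, T (f r) k := fun r hr => ⟨_, Or.inl ⟨r, hr, rfl, rfl⟩⟩
  have K01 : K.Adj (f 0) (f 1) := ⟨f0 ▸ f1 ▸ adj1, htag 0 (by omega), htag 1 (by omega)⟩
  have K45 : K.Adj (f 4) (f 5) := ⟨f4 ▸ f5 ▸ adj2, htag 4 (by omega), htag 5 (by omega)⟩
  have hreach : ∀ r, 1 ≤ r → r ≤ 3 → K.Reachable (f r) (f (r + 1)) := by
    intro r h1 h3
    obtain ⟨m1, m2, -, -⟩ := hcf r h1 h3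
    have hne' : f r ≠ f (r + 1) := by
      intro e
      by_cases h3' : r = 3
      · subst h3'
        rw [f3, f4] at e
        exact hA3 (e ▸ (by rw [e2]; simp))
      · have := hcm (r + 1) (by omega) (by omega) r (by omega) (e ▸ (hcf (r + 1) (by omega)
          (by omega)).1)
        omega
    refine (hφ.starGraph_reachable hc.le m1 m2 hne' (hc.conn _ _ (hφ.adj_of_mem m1 m2 hne'))).mono ?_
    have key : ∀ u, (Simp H u ∧ c r ∈ φ u) ∨ u = f r ∨ u = f (r + 1) → ∃ k, T u k := by
      intro u hu
      by_cases hq : ∃ q ≤ 5, u = f q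
      · obtain ⟨q, hq, rfl⟩ := hq
        exact htag q hq
      · push Not at hq
        rcases hu with hu | rfl | rfl
        · exact ⟨_, Or.inr ⟨r, h1, h3, hu.1, hu.2, hq, rfl⟩⟩
        · exact absurd rfl (hq r (by omega))
        · exact absurd rfl (hq (r + 1) (by omega))
    exact fun u v huv => ⟨huv.1, key _ huv.2.1, key _ huv.2.2⟩
  have hend : ∀ l, y 2 ∈ φ l → (∀ q ≤ 5, l ≠ h q) → ∀ q, 1 ≤ q → q ≤ 4 → l ≠ f q := by
    intro l hl hh q h1 h4
    interval_cases q
    · exact f1 ▸ hh 1 (by omega)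
    · rw [f2]
      exact fun e => hAg (e ▸ hl)
    · exact f3 ▸ hh 3 (by omega)
    · exact f4 ▸ hh 2 (by omega)
  obtain ⟨m', s', κ', ι', ht'⟩ : ∃ m' s' κ' ι', Tagged K T f 5 m' s' κ' ι' := by
    refine exists_tagged (by omega) (by rwa [f0, f5]) (fun v w hvw => hvw.2.1) hclose ?_ ?_ ?_ ?_
    · rintro v r (⟨q, hq, rfl, e⟩ | ⟨q, -, -, -, -, -, e⟩)
      · congr 1
        omega
      · omega
    · rintro k (⟨q, hq, e, rfl⟩ | ⟨q, -, -, -, -, hv, e⟩)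
      · by_contra hq0
        rcases Nat.lt_or_ge q 5 with h5 | h5
        · exact hend l₁ a2 a3 q (by omega) (by omega) (f0 ▸ e)
        · obtain rfl : q = 5 := by omega
          exact hll (by rw [← f0, ← f5]; exact e)
      · exact absurd rfl (hv 0 (by omega))
    · rintro k (⟨q, hq, e, rfl⟩ | ⟨q, -, -, -, -, hv, e⟩)
      · by_contra hq0
        rcases Nat.eq_zero_or_pos q with rfl | h5
        · exact hll (by rw [← f0, ← f5]; exact e.symm)
        · exact hend l₂ b2 b3 q (by omega) (by omega) (f5 ▸ e)
      · exact absurd rfl (hv 5 (by omega))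
    · exact K01.reachable.trans ((hreach 1 (by omega) (by omega)).trans
        ((hreach 2 (by omega) (by omega)).trans ((hreach 3 (by omega) (by omega)).trans
          K45.reachable)))
  have hm5 := ht'.le_cut (r := 5) le_rfl
  rw [ht'.last] at hm5
  have hι4 := ht'.le_cut (r := 4) (by omega)
  have hι4m := ht'.le 4 (by omega)
  have hι1m := ht'.le 1 (by omega)
  have sf : ∀ r ≤ 5, s' (ι' r) = f r := ht'.at_cut
  have i1 : ι' 1 = 1 := by
    have := ht'.lt_succ (r := 0) (by omega)
    have hh := K01
    rw [← sf 0 (by omega), ← sf 1 (by omega), ht'.adj_iff (by rw [ht'.zero]; omega) hι1m,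
      ht'.zero] at hh
    omega
  have i4 : ι' 4 + 1 = m' := by
    have := ht'.lt_succ (r := 4) (by omega)
    have hh := K45
    rw [← sf 4 (by omega), ← sf 5 (by omega), ht'.adj_iff hι4m (by rw [ht'.last]), ht'.last] at hh
    rw [ht'.last] at this
    omega
  have hnear : ∀ i ≤ m', (y 2 ∈ φ (s' i) ∨ Y ∈ φ (s' i)) → i = 0 ∨ i = 1 ∨ i = ι' 4 ∨ i = m' := by
    intro i hi hn
    rcases ht'.tag i hi with ⟨q, hq, e, e'⟩ | ⟨q, h1, h3, hs, hm, hv, -⟩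
    · have hiq := ht'.eq_of_tag hq hi e'
      rw [e] at hn
      interval_cases q
      · exact Or.inl (hiq.trans ht'.zero)
      · exact Or.inr (Or.inl (hiq.trans i1))
      · rw [f2] at hn
        exact absurd hn (by rw [hg]; simp [n12.symm, n24, hY1.symm, hY4.symm])
      · rw [f3] at hn
        exact absurd hn (by rw [e3]; simp [n23, n24, hY3.symm, hY4.symm])
      · exact Or.inr (Or.inr (Or.inl hiq))
      · exact Or.inr (Or.inr (Or.inr (hiq.trans ht'.last)))
    · obtain ⟨m1, -, m2, m3⟩ := hcf q h1 h3
      exact ((hc.eq_of_simp hs hm m1 (hv q (by omega)).symm hn).elim m2 m3).elim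
  have hheavy : ∀ i j, i < j → j ≤ m' → Hv G (s' i) (s' j) → j = i + 1 ∨ (i = 0 ∧ 5 ≤ j) := by
    intro i j hij hj hh
    have q1 := hnear i (by omega) (hc.near _ _ hh)
    have q2 := hnear j hj (hc.near_right hh)
    by_contra hcon
    obtain ⟨rfl, rfl⟩ | ⟨rfl, rfl⟩ | ⟨rfl, rfl⟩ : (i = 0 ∧ j = ι' 4) ∨ (i = 1 ∧ j = ι' 4) ∨
        (i = 1 ∧ j = m') := by omega
    · have := sf 0 (by omega)
      rw [ht'.zero] at this
      rw [this, sf 4 (by omega), f0, f4] at hh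
      exact nhv1 hh
    · have := sf 1 (by omega)
      rw [i1] at this
      rw [this, sf 4 (by omega), f1, f4] at hh
      exact nhv2 hh
    · have := sf 1 (by omega)
      rw [i1] at this
      have h5 := sf 5 (by omega)
      rw [ht'.last] at h5
      rw [this, h5, f1, f5] at hh
      exact nhv3 hh
  refine ⟨fun i => s' i, ⟨fun i j e => ?_, fun i j => ?_⟩, fun i j hij => ?_⟩
  · have := ht'.inj (by omega) (by omega) e
    omega
  · rw [← ht'.adj_iff (i := i) (j := j) (by omega) (by omega)]
    exact ⟨fun hh => ⟨hh, ⟨_, ht'.tag i (by omega)⟩, ⟨_, ht'.tag j (by omega)⟩⟩, fun hh => hh.1⟩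
  · have hg3 := mem_gamma3 hij
    rcases Nat.lt_trichotomy i.val j.val with hlt' | hlt' | hlt'
    · intro hh
      have := hheavy i j hlt' (by omega) hh
      omega
    · omega
    · intro hh
      have := hheavy j i hlt' (by omega) hh.symm
      omega

end DetourWindow

section GammaThree

variable {V W : Type*} [Finite V] {G H : SimpleGraph V} {φ : V → Sym2 W} {X Y : W}

theorem HeavyCtx.lightP6_gamma3_of_clean (hc : HeavyCtx G H φ X Y) {a b : W}
    {I₁ I₂ I₃ : List W} {S₁ S₂ S₃ : Set W}
    (hab : a ≠ b) (h₁ : Branch (FU φ Set.univ) a b I₁ S₁) (h₂ : Branch (FU φ Set.univ) a b I₂ S₂)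
    (h₃ : Branch (FU φ Set.univ) a b I₃ S₃) (h₁₂ : Disjoint S₁ S₂) (h₁₃ : Disjoint S₁ S₃)
    (h₂₃ : Disjoint S₂ S₃) (hX : X ∉ I₂) (hY : Y ∉ I₂)
    (hub : 2 ≤ I₂.length ∨ (¬ (a = X ∨ a = Y) ∧ ¬ (b = X ∨ b = Y))) : LightP6 G gamma3 := by
  obtain ⟨u', u, v, v', -, -, -, -, -, -, hne, hn, hch⟩ := h₁.exists_path hab h₂ h₃ h₁₂ h₁₃ h₂₃
  obtain ⟨y, h, hp, hy⟩ := exists_edgePath (N := I₂.length + 4) hn hch (by simp)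
  obtain ⟨m, s, κ, ι, ht⟩ := hp.exists_lift hc.rep (by omega) hc.le hc.conn
  have hlen := List.length_pos_iff.2 hne
  have hI : ∀ w ∈ I₂, ¬ (w = X ∨ w = Y) := by
    rintro w hw (rfl | rfl)
    · exact hX hw
    · exact hY hw
  refine ht.lightP6_gamma3 hc hp (by omega) fun r hr h3 h4 hcrit => ?_
  exfalso
  have hyr := hy (r + 1) (by omega)
  match I₂, hI with
  | [], _ => exact absurd hlen (lt_irrefl _)
  | [p], hI =>
    simp only [List.length_cons, List.length_nil] at hub h4
    obtain ⟨ha, hb⟩ := hub.resolve_left (by omega)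
    obtain rfl | rfl | rfl : r = 1 ∨ r = 2 ∨ r = 3 := by omega
    all_goals
      simp only [List.cons_append, List.nil_append, List.getElem?_cons_succ,
        List.getElem?_cons_zero, Option.some.injEq] at hyr
      rw [← hyr] at hcrit
    · exact ha hcrit
    · exact hI p (by simp) hcrit
    · exact hb hcrit
  | p :: q :: t, hI =>
    simp only [List.length_cons] at h4
    obtain rfl | rfl : r = 2 ∨ r = 3 := by omega
    all_goals
      simp only [List.cons_append, List.getElem?_cons_succ,
        List.getElem?_cons_zero, Option.some.injEq] at hyr
      rw [← hyr] at hcrit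
    · exact hI p (by simp) hcrit
    · exact hI q (by simp) hcrit

theorem HeavyCtx.lightP6_gamma3_of_short {a : W} (hc : HeavyCtx G H φ a Y) {b p q : W}
    {I₃ : List W} {S₁ S₂ S₃ : Set W}
    (hab : a ≠ b) (h₁ : Branch (FU φ Set.univ) a b [p] S₁)
    (h₂ : Branch (FU φ Set.univ) a b [q] S₂)
    (h₃ : Branch (FU φ Set.univ) a b I₃ S₃) (h₁₂ : Disjoint S₁ S₂) (h₁₃ : Disjoint S₁ S₃)
    (h₂₃ : Disjoint S₂ S₃) (hYp : p ≠ Y) (hYq : q ≠ Y) (hYb : b ≠ Y) : LightP6 G gamma3 := by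
  have hpb : (FU φ Set.univ).Adj p b := by
    obtain ⟨_, v, hs, -, hvb, -⟩ := h₁.seg
    have e : p = v := by simpa using hs.2.2
    exact e ▸ hvb
  obtain ⟨u', u, v, v', -, -, -, -, -, hu, hne, hn, hch⟩ :=
    h₁.exists_path hab h₂ h₃ h₁₂ h₁₃ h₂₃
  obtain rfl : p = u := by simpa using hu
  obtain ⟨y, h, hp, hy⟩ := exists_edgePath (N := 5) hn hch (by simp)
  obtain ⟨m, s, κ, ι, ht⟩ := hp.exists_lift hc.rep (by omega) hc.le hc.conn
  have y1 := hy 1 (by omega)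
  have y2 := hy 2 (by omega)
  have y3 := hy 3 (by omega)
  have y4 := hy 4 (by omega)
  simp only [List.cons_append, List.nil_append, List.getElem?_cons_succ, List.getElem?_cons_zero,
    Option.some.injEq] at y1 y2 y3 y4
  subst y1 y2 y3 y4
  by_cases hlong : ι 1 + 4 ≤ ι 2
  · exact ht.lightP6_gamma3_of_long hc hp hYp hYq hYb hpb hlong
  · have hne : ∀ i j, i ≤ 6 → j ≤ 6 → i ≠ j → y i ≠ y j := fun i j hi hj hij e =>
      hij (hp.inj i j (by omega) (by omega) e)
    refine ht.lightP6_gamma3 hc hp le_rfl fun r hr h3 h4 hcrit => ?_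
    obtain rfl | rfl | rfl : r = 1 ∨ r = 2 ∨ r = 3 := by omega
    · simp only [Nat.reduceAdd]
      omega
    · exact absurd hcrit (not_or.2 ⟨hne 3 2 (by omega) (by omega) (by omega), hYq⟩)
    · exact absurd hcrit (not_or.2 ⟨hne 4 2 (by omega) (by omega) (by omega), hYb⟩)

theorem HeavyCtx.lightP6_gamma3_of_hub {a : W} (hc : HeavyCtx G H φ a Y) {b : W} (hab : a ≠ b)
    {I : Fin 3 → List W} {S : Fin 3 → Set W} (hB : ∀ i, Branch (FU φ Set.univ) a b (I i) (S i))
    (hd : ∀ i j, i ≠ j → Disjoint (S i) (S j)) : LightP6 G gamma3 := by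
  by_cases hex : ∃ j, 2 ≤ (I j).length ∧ Y ∉ I j
  · obtain ⟨j, h1, h2⟩ := hex
    obtain ⟨i, k, hij, hjk, hik⟩ := exists_others j
    exact hc.lightP6_gamma3_of_clean hab (hB i) (hB j) (hB k) (hd _ _ hij) (hd _ _ hik)
      (hd _ _ hjk) (fun h => (hB j).ha ((hB j).sub _ h)) h2 (Or.inl h1)
  · push Not at hex
    have hsing : ∀ j, Y ∉ I j → ∃ p, I j = [p] := by
      intro j hj
      have h1 : ¬ 2 ≤ (I j).length := fun h => hj (hex j h)
      obtain ⟨u, v, hs, -⟩ := (hB j).seg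
      have h2 := List.length_pos_iff.2 hs.ne_nil
      exact List.length_eq_one_iff.1 (by omega)
    obtain ⟨k, hk⟩ : ∃ k, ∀ j, j ≠ k → Y ∉ I j := by
      by_cases h : ∃ k, Y ∈ I k
      · obtain ⟨k, hk⟩ := h
        exact ⟨k, fun j hj hj' => Set.disjoint_left.1 (hd j k hj) ((hB j).sub _ hj')
          ((hB k).sub _ hk)⟩
      · push Not at h
        exact ⟨0, fun j _ => h j⟩
    obtain ⟨i, j, hik, hkj, hij⟩ := exists_others k
    obtain ⟨p, hp⟩ := hsing i (hk i hik)
    obtain ⟨q, hq⟩ := hsing j (hk j hkj.symm)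
    have hYi := hk i hik
    have hYj := hk j hkj.symm
    have h₁ := hB i
    have h₂ := hB j
    rw [hp] at h₁ hYi
    rw [hq] at h₂ hYj
    refine hc.lightP6_gamma3_of_short hab h₁ h₂ (hB k) (hd _ _ hij) (hd _ _ hik) (hd _ _ hkj.symm)
      (fun e => hYi (by simp [e])) (fun e => hYj (by simp [e])) ?_
    rintro rfl
    obtain ⟨u, v, hs, hau, hvb, -⟩ := h₁.seg
    have e1 : p = v := by simpa using hs.2.2
    have e2 : u = p := hs.head_eq.symm
    subst e1 e2
    exact hc.rep.not_triangle hau hvb hc.edge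

theorem HeavyCtx.lightP6_gamma3 (hc : HeavyCtx G H φ X Y) (hθ : IsTheta (FU φ Set.univ)) :
    LightP6 G gamma3 := by
  obtain ⟨a, b, hab, I, S, hB, hd⟩ := hθ
  by_cases ha : a = X
  · exact (ha ▸ hc : HeavyCtx G H φ a Y).lightP6_gamma3_of_hub hab hB hd
  by_cases ha' : a = Y
  · exact (ha' ▸ hc.swap : HeavyCtx G H φ a X).lightP6_gamma3_of_hub hab hB hd
  have hB' := fun i => (hB i).symm
  by_cases hb : b = X
  · exact (hb ▸ hc : HeavyCtx G H φ b Y).lightP6_gamma3_of_hub hab.symm hB' hd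
  by_cases hb' : b = Y
  · exact (hb' ▸ hc.swap : HeavyCtx G H φ b X).lightP6_gamma3_of_hub hab.symm hB' hd
  obtain ⟨j, hX, hY⟩ := exists_clean hd X Y
  obtain ⟨i, k, hij, hjk, hik⟩ := exists_others j
  exact hc.lightP6_gamma3_of_clean hab (hB i) (hB j) (hB k) (hd _ _ hij) (hd _ _ hik) (hd _ _ hjk)
    (fun h => hX ((hB j).sub _ h)) (fun h => hY ((hB j).sub _ h))
    (Or.inr ⟨not_or.2 ⟨ha, ha'⟩, not_or.2 ⟨hb, hb'⟩⟩)

end GammaThree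

section Main

variable {V : Type*}

theorem degree_eq_nd (G : SimpleGraph V) [Fintype V] [DecidableRel G.Adj] (v : V) :
    G.degree v = nd G v := by
  rw [nd, ← SimpleGraph.card_neighborSet_eq_degree, Set.ncard_eq_toFinset_card']
  simp

theorem hv_iff (G : SimpleGraph V) [Fintype V] [DecidableRel G.Adj] (u v : V) :
    Hv G u v ↔ Fintype.card V ≤ G.degree u + G.degree v := by
  rw [Hv, degree_eq_nd, degree_eq_nd, Nat.card_eq_fintype_card]

theorem ClawOHeavy.ch {G : SimpleGraph V} [Fintype V] [DecidableRel G.Adj] (h : ClawOHeavy G) :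
    CH G := by
  intro a b₁ b₂ b₃ h12 h13 h23 h1 h2 h3
  by_cases a12 : G.Adj b₁ b₂
  · exact Or.inl (le_hc G a12)
  by_cases a13 : G.Adj b₁ b₃
  · exact Or.inr (Or.inl (le_hc G a13))
  by_cases a23 : G.Adj b₂ b₃
  · exact Or.inr (Or.inr (le_hc G a23))
  obtain ⟨u, v, hu, hv, huv, hn, hd⟩ := h a b₁ b₂ b₃ h12 h13 h23 h1 h2 h3 a12 a13 a23
  have hc : (hc G).Adj u v := ⟨huv, Or.inr ((hv_iff G u v).2 hd)⟩
  simp only [Set.mem_insert_iff, Set.mem_singleton_iff] at hu hv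
  rcases hu with rfl | rfl | rfl | rfl <;> rcases hv with rfl | rfl | rfl | rfl <;>
    first
    | exact absurd rfl huv
    | exact absurd ‹G.Adj _ _› hn
    | exact absurd (SimpleGraph.Adj.symm ‹G.Adj _ _›) hn
    | exact absurd h1.symm hn
    | exact absurd h2.symm hn
    | exact absurd h3.symm hn
    | exact Or.inl hc
    | exact Or.inl hc.symm
    | exact Or.inr (Or.inl hc)
    | exact Or.inr (Or.inl hc.symm)
    | exact Or.inr (Or.inr hc)
    | exact Or.inr (Or.inr hc.symm)

theorem Ham.isHamiltonian {G : SimpleGraph V} [Fintype V] [DecidableEq V] (h : Ham G) :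
    G.IsHamiltonian := by
  obtain ⟨l, hn, hm, hl, u, v, hs, huv⟩ := h
  intro _
  obtain ⟨hc, hu, hv⟩ := hs
  have hne : l ≠ [] := by rintro rfl; simp at hl
  rw [List.head?_eq_some_head hne, Option.some_inj] at hu
  rw [List.getLast?_eq_some_getLast hne, Option.some_inj] at hv
  set p : G.Walk u v := (SimpleGraph.Walk.ofSupport l hne hc).copy hu hv with hp
  have hsup : p.support = l := by simp [hp]
  have hlen : p.length = l.length - 1 := by simp [hp]
  have hpath : p.IsPath := by rw [SimpleGraph.Walk.isPath_def, hsup]; exact hn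
  refine ⟨v, .cons huv p, ?_⟩
  rw [SimpleGraph.Walk.isHamiltonianCycle_iff_isCycle_and_support_count_tail_eq_one]
  constructor
  · rw [SimpleGraph.Walk.cons_isCycle_iff]
    refine ⟨hpath, fun he => ?_⟩
    have := hpath.length_eq_one_of_mem_edges (by rwa [Sym2.eq_swap] at he)
    omega
  · intro w
    rw [SimpleGraph.Walk.support_cons, List.tail_cons, hsup]
    exact List.count_eq_one_of_mem hn ((hm w).2 trivial)

theorem TwoConnected.tc {G H : SimpleGraph V} [Fintype V] (h : TwoConnected G) (hle : G ≤ H) :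
    TC H Set.univ := by
  refine ⟨by rw [Set.ncard_univ, Nat.card_eq_fintype_card]; exact h.1, fun z A hA hne hAne => ?_⟩
  by_contra hcon
  push Not at hcon
  obtain ⟨a, ha⟩ := hne
  obtain ⟨b, hb, hbA⟩ := Set.exists_of_ssubset (hA.ssubset_of_ne hAne)
  have hr := (h.2 z).preconnected ⟨a, (hA ha).2⟩ ⟨b, hb.2⟩
  refine hbA (hr.mem_of_closed (S := {w | w.1 ∈ A}) ?_ ha)
  rintro ⟨x, hx⟩ hxA ⟨y, hy⟩ hxy
  by_contra hyA
  exact hcon x hxA y ⟨⟨trivial, hy⟩, hyA⟩ (hle hxy)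

theorem exists_heavyCtx [Fintype V] {G : SimpleGraph V} [DecidableRel G.Adj]
    (h2 : TwoConnected G) (hcl : ClawOHeavy G) (hn : ¬ Ham G) :
    ∃ (H : SimpleGraph V) (φ : V → Sym2 (Set V)) (X Y : Set V), HeavyCtx G H φ X Y ∧
      IsTheta (FU φ Set.univ) := by
  obtain ⟨H, ⟨hle, hCH, hnH, hconn⟩, hel⟩ := exists_closure hcl.ch hn
  have hTC := h2.tc hle
  have hnb : ∀ v, ∃ u, H.Adj v u := by
    intro v
    obtain ⟨a, ha, b, -, hab⟩ := hTC.conn (A := {v}) (Set.subset_univ _) ⟨v, rfl⟩ (by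
      intro e
      have := hTC.1
      rw [← e, Set.ncard_singleton] at this
      omega)
    obtain rfl : a = v := ha
    exact ⟨b, hab⟩
  obtain ⟨φ, hφ⟩ := exists_rep hnb (exists_cliques hCH hel)
  have hθ := isTheta_of_not_hamOn hφ Set.univ hTC hnH
  have hadj : ∀ u v, Hv G u v → u ≠ v → H.Adj u v := fun u v huv hne =>
    adj_of_hc_adj hCH hel ⟨hne, Or.inr (huv.mono hle)⟩
  have : Nonempty V := Fintype.card_pos_iff.1 (by have := h2.1; omega)
  obtain ⟨p, hp⟩ := Finite.exists_max (nd G)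
  obtain ⟨X, Y, hXY⟩ : ∃ X Y, φ p = s(X, Y) := by
    induction h : φ p using Sym2.inductionOn with
    | hf X Y => exact ⟨X, Y, rfl⟩
  refine ⟨H, φ, X, Y, ⟨hle, hφ, hconn, hadj, fun u v huv => ?_, ?_, p, trivial, hXY⟩, hθ⟩
  · have hup : Hv G u p := le_trans huv (Nat.add_le_add_left (hp v) _)
    rcases eq_or_ne u p with rfl | hne
    · rw [hXY]; simp
    · obtain ⟨-, w, hw, hwp⟩ := (hφ.adj _ _).1 (hadj u p hup hne)
      rw [hXY, Sym2.mem_iff] at hwp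
      rcases hwp with rfl | rfl
      · exact Or.inl hw
      · exact Or.inr hw
  · rintro rfl
    exact hφ.ndiag p (by rw [hXY]; exact Sym2.mk_isDiag_iff.2 rfl)

/-- A `2`-connected claw-o-heavy graph satisfying one of the three `P₆` conditions is
hamiltonian. -/
theorem isHamiltonian_of_subset [Fintype V] [DecidableEq V] {G : SimpleGraph V}
    [DecidableRel G.Adj] {γ : Set (Sym2 (Fin 6))}
    (hγ : γ ⊆ gamma1 ∨ γ ⊆ gamma2 ∨ γ ⊆ gamma3)
    (h2 : TwoConnected G) (hcl : ClawOHeavy G) (hP : P6GammaHeavy G γ) : G.IsHamiltonian := by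
  by_contra hn
  obtain ⟨H, φ, X, Y, hc, hθ⟩ := exists_heavyCtx h2 hcl fun h => hn h.isHamiltonian
  have key : ∀ γ', γ ⊆ γ' → ¬ LightP6 G γ' := by
    rintro γ' hsub ⟨v, hv, hl⟩
    obtain ⟨i, j, hij, hd⟩ := hP v hv
    exact hl i j (hsub hij) ((hv_iff G _ _).2 hd)
  rcases hγ with h | h | h
  · exact key _ h (hc.lightP6_gamma1 hθ)
  · exact key _ h (hc.lightP6_gamma2 hθ)
  · exact key _ h (hc.lightP6_gamma3 hθ)

end Main

section CycleParity

variable {V : Type*}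

/-- The cyclic successor along a Hamilton cycle. -/
theorem SimpleGraph.IsHamiltonian.exists_perm [Fintype V] [DecidableEq V] {G : SimpleGraph V}
    (h : G.IsHamiltonian) (h1 : Fintype.card V ≠ 1) :
    ∃ σ : Equiv.Perm V, (∀ v, G.Adj v (σ v)) ∧
      ∀ S : Set V, (∀ v ∈ S, σ v ∈ S) → S.Nonempty → S = Set.univ := by
  obtain ⟨a, p, hp⟩ := h h1
  have hcyc := hp.isCycle
  set l := p.support.tail with hl
  have hn : l.Nodup := hcyc.support_nodup
  have hlen : l.length = p.length := by simp [hl]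
  have h3 := hcyc.three_le_length
  have hm : ∀ v, v ∈ l := fun v => by
    have := (SimpleGraph.Walk.isHamiltonianCycle_iff_isCycle_and_support_count_tail_eq_one.1 hp).2 v
    exact List.count_pos_iff.1 (this ▸ Nat.one_pos)
  have hget : ∀ i (hi : i < l.length), l[i] = p.getVert (i + 1) := by
    intro i hi
    rw [SimpleGraph.Walk.getVert_eq_support_getElem _ (by omega)]
    simp [hl]
  have hadj : ∀ v, G.Adj v (l.formPerm v) := by
    intro v
    obtain ⟨i, hi, rfl⟩ := List.mem_iff_getElem.1 (hm v)
    rw [List.formPerm_apply_getElem _ hn, hget, hget]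
    rcases Nat.lt_or_ge (i + 1) l.length with h | h
    · rw [Nat.mod_eq_of_lt h]
      exact p.adj_getVert_succ (by omega)
    · have h4 : i + 1 = l.length := by omega
      have h5 := p.adj_getVert_succ (i := 0) (by omega)
      rw [p.getVert_zero] at h5
      rwa [h4, Nat.mod_self, hlen, p.getVert_length]
  refine ⟨l.formPerm, hadj, fun S hS hne => ?_⟩
  obtain ⟨x, hx⟩ := hne
  ext y
  simp only [Set.mem_univ, iff_true]
  have hc : l.formPerm.IsCycle := List.isCycle_formPerm hn (by omega)
  obtain ⟨n, -, -, rfl⟩ := (hc.sameCycle (hadj x).ne' (hadj y).ne').exists_pow_eq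
  induction n with
  | zero => exact hx
  | succ n ih =>
    rw [pow_succ']
    exact hS _ ih

/-- As many steps of a permutation leave a set as enter it. -/
theorem sum_exit_eq_sum_enter [Fintype V] (σ : Equiv.Perm V) (S : Set V) [DecidablePred (· ∈ S)] :
    ∑ v, ((if v ∈ S ∧ σ v ∉ S then 1 else 0) : ℤ) = ∑ v, if v ∈ S ∧ σ.symm v ∉ S then 1 else 0 := by
  have h1 : ∑ v, ((if v ∈ S ∧ σ v ∈ S then 1 else 0) : ℤ) =
      ∑ v, if v ∈ S ∧ σ.symm v ∈ S then 1 else 0 := by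
    refine Fintype.sum_equiv σ _ _ fun v => ?_
    simp [and_comm]
  have h2 : ∀ τ : Equiv.Perm V, ∑ v, ((if v ∈ S ∧ τ v ∉ S then 1 else 0) : ℤ) =
      ∑ v, (if v ∈ S then 1 else 0) - ∑ v, if v ∈ S ∧ τ v ∈ S then 1 else 0 := by
    intro τ
    rw [← Finset.sum_sub_distrib]
    refine Finset.sum_congr rfl fun v _ => ?_
    by_cases hv : v ∈ S <;> by_cases hw : τ v ∈ S <;> simp [hv, hw]
  rw [h2 σ, h2 σ.symm, h1]

/-- A part attached through two vertices is traversed once from end to end. -/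
theorem traverse_part [Fintype V] {σ : Equiv.Perm V}
    (hσ : ∀ S : Set V, (∀ v ∈ S, σ v ∈ S) → S.Nonempty → S = Set.univ) {D : Set V} {a b : V}
    (ha : a ∈ D) (hb : b ∈ D) (hab : a ≠ b) (hD : ∀ v ∈ D, v ≠ a → v ≠ b → σ v ∈ D ∧ σ.symm v ∈ D)
    (hc : ∃ v ∈ D, v ≠ a ∧ v ≠ b) (hne : D ≠ Set.univ) : σ a ∈ D ↔ σ.symm a ∉ D := by
  classical
  have hsum : ∀ τ : Equiv.Perm V, (∀ v ∈ D, v ≠ a → v ≠ b → τ v ∈ D) →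
      ∑ v, ((if v ∈ D ∧ τ v ∉ D then 1 else 0) : ℤ) =
      (if τ a ∉ D then 1 else 0) + if τ b ∉ D then 1 else 0 := by
    intro τ hτ
    rw [← Finset.sum_subset (Finset.subset_univ {a, b}), Finset.sum_pair hab]
    · simp [ha, hb]
    · intro v _ hv
      simp only [Finset.mem_insert, Finset.mem_singleton, not_or] at hv
      rw [if_neg]
      exact fun h => h.2 (hτ v h.1 hv.1 hv.2)
  have key := sum_exit_eq_sum_enter σ D
  rw [hsum σ fun v h1 h2 h3 => (hD v h1 h2 h3).1,
    hsum σ.symm fun v h1 h2 h3 => (hD v h1 h2 h3).2] at key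
  have hclosed : ∀ T : Set V, T ⊆ D → T.Nonempty → ∃ v ∈ T, σ v ∉ T := by
    intro T hT hTn
    by_contra hcon
    push Not at hcon
    exact hne (Set.univ_subset_iff.1 (hσ T hcon hTn ▸ hT))
  obtain ⟨c, hcD, hca, hcb⟩ := hc
  by_cases h1 : σ a ∈ D <;> by_cases h2 : σ.symm a ∈ D <;> simp only [h1, h2, not_true, not_false_iff,
    if_true, if_false, iff_true, iff_false] at key ⊢
  · by_cases h3 : σ b ∈ D
    · obtain ⟨v, hv, hv2⟩ := hclosed D subset_rfl ⟨c, hcD⟩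
      by_cases hva : v = a
      · exact hv2 (hva ▸ h1)
      by_cases hvb : v = b
      · exact hv2 (hvb ▸ h3)
      exact hv2 (hD v hv hva hvb).1
    · have h4 : σ.symm b ∉ D := fun h => by simp [h3, h] at key
      obtain ⟨v, hv, hv2⟩ := hclosed (D \ {b}) Set.sdiff_subset ⟨c, hcD, hcb⟩
      refine hv2 ⟨?_, fun h => h4 ?_⟩
      · by_cases hva : v = a
        · exact hva ▸ h1
        exact (hD v hv.1 hva hv.2).1
      · rw [← Set.mem_singleton_iff.1 h, Equiv.symm_apply_apply]
        exact hv.1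
  · by_cases h3 : σ b ∈ D
    · have h4 : σ.symm b ∈ D := by
        by_contra h
        simp [h3, h] at key
      obtain ⟨v, hv, hv2⟩ := hclosed (D \ {a}) Set.sdiff_subset ⟨c, hcD, hca⟩
      refine hv2 ⟨?_, fun h => h2 ?_⟩
      · by_cases hvb : v = b
        · exact hvb ▸ h3
        exact (hD v hv.1 hv.2 hvb).1
      · rw [← Set.mem_singleton_iff.1 h, Equiv.symm_apply_apply]
        exact hv.1
    · have h4 : σ.symm b ∉ D := fun h => by simp [h3, h] at key
      obtain ⟨v, hv, hv2⟩ := hclosed (D \ {a, b}) Set.sdiff_subset ⟨c, hcD, by simp [hca, hcb]⟩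
      have hva : v ≠ a := fun h => hv.2 (by simp [h])
      have hvb : v ≠ b := fun h => hv.2 (by simp [h])
      refine hv2 ⟨(hD v hv.1 hva hvb).1, fun h => ?_⟩
      rcases h with h | h
      · refine h2 ?_
        rw [← h, Equiv.symm_apply_apply]
        exact hv.1
      · refine h4 ?_
        rw [← Set.mem_singleton_iff.1 h, Equiv.symm_apply_apply]
        exact hv.1

/-- A graph with three parts, each attached to a set `S` through one vertex and to the rest of
the graph through another one, has no Hamilton cycle. -/
theorem not_isHamiltonian_of_parts [Fintype V] [DecidableEq V] {G : SimpleGraph V} {S : Set V}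
    {D : Fin 3 → Set V} {a b : Fin 3 → V} (ha : Function.Injective a) (haS : ∀ i, a i ∈ S)
    (hS : ∀ v ∈ S, (∀ i, v ≠ a i) → ∀ w, G.Adj v w → w ∈ S)
    (haD : ∀ i, a i ∈ D i) (hbD : ∀ i, b i ∈ D i) (hab : ∀ i, a i ≠ b i)
    (hA : ∀ i w, G.Adj (a i) w → (w ∈ S ↔ w ∉ D i))
    (hD : ∀ i, ∀ v ∈ D i, v ≠ a i → v ≠ b i → ∀ w, G.Adj v w → w ∈ D i)
    (hc : ∀ i, ∃ v ∈ D i, v ≠ a i ∧ v ≠ b i) (hne : ∀ i, D i ≠ Set.univ) :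
    ¬ G.IsHamiltonian := by
  classical
  intro hG
  obtain ⟨σ, hadj, hσ⟩ := hG.exists_perm fun h =>
    absurd (ha ((Fintype.card_le_one_iff.1 h.le) (a 0) (a 1))) (by decide)
  have hadj' : ∀ v, G.Adj v (σ.symm v) := fun v => by
    have := hadj (σ.symm v)
    rw [Equiv.apply_symm_apply] at this
    exact this.symm
  have hsum : ∀ τ : Equiv.Perm V, (∀ v, G.Adj v (τ v)) →
      ∑ v, ((if v ∈ S ∧ τ v ∉ S then 1 else 0) : ℤ) = ∑ i, if τ (a i) ∉ S then 1 else 0 := by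
    intro τ hτ
    rw [← Finset.sum_subset (Finset.subset_univ (Finset.univ.map ⟨a, ha⟩)), Finset.sum_map]
    · simp [haS]
    · intro v _ hv
      rw [if_neg]
      refine fun h => h.2 (hS v h.1 (fun i hi => hv ?_) _ (hτ v))
      simp [hi]
  have key := sum_exit_eq_sum_enter σ S
  rw [hsum σ hadj, hsum σ.symm hadj'] at key
  have hpart : ∀ i, ((if σ.symm (a i) ∉ S then 1 else 0) : ℤ) =
      1 - if σ (a i) ∉ S then 1 else 0 := by
    intro i
    have h1 := traverse_part hσ (haD i) (hbD i) (hab i)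
      (fun v h1 h2 h3 => ⟨hD i v h1 h2 h3 _ (hadj v), hD i v h1 h2 h3 _ (hadj' v)⟩) (hc i) (hne i)
    have h2 := hA i _ (hadj (a i))
    have h3 := hA i _ (hadj' (a i))
    have h4 : σ.symm (a i) ∉ S ↔ σ (a i) ∈ S := by tauto
    by_cases h5 : σ (a i) ∈ S <;> simp [h4, h5]
  rw [Finset.sum_congr rfl fun i _ => hpart i, Finset.sum_sub_distrib] at key
  generalize (∑ i, if σ (a i) ∉ S then 1 else 0 : ℤ) = t at key
  simp only [Finset.sum_const, Finset.card_univ, Fintype.card_fin, nsmul_eq_mul] at key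
  omega

end CycleParity

section BlowUp

variable {k : ℕ}

/-- `p` and `q` are equal or joined by an edge from the list `es`. -/
def Near (es : List (ℕ × ℕ)) (p q : Fin k) : Prop :=
  p = q ∨ (p.val, q.val) ∈ es ∨ (q.val, p.val) ∈ es

instance (es : List (ℕ × ℕ)) : DecidableRel (Near (k := k) es) := fun _ _ =>
  inferInstanceAs (Decidable (_ ∨ _ ∨ _))

theorem Near.symm {es : List (ℕ × ℕ)} {p q : Fin k} (h : Near es p q) : Near es q p := by
  unfold Near at *
  tauto

theorem Near.refl (es : List (ℕ × ℕ)) (p : Fin k) : Near es p p := Or.inl rfl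

/-- The graph with edge list `es` in which the vertex `q` is replaced by a clique of order `w q`. -/
def blowUp (es : List (ℕ × ℕ)) (w : Fin k → ℕ) : SimpleGraph (Σ q : Fin k, Fin (w q)) where
  Adj x y := x ≠ y ∧ Near es x.1 y.1
  symm := ⟨fun _ _ h => ⟨h.1.symm, h.2.symm⟩⟩
  loopless := ⟨fun _ h => h.1 rfl⟩

instance (es : List (ℕ × ℕ)) (w : Fin k → ℕ) : DecidableRel (blowUp es w).Adj := fun _ _ =>
  inferInstanceAs (Decidable (_ ∧ _))

variable {es : List (ℕ × ℕ)} {w d : Fin k → ℕ} {n : ℕ}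

theorem blowUp_degree_add_one (x : Σ q : Fin k, Fin (w q)) :
    (blowUp es w).degree x + 1 = ∑ q, if Near es x.1 q then w q else 0 := by
  have h1 : insert x ((blowUp es w).neighborFinset x) =
      Finset.univ.filter fun y : Σ q : Fin k, Fin (w q) => Near es x.1 y.1 := by
    ext y
    simp only [Finset.mem_insert, SimpleGraph.mem_neighborFinset, Finset.mem_filter,
      Finset.mem_univ, true_and]
    constructor
    · rintro (rfl | h)
      · exact Near.refl _ _
      · exact h.2
    · intro h
      by_cases hxy : y = x
      · exact Or.inl hxy
      · exact Or.inr ⟨fun e => hxy e.symm, h⟩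
  rw [SimpleGraph.degree, ← Finset.card_insert_of_notMem (a := x) (by simp), h1, Finset.card_filter,
    Fintype.sum_sigma]
  refine Finset.sum_congr rfl fun q _ => ?_
  split_ifs <;> simp

/-- The listed order of the vertices is a bipolar ordering. -/
def Bipolar (k : ℕ) (es : List (ℕ × ℕ)) : Prop :=
  3 ≤ k ∧ (∀ q : Fin k, q.val = 0 ∨ ∃ p : Fin k, p < q ∧ Near es q p) ∧
  (∀ q : Fin k, q.val + 1 = k ∨ ∃ p : Fin k, q < p ∧ Near es q p) ∧
  ∀ p q : Fin k, p.val = 0 → q.val + 1 = k → Near es p q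

theorem blowUp_twoConnected (hw : ∀ q, 0 < w q) (h : Bipolar k es) :
    TwoConnected (blowUp es w) := by
  obtain ⟨hk, hlow, hhigh, hends⟩ := h
  set r : Fin k → Σ q : Fin k, Fin (w q) := fun q => ⟨q, 0, hw q⟩ with hr
  refine ⟨?_, fun v => ?_⟩
  · rw [Fintype.card_sigma]
    simp only [Fintype.card_fin]
    calc 3 ≤ ∑ _q : Fin k, 1 := by simpa
      _ ≤ _ := Finset.sum_le_sum fun q _ => hw q
  set K := (blowUp es w).induce ({v}ᶜ : Set _) with hK
  have hadj : ∀ x y (hx : x ≠ v) (hy : y ≠ v), Near es x.1 y.1 →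
      K.Reachable ⟨x, hx⟩ ⟨y, hy⟩ := by
    intro x y hx hy hxy
    by_cases e : x = y
    · subst e; rfl
    · exact SimpleGraph.Adj.reachable (show (blowUp es w).Adj x y from ⟨e, hxy⟩)
  set s : Fin k := ⟨0, by omega⟩
  set t : Fin k := ⟨k - 1, by omega⟩
  have hne : ∀ q, q ≠ v.1 → r q ≠ v := fun q hq e => hq (by rw [← e])
  have down : ∀ (hs : s ≠ v.1) (m : ℕ) x (hx : x ≠ v), x.1.val = m → x.1 ≤ v.1 →
      K.Reachable ⟨x, hx⟩ ⟨r s, hne s hs⟩ := by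
    intro hs m
    induction m using Nat.strong_induction_on with
    | _ m ih =>
      intro x hx hxm hxv
      rcases hlow x.1 with h0 | ⟨p, hp, hpq⟩
      · refine hadj _ _ _ _ ?_
        rw [show x.1 = s from Fin.ext h0]
        exact Near.refl _ _
      · have hpv : p ≠ v.1 := (lt_of_lt_of_le hp hxv).ne
        exact (hadj x (r p) hx (hne p hpv) hpq).trans
          (ih p.val (hxm ▸ hp) (r p) (hne p hpv) rfl (hp.le.trans hxv))
  have up : ∀ (ht : t ≠ v.1) (m : ℕ) x (hx : x ≠ v), k - x.1.val = m → v.1 ≤ x.1 →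
      K.Reachable ⟨x, hx⟩ ⟨r t, hne t ht⟩ := by
    intro ht m
    induction m using Nat.strong_induction_on with
    | _ m ih =>
      intro x hx hxm hxv
      rcases hhigh x.1 with h0 | ⟨p, hp, hpq⟩
      · refine hadj _ _ _ _ ?_
        rw [show x.1 = t from Fin.ext (by simp only [t]; omega)]
        exact Near.refl _ _
      · have hpv : p ≠ v.1 := (lt_of_le_of_lt hxv hp).ne'
        have h1 : x.1.val < p.val := hp
        have h2 := p.isLt
        exact (hadj x (r p) hx (hne p hpv) hpq).trans
          (ih (k - p.val) (by omega) (r p) (hne p hpv) rfl (hxv.trans hp.le))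
  rw [SimpleGraph.connected_iff_exists_forall_reachable]
  by_cases hs : s = v.1
  · have ht : t ≠ v.1 := by
      rw [← hs]
      intro e
      have := congrArg Fin.val e
      simp only [s, t] at this
      omega
    refine ⟨⟨r t, hne t ht⟩, fun ⟨x, hx⟩ => (up ht _ x hx rfl ?_).symm⟩
    rw [← hs]
    exact Nat.zero_le _
  · refine ⟨⟨r s, hne s hs⟩, fun ⟨x, hx⟩ => ?_⟩
    rcases le_total x.1 v.1 with hxv | hxv
    · exact (down hs _ x hx rfl hxv).symm
    · by_cases ht : t = v.1
      · refine (down hs _ x hx rfl ?_).symm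
        rw [← ht]
        exact Nat.le_sub_one_of_lt x.1.isLt
      · exact (hadj (r s) (r t) _ (hne t ht) (hends s t rfl (by simp only [t]; omega))).trans
          (up ht _ x hx rfl hxv).symm

/-- Degrees and order of a blow-up. -/
def Sizes (es : List (ℕ × ℕ)) (w d : Fin k → ℕ) (n : ℕ) : Prop :=
  (∀ q, 0 < w q) ∧ ∑ q, w q = n ∧ ∀ q, ∑ p, (if Near es q p then w p else 0) = d q + 1

theorem Sizes.degree_eq (h : Sizes es w d n) (x : Σ q : Fin k, Fin (w q)) :
    (blowUp es w).degree x = d x.1 := by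
  have := blowUp_degree_add_one (es := es) x
  rw [h.2.2] at this
  omega

theorem Sizes.card_eq (h : Sizes es w d n) : Fintype.card (Σ q : Fin k, Fin (w q)) = n := by
  rw [Fintype.card_sigma, ← h.2.1]
  simp

/-- The claw condition, read off the quotient of a blow-up. -/
def ClawCheck (es : List (ℕ × ℕ)) (d : Fin k → ℕ) (n : ℕ) : Prop :=
  ∀ a b₁ : Fin k, Near es a b₁ → ∀ b₂, Near es a b₂ → ¬ Near es b₁ b₂ →
    ∀ b₃, Near es a b₃ → ¬ Near es b₁ b₃ → ¬ Near es b₂ b₃ →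
    n ≤ d b₁ + d b₂ ∨ n ≤ d b₁ + d b₃ ∨ n ≤ d b₂ + d b₃

instance : Decidable (ClawCheck es d n) := by
  unfold ClawCheck
  infer_instance

theorem blowUp_clawOHeavy (h : Sizes es w d n) (hc : ClawCheck es d n) :
    ClawOHeavy (blowUp es w) := by
  intro a b₁ b₂ b₃ h12 h13 h23 h1 h2 h3 n12 n13 n23
  have key := hc a.1 b₁.1 h1.2 b₂.1 h2.2 (fun h => n12 ⟨h12, h⟩) b₃.1 h3.2 (fun h => n13 ⟨h13, h⟩)
    (fun h => n23 ⟨h23, h⟩)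
  simp only [← h.degree_eq] at key
  rw [h.card_eq]
  rcases key with key | key | key
  · exact ⟨b₁, b₂, by simp, by simp, h12, n12, key⟩
  · exact ⟨b₁, b₃, by simp, by simp, h13, n13, key⟩
  · exact ⟨b₂, b₃, by simp, by simp, h23, n23, key⟩

/-- The `P₆` condition for the pairs in `L`, read off the quotient of a blow-up. -/
def PathCheck (es : List (ℕ × ℕ)) (d : Fin k → ℕ) (n : ℕ) (L : List (Fin 6 × Fin 6)) : Prop :=
  ∀ p₀ p₁ : Fin k, Near es p₀ p₁ → ∀ p₂, Near es p₁ p₂ → ¬ Near es p₀ p₂ →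
    ∀ p₃, Near es p₂ p₃ → ¬ Near es p₀ p₃ → ¬ Near es p₁ p₃ →
    ∀ p₄, Near es p₃ p₄ → ¬ Near es p₀ p₄ → ¬ Near es p₁ p₄ → ¬ Near es p₂ p₄ →
    ∀ p₅, Near es p₄ p₅ → ¬ Near es p₀ p₅ → ¬ Near es p₁ p₅ → ¬ Near es p₂ p₅ → ¬ Near es p₃ p₅ →
    ∃ e ∈ L, n ≤ d (![p₀, p₁, p₂, p₃, p₄, p₅] e.1) + d (![p₀, p₁, p₂, p₃, p₄, p₅] e.2)

instance {L : List (Fin 6 × Fin 6)} : Decidable (PathCheck es d n L) := by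
  unfold PathCheck
  infer_instance

theorem blowUp_p6GammaHeavy (h : Sizes es w d n) {L : List (Fin 6 × Fin 6)}
    (hL : PathCheck es d n L) {γ : Set (Sym2 (Fin 6))} (hγ : ∀ e ∈ L, s(e.1, e.2) ∈ γ) :
    P6GammaHeavy (blowUp es w) γ := by
  rintro v ⟨hinj, hv⟩
  have hy : ∀ i j : Fin 6, (i.val + 1 = j.val ∨ j.val + 1 = i.val) → Near es (v i).1 (v j).1 :=
    fun i j hij => ((hv i j).2 hij).2
  have hno : ∀ i j : Fin 6, i ≠ j → ¬ (i.val + 1 = j.val ∨ j.val + 1 = i.val) →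
      ¬ Near es (v i).1 (v j).1 :=
    fun i j hij h1 h2 => h1 ((hv i j).1 ⟨fun e => hij (hinj e), h2⟩)
  obtain ⟨e, he, hd⟩ := hL (v 0).1 (v 1).1 (hy 0 1 (by decide))
    (v 2).1 (hy 1 2 (by decide)) (hno 0 2 (by decide) (by decide))
    (v 3).1 (hy 2 3 (by decide)) (hno 0 3 (by decide) (by decide)) (hno 1 3 (by decide) (by decide))
    (v 4).1 (hy 3 4 (by decide)) (hno 0 4 (by decide) (by decide)) (hno 1 4 (by decide) (by decide))
    (hno 2 4 (by decide) (by decide))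
    (v 5).1 (hy 4 5 (by decide)) (hno 0 5 (by decide) (by decide)) (hno 1 5 (by decide) (by decide))
    (hno 2 5 (by decide) (by decide)) (hno 3 5 (by decide) (by decide))
  have hvec : ∀ i : Fin 6, ![(v 0).1, (v 1).1, (v 2).1, (v 3).1, (v 4).1, (v 5).1] i = (v i).1 := by
    intro i
    fin_cases i <;> rfl
  rw [hvec, hvec, ← h.degree_eq, ← h.degree_eq, ← h.card_eq] at hd
  exact ⟨e.1, e.2, hγ e he, hd⟩

/-- The three-part structure of `not_isHamiltonian_of_parts`, read off the quotient of a
blow-up. -/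
def PartsCheck (es : List (ℕ × ℕ)) (w : Fin k → ℕ) (S : List (Fin k)) (D : Fin 3 → List (Fin k))
    (a b : Fin 3 → Fin k) : Prop :=
  (∀ i j, a i ∈ D j → i = j) ∧
  (∀ i, w (a i) = 1 ∧ w (b i) = 1 ∧ a i ∈ S ∧ a i ∈ D i ∧ b i ∈ D i ∧ a i ≠ b i) ∧
  (∀ p ∈ S, (∀ i, p ≠ a i) → ∀ q, Near es p q → q ∈ S) ∧
  (∀ i q, q ≠ a i → Near es (a i) q → (q ∈ S ↔ q ∉ D i)) ∧
  (∀ i, ∀ p ∈ D i, p ≠ a i → p ≠ b i → ∀ q, Near es p q → q ∈ D i) ∧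
  ∀ i, ∃ p ∈ D i, p ≠ a i ∧ p ≠ b i

instance {S : List (Fin k)} {D : Fin 3 → List (Fin k)} {a b : Fin 3 → Fin k} :
    Decidable (PartsCheck es w S D a b) := by
  unfold PartsCheck
  set_option synthInstance.maxHeartbeats 200000 in
  set_option synthInstance.maxSize 1000 in
  infer_instance

theorem blowUp_not_isHamiltonian (hw : ∀ q, 0 < w q) {S : List (Fin k)} {D : Fin 3 → List (Fin k)}
    {a b : Fin 3 → Fin k} (h : PartsCheck es w S D a b) : ¬ (blowUp es w).IsHamiltonian := by
  obtain ⟨h1, h2, h3, h4, h5, h6⟩ := h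
  set r : Fin k → Σ q : Fin k, Fin (w q) := fun q => ⟨q, 0, hw q⟩ with hr
  have huniq : ∀ x : Σ q : Fin k, Fin (w q), w x.1 = 1 → x = r x.1 := by
    rintro ⟨q, j⟩ hq
    have : j = ⟨0, hw q⟩ := Fin.ext (by have := j.isLt; simp only at hq; omega)
    rw [this]
  have hxa : ∀ x i, x ≠ r (a i) → x.1 ≠ a i := fun x i hx e => hx (by
    rw [← e]; exact huniq x (by rw [e]; exact (h2 i).1))
  have hxb : ∀ x i, x ≠ r (b i) → x.1 ≠ b i := fun x i hx e => hx (by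
    rw [← e]; exact huniq x (by rw [e]; exact (h2 i).2.1))
  refine not_isHamiltonian_of_parts (S := {x | x.1 ∈ S}) (D := fun i => {x | x.1 ∈ D i})
    (a := fun i => r (a i)) (b := fun i => r (b i)) ?_ (fun i => (h2 i).2.2.1) ?_
    (fun i => (h2 i).2.2.2.1) (fun i => (h2 i).2.2.2.2.1) ?_ ?_ ?_ ?_ ?_
  · intro i j hij
    refine h1 i j ?_
    rw [show a i = a j from congrArg Sigma.fst hij]
    exact (h2 j).2.2.2.1
  · exact fun x hx hxi y hxy => h3 _ hx (fun i => hxa x i (hxi i)) _ hxy.2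
  · exact fun i e => (h2 i).2.2.2.2.2 (congrArg Sigma.fst e)
  · exact fun i y hy => h4 i y.1 (hxa y i fun e => hy.1 e.symm) hy.2
  · exact fun i x hx hxi hxi' y hxy => h5 i _ hx (hxa x i hxi) (hxb x i hxi') _ hxy.2
  · intro i
    obtain ⟨p, hp, hpa, hpb⟩ := h6 i
    exact ⟨r p, hp, fun e => hpa (congrArg Sigma.fst e), fun e => hpb (congrArg Sigma.fst e)⟩
  · intro i hi
    have : ∀ j, a j ∈ D i := fun j => (hi ▸ Set.mem_univ (r (a j)) : r (a j) ∈ {x | x.1 ∈ D i})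
    exact absurd ((h1 0 i (this 0)).trans (h1 1 i (this 1)).symm) (by decide)

end BlowUp

section Counterexamples

/-- Every `2`-connected claw-o-heavy and `P₆`-`γ`-heavy graph is hamiltonian. -/
def ForcesHam (γ : Set (Sym2 (Fin 6))) : Prop :=
  ∀ (V : Type) [Fintype V] [DecidableEq V] (G : SimpleGraph V) [DecidableRel G.Adj],
    TwoConnected G → ClawOHeavy G → P6GammaHeavy G γ → G.IsHamiltonian

/-- The blow-up of `es` by `w` is `2`-connected, claw-o-heavy and not hamiltonian. -/
def Certified {k : ℕ} (es : List (ℕ × ℕ)) (w d : Fin k → ℕ) (n : ℕ) (S : List (Fin k))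
    (D : Fin 3 → List (Fin k)) (a b : Fin 3 → Fin k) : Prop :=
  Sizes es w d n ∧ Bipolar k es ∧ ClawCheck es d n ∧ PartsCheck es w S D a b

instance {k : ℕ} {es : List (ℕ × ℕ)} {w d : Fin k → ℕ} {n : ℕ} {S : List (Fin k)}
    {D : Fin 3 → List (Fin k)} {a b : Fin 3 → Fin k} : Decidable (Certified es w d n S D a b) := by
  unfold Certified Sizes Bipolar
  infer_instance

theorem Certified.not_forcesHam {k : ℕ} {es : List (ℕ × ℕ)} {w d : Fin k → ℕ} {n : ℕ}
    {S : List (Fin k)} {D : Fin 3 → List (Fin k)} {a b : Fin 3 → Fin k}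
    (h : Certified es w d n S D a b) {γ : Set (Sym2 (Fin 6))} (hsym : SymmetricalGamma γ)
    (L : List (Fin 6 × Fin 6)) (hL : PathCheck es d n (L ++ L.map (Prod.map Fin.rev Fin.rev)))
    (hγ : ∀ e ∈ L, s(e.1, e.2) ∈ γ) : ¬ ForcesHam γ := by
  obtain ⟨h1, h2, h3, h4⟩ := h
  refine fun hall => blowUp_not_isHamiltonian h1.1 h4 (hall _ _ (blowUp_twoConnected h1.1 h2)
    (blowUp_clawOHeavy h1 h3) (blowUp_p6GammaHeavy h1 hL fun e he => ?_))
  rcases List.mem_append.1 he with he | he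
  · exact hγ e he
  · obtain ⟨e', he', rfl⟩ := List.mem_map.1 he
    exact (hsym _).1 (hγ e' he')

theorem certified_ten : Certified
    [(0, 1), (0, 2), (0, 3), (0, 8), (0, 9), (1, 4), (1, 5), (1, 8), (1, 9), (2, 3), (3, 5), (3, 6),
      (4, 5), (5, 6), (6, 7), (6, 9), (7, 9), (8, 9)]
    ![1, 1, 1, 1, 1, 1, 1, 1, 1, 1] ![5, 5, 2, 4, 2, 4, 4, 2, 3, 5] 10 [0, 1, 8, 9]
    ![[0, 3, 2], [9, 6, 7], [1, 5, 4]] ![0, 9, 1] ![3, 6, 5] := by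
  decide +kernel

theorem certified_fourteen : Certified
    [(0, 1), (0, 4), (0, 8), (1, 2), (1, 3), (1, 8), (2, 3), (3, 5), (3, 6), (4, 5), (5, 6), (6, 7),
      (6, 8), (7, 8)]
    ![1, 1, 1, 1, 6, 1, 1, 1, 1] ![8, 4, 2, 4, 7, 8, 4, 2, 4] 14 [0, 1, 8]
    ![[0, 5, 4], [8, 6, 7], [1, 3, 2]] ![0, 8, 1] ![5, 6, 3] := by
  decide +kernel

theorem certified_fourteen_centre : Certified
    [(0, 1), (0, 2), (0, 9), (1, 9), (2, 3), (2, 4), (3, 5), (3, 6), (4, 7), (4, 8), (5, 6), (6, 8),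
      (6, 9), (7, 8), (8, 9)]
    ![1, 1, 5, 1, 1, 1, 1, 1, 1, 1] ![7, 2, 7, 7, 7, 2, 4, 2, 4, 4] 14 [0, 2, 3, 4]
    ![[0, 9, 1], [3, 6, 5], [4, 8, 7]] ![0, 3, 4] ![9, 6, 8] := by
  decide +kernel

theorem certified_twentyfive : Certified
    [(0, 1), (0, 9), (1, 2), (2, 3), (2, 4), (3, 4), (3, 5), (3, 6), (4, 7), (4, 8), (5, 6), (6, 8),
      (6, 9), (7, 8), (8, 9)]
    ![1, 11, 1, 1, 1, 1, 1, 1, 1, 6] ![17, 12, 13, 4, 4, 2, 9, 2, 9, 8] 25 [0, 6, 8, 9]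
    ![[0, 2, 1], [6, 3, 5], [8, 4, 7]] ![0, 6, 8] ![2, 3, 4] := by
  decide +kernel

theorem certified_fifty : Certified
    [(0, 1), (0, 2), (0, 12), (1, 12), (2, 3), (3, 4), (3, 8), (4, 5), (5, 6), (5, 7), (6, 7),
      (7, 11), (7, 12), (8, 9), (9, 10), (9, 11), (10, 11), (11, 12)]
    ![1, 1, 8, 17, 8, 1, 1, 1, 8, 1, 1, 1, 1] ![10, 2, 25, 40, 25, 10, 2, 4, 25, 10, 2, 4, 4] 50
    [0, 2, 3, 4, 5, 8, 9] ![[0, 12, 1], [5, 7, 6], [9, 11, 10]] ![0, 5, 9] ![12, 7, 11] := by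
  decide +kernel

variable {γ : Set (Sym2 (Fin 6))} (hsym : SymmetricalGamma γ)
include hsym

theorem ForcesHam.not_mem (h : ForcesHam γ) : s(1, 1) ∉ γ ∧ s(2, 2) ∉ γ ∧ s(1, 2) ∉ γ :=
  ⟨fun hm => certified_ten.not_forcesHam hsym [(1, 1)] (by decide +kernel) (by simpa using hm) h,
    fun hm => certified_ten.not_forcesHam hsym [(2, 2)] (by decide +kernel) (by simpa using hm) h,
    fun hm => certified_ten.not_forcesHam hsym [(1, 2)] (by decide +kernel) (by simpa using hm) h⟩

theorem ForcesHam.not_mem_of_end (h : ForcesHam γ) (he : s(0, 0) ∈ γ ∨ s(0, 1) ∈ γ) :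
    s(1, 3) ∉ γ ∧ s(2, 3) ∉ γ := by
  constructor <;> intro hm <;> rcases he with he | he
  · exact certified_fourteen.not_forcesHam hsym [(0, 0), (1, 3)] (by decide +kernel)
      (by simpa using ⟨he, hm⟩) h
  · exact certified_fourteen.not_forcesHam hsym [(0, 1), (1, 3)] (by decide +kernel)
      (by simpa using ⟨he, hm⟩) h
  · exact certified_fourteen.not_forcesHam hsym [(0, 0), (2, 3)] (by decide +kernel)
      (by simpa using ⟨he, hm⟩) h
  · exact certified_fourteen.not_forcesHam hsym [(0, 1), (2, 3)] (by decide +kernel)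
      (by simpa using ⟨he, hm⟩) h

theorem ForcesHam.not_mem_of_skip (h : ForcesHam γ) (he : s(0, 2) ∈ γ) :
    s(0, 0) ∉ γ ∧ s(0, 1) ∉ γ ∧ s(0, 5) ∉ γ ∧ s(1, 3) ∉ γ ∧ s(2, 3) ∉ γ := by
  refine ⟨fun hm => ?_, fun hm => ?_, fun hm => ?_, fun hm => ?_, fun hm => ?_⟩
  · exact certified_fifty.not_forcesHam hsym [(0, 2), (0, 0)] (by decide +kernel)
      (by simpa using ⟨he, hm⟩) h
  · exact certified_twentyfive.not_forcesHam hsym [(0, 2), (0, 1)] (by decide +kernel)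
      (by simpa using ⟨he, hm⟩) h
  · exact certified_fifty.not_forcesHam hsym [(0, 2), (0, 5)] (by decide +kernel)
      (by simpa using ⟨he, hm⟩) h
  · exact certified_fourteen_centre.not_forcesHam hsym [(0, 2), (1, 3)] (by decide +kernel)
      (by simpa using ⟨he, hm⟩) h
  · exact certified_fourteen_centre.not_forcesHam hsym [(0, 2), (2, 3)] (by decide +kernel)
      (by simpa using ⟨he, hm⟩) h

theorem ForcesHam.subset (h : ForcesHam γ) : γ ⊆ gamma1 ∨ γ ⊆ gamma2 ∨ γ ⊆ gamma3 := by
  have hrev : ∀ i j : Fin 6, s(i, j) ∈ γ ↔ s(i.rev, j.rev) ∈ γ := fun i j => hsym s(i, j)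
  obtain ⟨hb, hc, hi⟩ := ForcesHam.not_mem hsym h
  have hsub : ∀ γ' : Set (Sym2 (Fin 6)), (∀ i j : Fin 6, i ≤ j → s(i, j) ∈ γ → s(i, j) ∈ γ') →
      γ ⊆ γ' := by
    intro γ' h e he
    induction e using Sym2.inductionOn with
    | hf i j =>
      rcases le_total i j with hij | hij
      · exact h i j hij he
      · rw [Sym2.eq_swap] at he ⊢
        exact h j i hij he
  have h00 : s(5, 5) ∈ γ ↔ s(0, 0) ∈ γ := hrev 5 5
  have h11 : s(4, 4) ∈ γ ↔ s(1, 1) ∈ γ := hrev 4 4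
  have h22 : s(3, 3) ∈ γ ↔ s(2, 2) ∈ γ := hrev 3 3
  have h01 : s(4, 5) ∈ γ ↔ s(0, 1) ∈ γ := (hrev 4 5).trans (by rw [Sym2.eq_swap]; rfl)
  have h02 : s(3, 5) ∈ γ ↔ s(0, 2) ∈ γ := (hrev 3 5).trans (by rw [Sym2.eq_swap]; rfl)
  have h12 : s(3, 4) ∈ γ ↔ s(1, 2) ∈ γ := (hrev 3 4).trans (by rw [Sym2.eq_swap]; rfl)
  have h13 : s(2, 4) ∈ γ ↔ s(1, 3) ∈ γ := (hrev 2 4).trans (by rw [Sym2.eq_swap]; rfl)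
  by_cases hskip : s(0, 2) ∈ γ
  · obtain ⟨n1, n2, n3, n4, n5⟩ := ForcesHam.not_mem_of_skip hsym h hskip
    refine Or.inr (Or.inr (hsub _ fun i j hij hm => ?_))
    fin_cases i <;> fin_cases j <;> first
      | exact absurd hij (by decide)
      | (simp [gamma3]; done)
      | (clear hrev hsub hsym h; simp_all)
  by_cases hend : s(0, 0) ∈ γ ∨ s(0, 1) ∈ γ
  · obtain ⟨n1, n2⟩ := ForcesHam.not_mem_of_end hsym h hend
    refine Or.inr (Or.inl (hsub _ fun i j hij hm => ?_))
    fin_cases i <;> fin_cases j <;> first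
      | exact absurd hij (by decide)
      | (simp [gamma2]; done)
      | (clear hrev hsub hsym h; simp_all)
  · refine Or.inl (hsub _ fun i j hij hm => ?_)
    fin_cases i <;> fin_cases j <;> first
      | exact absurd hij (by decide)
      | (simp [gamma1]; done)
      | (clear hrev hsub hsym h; simp_all)

end Counterexamples

/-- Let `γ` be a symmetrical graph on `I`.  Then every 2-connected claw-o-heavy and
`P₆`-`γ`-heavy graph is hamiltonian if and only if `γ` is a subgraph of `γ₁`, `γ₂` or `γ₃`. -/
theorem stmt_6 (γ : Set (Sym2 (Fin 6))) (hsym : SymmetricalGamma γ) :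
    (∀ (V : Type) [Fintype V] [DecidableEq V] (G : SimpleGraph V) [DecidableRel G.Adj],
      TwoConnected G → ClawOHeavy G → P6GammaHeavy G γ → G.IsHamiltonian)
    ↔ (γ ⊆ gamma1 ∨ γ ⊆ gamma2 ∨ γ ⊆ gamma3) :=
  ⟨fun h => ForcesHam.subset hsym h, fun hγ _ _ _ _ _ h2 hcl hP =>
    isHamiltonian_of_subset hγ h2 hcl hP⟩
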